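/- arXiv:1508.00867 — 2 statements merged into one kernel-verified Lean document; each statement's English description precedes it below -/
import Mathlib

section
/- Let p be an imitation kernel with G-stochastic function P_(·). Then 𝒢(p) has exactly one element if and only if P_(·) has exactly one closed intercommunicating class R and the states of R are aperiodic relative to gcd(A), i.e. for every (equivalently, some) i ∈ R, gcd{ s(𝐚) : 𝐚 a word with P_𝐚(i,i) > 0 } = gcd(A). -/
open MeasureTheory
open scoped BigOperators

/-- The matrix of a word `𝐚 = (a_1, …, a_n)` (encoded as a list `[a_1, …, a_n]`),
namely `P_𝐚 = P_(a_n) ⋯ P_(a_1)`, so that `wordK P l i j` is the `(i,j)` entry. -/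
noncomputable def wordK {G : Type*} [Fintype G] [DecidableEq G]
    (P : ℕ → G → G → ℝ) : List ℕ → G → G → ℝ
  | [] => fun i j => if i = j then 1 else 0
  | a :: l => fun i j => ∑ m, wordK P l i m * P a m j

/-- A word over the alphabet `A`: a nonempty finite tuple with entries in `A`. -/
def IsWord (A : Set ℕ) (l : List ℕ) : Prop := l ≠ [] ∧ ∀ a ∈ l, a ∈ A

/-- `i` communicates with `j` if `P_𝐚(i,j) > 0` for some word `𝐚`. -/
def Communicates {G : Type*} [Fintype G] [DecidableEq G]
    (A : Set ℕ) (P : ℕ → G → G → ℝ) (i j : G) : Prop :=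
  ∃ l : List ℕ, IsWord A l ∧ 0 < wordK P l i j

/-- `i` and `j` intercommunicate (every state intercommunicates with itself). -/
def Intercommunicates {G : Type*} [Fintype G] [DecidableEq G]
    (A : Set ℕ) (P : ℕ → G → G → ℝ) (i j : G) : Prop :=
  i = j ∨ (Communicates A P i j ∧ Communicates A P j i)

/-- An intercommunicating class: an equivalence class of the intercommunication relation. -/
def IsInterClass {G : Type*} [Fintype G] [DecidableEq G]
    (A : Set ℕ) (P : ℕ → G → G → ℝ) (C : Set G) : Prop :=
  ∃ i : G, C = {j | Intercommunicates A P i j}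

/-- A set `C` is closed if whenever `i ∈ C` communicates with `j`, then `j ∈ C`. -/
def IsClosedClass {G : Type*} [Fintype G] [DecidableEq G]
    (A : Set ℕ) (P : ℕ → G → G → ℝ) (C : Set G) : Prop :=
  ∀ i ∈ C, ∀ j : G, Communicates A P i j → j ∈ C

/-- `d` is the greatest common divisor of the set `S ⊆ ℕ`. -/
def IsGCDOfSet (S : Set ℕ) (d : ℕ) : Prop :=
  (∀ n ∈ S, d ∣ n) ∧ ∀ e : ℕ, (∀ n ∈ S, e ∣ n) → e ∣ d

/-- The set of depths `s(𝐚)` of words `𝐚` with `P_𝐚(i,i) > 0`. -/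
def ReturnDepths {G : Type*} [Fintype G] [DecidableEq G]
    (A : Set ℕ) (P : ℕ → G → G → ℝ) (i : G) : Set ℕ :=
  {s | ∃ l : List ℕ, IsWord A l ∧ 0 < wordK P l i i ∧ l.sum = s}

/-- `E` is measurable with respect to the coordinates `(x_m)_{m < n}`. -/
def PastMeasurable {G : Type*} [MeasurableSpace G] (n : ℤ) (E : Set (ℤ → G)) : Prop :=
  MeasurableSet[MeasurableSpace.comap
    (fun x : ℤ → G => fun m : {m : ℤ // m < n} => x m.1) MeasurableSpace.pi] E

/-- `μ` is compatible with the imitation kernel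
`p(g | w_{-1}, w_{-2}, …) = ∑_{k ∈ A} θ_k P_(k)(w_{-k}, g)` (here `θ` vanishes off `A`). -/
def Compatible {G : Type*} [MeasurableSpace G] (θ : ℕ → ℝ) (P : ℕ → G → G → ℝ)
    (μ : Measure (ℤ → G)) : Prop :=
  ∀ (n : ℤ) (g : G) (E : Set (ℤ → G)), PastMeasurable n E →
    (μ (E ∩ {x | x n = g})).toReal
      = ∫ x in E, (∑' k : ℕ, θ k * P k (x (n - (k : ℤ))) g) ∂μ

/-- The standing assumptions on the data `(A, θ, P)` of an imitation kernel. -/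
structure IsImitation {G : Type*} [Fintype G] (A : Set ℕ) (θ : ℕ → ℝ) (P : ℕ → G → G → ℝ) :
    Prop where
  pos : ∀ k ∈ A, 0 < k
  weight_pos : ∀ k ∈ A, 0 < θ k
  weight_zero : ∀ k, k ∉ A → θ k = 0
  weight_sum : HasSum θ 1
  nonneg : ∀ k ∈ A, ∀ i j : G, 0 ≤ P k i j
  row : ∀ k ∈ A, ∀ i : G, ∑ j, P k i j = 1

/-- The imitation kernel at time `n`, evaluated along the configuration `x`. -/
noncomputable def imitKernel {G : Type*} (θ : ℕ → ℝ) (P : ℕ → G → G → ℝ) (n : ℤ) (x : ℤ → G)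
    (g : G) : ℝ :=
  ∑' k : ℕ, θ k * P k (x (n - (k : ℤ))) g

namespace IsImitation

variable {G : Type*} [Fintype G] {A : Set ℕ} {θ : ℕ → ℝ} {P : ℕ → G → G → ℝ}

theorem weight_nonneg (h : IsImitation A θ P) (k : ℕ) : 0 ≤ θ k := by
  by_cases hk : k ∈ A
  · exact (h.weight_pos k hk).le
  · exact (h.weight_zero k hk).ge

theorem le_one (h : IsImitation A θ P) {k : ℕ} (hk : k ∈ A) (i j : G) : P k i j ≤ 1 := by
  rw [← h.row k hk i]
  exact Finset.single_le_sum (fun j _ => h.nonneg k hk i j) (Finset.mem_univ j)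

theorem term_nonneg (h : IsImitation A θ P) (k : ℕ) (i j : G) : 0 ≤ θ k * P k i j := by
  by_cases hk : k ∈ A
  · exact mul_nonneg (h.weight_nonneg k) (h.nonneg k hk i j)
  · simp [h.weight_zero k hk]

theorem term_le (h : IsImitation A θ P) (k : ℕ) (i j : G) : θ k * P k i j ≤ θ k := by
  by_cases hk : k ∈ A
  · exact mul_le_of_le_one_right (h.weight_nonneg k) (h.le_one hk i j)
  · simp [h.weight_zero k hk]

theorem term_norm_le (h : IsImitation A θ P) (k : ℕ) (i j : G) : ‖θ k * P k i j‖ ≤ θ k := by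
  rw [Real.norm_of_nonneg (h.term_nonneg k i j)]
  exact h.term_le k i j

theorem summable_term (h : IsImitation A θ P) (n : ℤ) (x : ℤ → G) (g : G) :
    Summable fun k : ℕ => θ k * P k (x (n - (k : ℤ))) g :=
  Summable.of_norm_bounded h.weight_sum.summable fun k => h.term_norm_le k _ g

theorem hasSum_kernel (h : IsImitation A θ P) (n : ℤ) (x : ℤ → G) (g : G) :
    HasSum (fun k : ℕ => θ k * P k (x (n - (k : ℤ))) g) (imitKernel θ P n x g) :=
  (h.summable_term n x g).hasSum

theorem kernel_nonneg (h : IsImitation A θ P) (n : ℤ) (x : ℤ → G) (g : G) :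
    0 ≤ imitKernel θ P n x g :=
  tsum_nonneg fun k => h.term_nonneg k _ g

theorem sum_kernel (h : IsImitation A θ P) (n : ℤ) (x : ℤ → G) :
    ∑ g, imitKernel θ P n x g = 1 := by
  have h1 := hasSum_sum (s := Finset.univ) fun g _ => h.hasSum_kernel n x g
  refine h1.unique ?_
  convert h.weight_sum using 1
  ext k
  rw [← Finset.mul_sum]
  by_cases hk : k ∈ A
  · rw [h.row k hk, mul_one]
  · simp [h.weight_zero k hk]

theorem sum_ofReal_kernel (h : IsImitation A θ P) (n : ℤ) (x : ℤ → G) :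
    ∑ g, ENNReal.ofReal (imitKernel θ P n x g) = 1 := by
  rw [← ENNReal.ofReal_sum_of_nonneg fun g _ => h.kernel_nonneg n x g, h.sum_kernel,
    ENNReal.ofReal_one]

theorem kernel_le_one (h : IsImitation A θ P) (n : ℤ) (x : ℤ → G) (g : G) :
    imitKernel θ P n x g ≤ 1 := by
  rw [← h.sum_kernel n x]
  exact Finset.single_le_sum (fun j _ => h.kernel_nonneg n x j) (Finset.mem_univ g)

theorem kernel_congr (h : IsImitation A θ P) {n : ℤ} {x y : ℤ → G} (hxy : ∀ m < n, x m = y m)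
    (g : G) : imitKernel θ P n x g = imitKernel θ P n y g := by
  refine tsum_congr fun k => ?_
  by_cases hk : k ∈ A
  · have := h.pos k hk
    rw [hxy (n - k) (by omega)]
  · simp [h.weight_zero k hk]

theorem exists_of_kernel_pos {n : ℤ} {x : ℤ → G} {g : G}
    (h : IsImitation A θ P) (hpos : imitKernel θ P n x g ≠ 0) :
    ∃ k ∈ A, 0 < P k (x (n - (k : ℤ))) g := by
  by_contra! hcon
  refine hpos ?_
  unfold imitKernel
  convert tsum_zero with k
  by_cases hk : k ∈ A
  · rw [le_antisymm (hcon k hk) (h.nonneg k hk _ _), mul_zero]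
  · simp [h.weight_zero k hk]

theorem continuous_kernel [TopologicalSpace G] [DiscreteTopology G] (h : IsImitation A θ P)
    (n : ℤ) (g : G) : Continuous fun x : ℤ → G => imitKernel θ P n x g := by
  refine continuous_tsum (fun k => ?_) h.weight_sum.summable fun k x => h.term_norm_le k _ g
  exact continuous_const.mul
    ((continuous_of_discreteTopology (f := fun i => P k i g)).comp (continuous_apply _))

theorem measurable_kernel [MeasurableSpace G] [MeasurableSingletonClass G]
    (h : IsImitation A θ P) (n : ℤ) (g : G) :
    Measurable fun x : ℤ → G => imitKernel θ P n x g := by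
  let _ : TopologicalSpace G := ⊥
  have : DiscreteTopology G := ⟨rfl⟩
  exact (h.continuous_kernel n g).measurable

end IsImitation

/-- Two finite measures on a product of copies of a finite set which agree on all elementary
cylinders are equal. -/
theorem Measure.ext_of_forall_cylinder {G ι : Type*} [Fintype G] [Nonempty G]
    [MeasurableSpace G] [MeasurableSingletonClass G] (μ ν : Measure (ι → G))
    [IsFiniteMeasure μ] [IsFiniteMeasure ν]
    (h : ∀ (F : Finset ι) (v : ι → G), μ {x | ∀ i ∈ F, x i = v i} = ν {x | ∀ i ∈ F, x i = v i}) :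
    μ = ν := by
  classical
  have key : ∀ F : Finset ι, ν.map F.restrict = μ.map F.restrict := by
    intro F
    refine Measure.ext_of_singleton fun v => ?_
    rw [Measure.map_apply (Finset.measurable_restrict F) (measurableSet_singleton v),
      Measure.map_apply (Finset.measurable_restrict F) (measurableSet_singleton v)]
    obtain ⟨g⟩ := ‹Nonempty G›
    have e : F.restrict ⁻¹' ({v} : Set (F → G)) =
        {x : ι → G | ∀ i ∈ F, x i = (fun i => if hi : i ∈ F then v ⟨i, hi⟩ else g) i} := by
      ext x
      simp only [Set.mem_preimage, Set.mem_singleton_iff, Set.mem_ofPred_eq, funext_iff,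
        Finset.restrict, Subtype.forall]
      refine forall₂_congr fun i hi => ?_
      simp [hi]
    rw [e, h F]
  exact IsProjectiveLimit.unique (P := fun F => μ.map F.restrict) (fun F => rfl) key

theorem measurableSet_coord_eq {G ι : Type*} [MeasurableSpace G] [MeasurableSingletonClass G]
    (n : ι) (g : G) : MeasurableSet {x : ι → G | x n = g} :=
  (measurableSet_singleton g).preimage (measurable_pi_apply n)

theorem measurableSet_cylinder {G ι κ : Type*} [MeasurableSpace G] [MeasurableSingletonClass G]
    (F : Finset κ) (t : κ → ι) (v : κ → G) :
    MeasurableSet {x : ι → G | ∀ m ∈ F, x (t m) = v m} := by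
  have : {x : ι → G | ∀ m ∈ F, x (t m) = v m} = ⋂ m ∈ F, {x | x (t m) = v m} := by
    ext x; simp
  rw [this]
  exact F.measurableSet_biInter fun m _ => measurableSet_coord_eq (t m) (v m)

section Existence

variable {G : Type*} [Fintype G] [MeasurableSpace G] [MeasurableSingletonClass G]
  {A : Set ℕ} {θ : ℕ → ℝ} {P : ℕ → G → G → ℝ}

/-- It suffices to check compatibility on elementary cylinders of the past. -/
theorem compatible_of_cylinder [Nonempty G] (h : IsImitation A θ P) (μ : Measure (ℤ → G))
    [IsProbabilityMeasure μ]
    (hμ : ∀ (n : ℤ) (g : G) (F : Finset {m : ℤ // m < n}) (v : {m : ℤ // m < n} → G),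
      μ ({x | ∀ m ∈ F, x m.1 = v m} ∩ {x | x n = g}) =
        ∫⁻ x in {x | ∀ m ∈ F, x m.1 = v m}, ENNReal.ofReal (imitKernel θ P n x g) ∂μ) :
    Compatible θ P μ := by
  intro n g E hE
  obtain ⟨E', hE', rfl⟩ := hE
  set ρ : (ℤ → G) → ({m : ℤ // m < n} → G) := fun x m => x m.1 with hρ
  have hρm : Measurable ρ := measurable_pi_lambda _ fun m => measurable_pi_apply _
  have hg : MeasurableSet {x : ℤ → G | x n = g} := measurableSet_coord_eq n g
  have hfin : ∫⁻ x, ENNReal.ofReal (imitKernel θ P n x g) ∂μ ≠ ⊤ := by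
    refine ((lintegral_mono (g := fun _ => 1) fun x => ?_).trans_lt ?_).ne
    · exact ENNReal.ofReal_le_one.2 (h.kernel_le_one n x g)
    · simp
  have := isFiniteMeasure_withDensity hfin
  have heq : (μ.restrict {x | x n = g}).map ρ =
      (μ.withDensity fun x => ENNReal.ofReal (imitKernel θ P n x g)).map ρ := by
    refine Measure.ext_of_forall_cylinder _ _ fun F v => ?_
    have hc : MeasurableSet {x : {m : ℤ // m < n} → G | ∀ m ∈ F, x m = v m} :=
      measurableSet_cylinder F id v
    have hc' := measurableSet_cylinder F Subtype.val v
    rw [Measure.map_apply hρm hc, Measure.map_apply hρm hc, Measure.restrict_apply' hg]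
    exact (hμ n g F v).trans (withDensity_apply _ hc').symm
  have hE2 := congrArg (fun ν : Measure _ => ν E') heq
  simp only [Measure.map_apply hρm hE', Measure.restrict_apply' hg,
    withDensity_apply _ (hρm hE')] at hE2
  rw [hE2]
  exact (integral_eq_lintegral_of_nonneg_ae (ae_of_all _ fun x => h.kernel_nonneg n x g)
    (h.measurable_kernel n g).aestronglyMeasurable).symm

open Classical in
/-- The law of the configuration obtained from `w` by resampling successively, according to the
imitation kernel, the sites `s, s + 1, …, s + c - 1`. -/
noncomputable def resampleLaw (θ : ℕ → ℝ) (P : ℕ → G → G → ℝ) :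
    ℕ → ℤ → (ℤ → G) → Measure (ℤ → G)
  | 0, _, w => Measure.dirac w
  | c + 1, s, w => ∑ g, ENNReal.ofReal (imitKernel θ P s w g) •
      resampleLaw θ P c (s + 1) (Function.update w s g)

omit [MeasurableSingletonClass G] in
open Classical in
theorem lintegral_resampleLaw_succ (c : ℕ) (s : ℤ) (w : ℤ → G) (f : (ℤ → G) → ENNReal) :
    ∫⁻ x, f x ∂(resampleLaw θ P (c + 1) s w) = ∑ g, ENNReal.ofReal (imitKernel θ P s w g) *
      ∫⁻ x, f x ∂(resampleLaw θ P c (s + 1) (Function.update w s g)) := by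
  simp [resampleLaw, lintegral_finsetSum_measure, lintegral_smul_measure]

omit [MeasurableSingletonClass G] in
/-- Functions of the coordinates before `s` are not affected by resampling from `s` on. -/
theorem lintegral_resampleLaw_of_past (h : IsImitation A θ P) (f : (ℤ → G) → ENNReal)
    (hf : Measurable f) : ∀ (c : ℕ) (s : ℤ) (w : ℤ → G),
    (∀ x y : ℤ → G, (∀ m < s, x m = y m) → f x = f y) →
    ∫⁻ x, f x ∂(resampleLaw θ P c s w) = f w := by
  classical
  intro c
  induction c with
  | zero => intro s w _; exact lintegral_dirac' w hf
  | succ c ih =>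
    intro s w hs
    rw [lintegral_resampleLaw_succ]
    have : ∀ g, ∫⁻ x, f x ∂(resampleLaw θ P c (s + 1) (Function.update w s g)) = f w := by
      intro g
      rw [ih (s + 1) _ fun x y hxy => hs x y fun m hm => hxy m (by omega)]
      exact hs _ _ fun m hm => Function.update_of_ne hm.ne _ _
    simp_rw [this]
    rw [← Finset.sum_mul, h.sum_ofReal_kernel, one_mul]

omit [MeasurableSingletonClass G] in
theorem resampleLaw_isProbabilityMeasure (h : IsImitation A θ P) (c : ℕ) (s : ℤ) (w : ℤ → G) :
    IsProbabilityMeasure (resampleLaw θ P c s w) := by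
  constructor
  simpa using lintegral_resampleLaw_of_past h (fun _ => 1) measurable_const c s w
    fun _ _ _ => rfl

open Classical in
/-- The resampled law has the prescribed conditional probabilities at the resampled sites. -/
theorem lintegral_resampleLaw_kernel (h : IsImitation A θ P) (n : ℤ) (g : G)
    (f : (ℤ → G) → ENNReal) (hf : Measurable f)
    (hpast : ∀ x y : ℤ → G, (∀ m < n, x m = y m) → f x = f y) :
    ∀ (c : ℕ) (s : ℤ) (w : ℤ → G), s ≤ n → n < s + c →
    ∫⁻ x, f x * (if x n = g then 1 else 0) ∂(resampleLaw θ P c s w) =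
      ∫⁻ x, f x * ENNReal.ofReal (imitKernel θ P n x g) ∂(resampleLaw θ P c s w) := by
  have hm1 : Measurable fun x : ℤ → G => f x * (if x n = g then 1 else 0) :=
    hf.mul (Measurable.ite (measurableSet_coord_eq n g)
      measurable_const measurable_const)
  have hm2 : Measurable fun x : ℤ → G => f x * ENNReal.ofReal (imitKernel θ P n x g) :=
    hf.mul (h.measurable_kernel n g).ennreal_ofReal
  intro c
  induction c with
  | zero => intro s w h1 h2; simp at h2; omega
  | succ c ih =>
    intro s w h1 h2
    rcases h1.eq_or_lt with rfl | h1
    · rw [lintegral_resampleLaw_of_past h (fun x => f x * ENNReal.ofReal (imitKernel θ P s x g))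
        hm2 (c + 1) s w fun x y hxy => by rw [hpast x y hxy, h.kernel_congr hxy],
        lintegral_resampleLaw_succ]
      have : ∀ g', ∫⁻ x, f x * (if x s = g then 1 else 0)
          ∂(resampleLaw θ P c (s + 1) (Function.update w s g')) =
          f w * if g' = g then 1 else 0 := by
        intro g'
        rw [lintegral_resampleLaw_of_past h (fun x => f x * (if x s = g then 1 else 0)) hm1 c
          (s + 1) _ fun x y hxy => by
            rw [hpast x y fun m hm => hxy m (by omega), hxy s (by omega)],
          hpast _ w fun m hm => Function.update_of_ne hm.ne _ _, Function.update_self]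
      simp_rw [this]
      simp [mul_comm]
    · rw [lintegral_resampleLaw_succ, lintegral_resampleLaw_succ]
      refine Finset.sum_congr rfl fun g' _ => ?_
      rw [ih (s + 1) _ (by omega) (by push_cast at h2; omega)]

omit [MeasurableSingletonClass G] in
/-- Resampling preserves families of sets which are stable under the kernel. -/
theorem lintegral_resampleLaw_eq_zero (h : IsImitation A θ P) (S : ℤ → Set G)
    (hS : ∀ n, ∀ k ∈ A, ∀ i ∈ S (n - (k : ℤ)), ∀ j, 0 < P k i j → j ∈ S n)
    (f : (ℤ → G) → ENNReal) (hf : Measurable f) (hf0 : ∀ x, (∀ n, x n ∈ S n) → f x = 0) :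
    ∀ (c : ℕ) (s : ℤ) (w : ℤ → G), (∀ n, w n ∈ S n) →
      ∫⁻ x, f x ∂(resampleLaw θ P c s w) = 0 := by
  classical
  intro c
  induction c with
  | zero => intro s w hw; rw [← hf0 w hw]; exact lintegral_dirac' w hf
  | succ c ih =>
    intro s w hw
    rw [lintegral_resampleLaw_succ]
    refine Finset.sum_eq_zero fun g _ => ?_
    by_cases hg : imitKernel θ P s w g = 0
    · simp [hg]
    · obtain ⟨k, hk, hpos⟩ := h.exists_of_kernel_pos hg
      rw [ih (s + 1) _ fun n => ?_, mul_zero]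
      by_cases hn : n = s
      · subst hn
        rw [Function.update_self]
        exact hS n k hk _ (hw _) g hpos
      · rw [Function.update_of_ne hn]
        exact hw n

theorem exists_compatible [Nonempty G] (h : IsImitation A θ P) (S : ℤ → Set G)
    (hne : ∀ n, (S n).Nonempty)
    (hS : ∀ n, ∀ k ∈ A, ∀ i ∈ S (n - (k : ℤ)), ∀ j, 0 < P k i j → j ∈ S n) :
    ∃ μ : Measure (ℤ → G), (IsProbabilityMeasure μ ∧ Compatible θ P μ) ∧
      ∀ n, ∀ᵐ x ∂μ, x n ∈ S n := by
  classical
  let _ : TopologicalSpace G := ⊥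
  have : DiscreteTopology G := ⟨rfl⟩
  choose w hw using hne
  let ν : ℕ → ProbabilityMeasure (ℤ → G) := fun N =>
    ⟨resampleLaw θ P (2 * N + 1) (-N) w, resampleLaw_isProbabilityMeasure h _ _ _⟩
  obtain ⟨μ, -, hμ⟩ := isCompact_univ.ultrafilter_le_nhds
    ((Filter.hyperfilter ℕ).map ν) (by simp)
  have hlim := ProbabilityMeasure.tendsto_iff_forall_lintegral_tendsto.1
    (show Filter.Tendsto ν (Filter.hyperfilter ℕ) (nhds μ) from hμ)
  have hlim' : ∀ f : (ℤ → G) → NNReal, Continuous f → Filter.Tendsto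
      (fun N : ℕ => ∫⁻ x, f x ∂(resampleLaw θ P (2 * N + 1) (-N) w))
      (Filter.hyperfilter ℕ) (nhds (∫⁻ x, f x ∂(μ : Measure (ℤ → G)))) := fun f hf =>
    hlim (BoundedContinuousFunction.mkOfCompact ⟨f, hf⟩)
  have hite : ∀ (E : Set (ℤ → G)) [DecidablePred (· ∈ E)], IsClopen E →
      Continuous fun x : ℤ → G => if x ∈ E then (1 : NNReal) else 0 := by
    intro E _ hE
    refine Continuous.if (fun a ha => ?_) continuous_const continuous_const
    simp [hE.frontier_eq] at ha
  have hcl : ∀ (n : ℤ) (s : Set G), IsClopen {x : ℤ → G | x n ∈ s} := fun n s =>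
    (isClopen_discrete s).preimage (continuous_apply n)
  refine ⟨μ, ⟨inferInstance, compatible_of_cylinder h _ fun n g F v => ?_⟩, fun n => ?_⟩
  · set E : Set (ℤ → G) := {x | ∀ m ∈ F, x m.1 = v m} with hEdef
    have hEm : MeasurableSet E := measurableSet_cylinder F Subtype.val v
    have hEc : IsClopen E := by
      have : E = ⋂ m ∈ F, {x : ℤ → G | x m.1 ∈ ({v m} : Set G)} := by
        ext x; simp [hEdef]
      rw [this]
      exact isClopen_biInter_finset fun m _ => hcl _ _
    have hgm : MeasurableSet {x : ℤ → G | x n = g} :=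
      measurableSet_coord_eq n g
    have e1 : μ.toMeasure (E ∩ {x | x n = g}) =
        ∫⁻ x, (((if x ∈ E then (1 : NNReal) else 0) * if x n = g then 1 else 0 : NNReal) : ENNReal)
          ∂μ.toMeasure := by
      rw [← lintegral_indicator_one (hEm.inter hgm)]
      refine lintegral_congr fun x => ?_
      by_cases h1 : x ∈ E <;> by_cases h2 : x n = g <;> simp [h1, h2]
    have e2 : ∫⁻ x in E, ENNReal.ofReal (imitKernel θ P n x g) ∂μ.toMeasure =
        ∫⁻ x, (((if x ∈ E then (1 : NNReal) else 0) * (imitKernel θ P n x g).toNNReal : NNReal)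
          : ENNReal) ∂μ.toMeasure := by
      rw [← lintegral_indicator hEm]
      refine lintegral_congr fun x => ?_
      by_cases h1 : x ∈ E <;> simp [h1, ENNReal.ofReal]
    rw [e1, e2]
    have hc1 : Continuous fun x : ℤ → G =>
        ((if x ∈ E then (1 : NNReal) else 0) * if x n = g then 1 else 0) :=
      (hite E hEc).mul (hite {x | x n = g} (hcl n {g}))
    have hc2 : Continuous fun x : ℤ → G =>
        ((if x ∈ E then (1 : NNReal) else 0) * (imitKernel θ P n x g).toNNReal) :=
      (hite E hEc).mul (continuous_real_toNNReal.comp (h.continuous_kernel n g))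
    refine tendsto_nhds_unique (hlim' _ hc1) ((hlim' _ hc2).congr' ?_)
    refine Nat.hyperfilter_le_atTop ((Filter.eventually_ge_atTop n.natAbs).mono fun N hN => ?_)
    have := lintegral_resampleLaw_kernel h n g (fun x => if x ∈ E then (1 : ENNReal) else 0)
      (Measurable.ite hEm measurable_const measurable_const)
      (fun x y hxy => by
        have : x ∈ E ↔ y ∈ E := forall₂_congr fun m _ => by rw [hxy m.1 m.2]
        simp [this]) (2 * N + 1) (-N) w (by omega) (by push_cast; omega)
    symm
    convert this using 3 with x x
    · by_cases h1 : x ∈ E <;> by_cases h2 : x n = g <;> simp [h1, h2]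
    · by_cases h1 : x ∈ E <;> simp [h1, ENNReal.ofReal]
  · set B : Set (ℤ → G) := {x | x n ∈ (S n)ᶜ} with hB
    have hm : MeasurableSet B := measurable_pi_apply n (Set.toFinite (S n)ᶜ).measurableSet
    rw [ae_iff]
    change μ.toMeasure B = 0
    rw [← lintegral_indicator_one hm]
    have e1 : ∫⁻ x, B.indicator 1 x ∂μ.toMeasure =
        ∫⁻ x, ((if x ∈ B then (1 : NNReal) else 0 : NNReal) : ENNReal) ∂μ.toMeasure := by
      refine lintegral_congr fun x => ?_
      by_cases h1 : x ∈ B <;> simp [h1]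
    rw [e1]
    refine tendsto_nhds_unique (hlim' _ (hite B (hcl n (S n)ᶜ))) ?_
    refine tendsto_const_nhds.congr fun N => ?_
    refine (lintegral_resampleLaw_eq_zero h S hS _ ?_ (fun x hx => ?_) _ _ w hw).symm
    · exact (Measurable.ite hm measurable_const measurable_const).coe_nnreal_ennreal
    · simp [hB, hx n]

end Existence

section Words

variable {G : Type*} [Fintype G] [DecidableEq G] {A : Set ℕ} {θ : ℕ → ℝ} {P : ℕ → G → G → ℝ}

/-- The matrix of a word. -/
noncomputable def wordMat (P : ℕ → G → G → ℝ) (l : List ℕ) : Matrix G G ℝ :=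
  Matrix.of (wordK P l)

theorem wordMat_apply (P : ℕ → G → G → ℝ) (l : List ℕ) (i j : G) :
    wordMat P l i j = wordK P l i j := rfl

theorem wordMat_nil (P : ℕ → G → G → ℝ) : wordMat P [] = 1 := by
  ext i j
  simp [wordMat, wordK, Matrix.one_apply]

theorem wordMat_cons (P : ℕ → G → G → ℝ) (a : ℕ) (l : List ℕ) :
    wordMat P (a :: l) = wordMat P l * Matrix.of (P a) := rfl

theorem wordMat_append (P : ℕ → G → G → ℝ) (l₁ l₂ : List ℕ) :
    wordMat P (l₁ ++ l₂) = wordMat P l₂ * wordMat P l₁ := by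
  induction l₁ with
  | nil => simp [wordMat_nil]
  | cons a l ih => rw [List.cons_append, wordMat_cons, ih, wordMat_cons, mul_assoc]

theorem wordMat_nonneg (h : IsImitation A θ P) {l : List ℕ} (hl : ∀ a ∈ l, a ∈ A) (i j : G) :
    0 ≤ wordMat P l i j := by
  induction l generalizing i j with
  | nil => rw [wordMat_nil, Matrix.one_apply]; split_ifs <;> simp
  | cons a l ih =>
    rw [wordMat_cons, Matrix.mul_apply]
    exact Finset.sum_nonneg fun m _ => mul_nonneg
      (ih (fun b hb => hl b (List.mem_cons_of_mem _ hb)) i m)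
      (h.nonneg a (hl a List.mem_cons_self) m j)

theorem wordMat_row (h : IsImitation A θ P) {l : List ℕ} (hl : ∀ a ∈ l, a ∈ A) (i : G) :
    ∑ j, wordMat P l i j = 1 := by
  induction l with
  | nil => simp [wordMat_nil, Matrix.one_apply]
  | cons a l ih =>
    simp_rw [wordMat_cons, Matrix.mul_apply]
    rw [Finset.sum_comm]
    simp_rw [← Finset.mul_sum, Matrix.of_apply, h.row a (hl a List.mem_cons_self), mul_one]
    exact ih fun b hb => hl b (List.mem_cons_of_mem _ hb)

theorem wordK_append_pos (h : IsImitation A θ P) {l₁ l₂ : List ℕ} (hl₁ : ∀ a ∈ l₁, a ∈ A)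
    (hl₂ : ∀ a ∈ l₂, a ∈ A) {i m j : G} (h₁ : 0 < wordK P l₁ m j) (h₂ : 0 < wordK P l₂ i m) :
    0 < wordK P (l₁ ++ l₂) i j := by
  rw [← wordMat_apply, wordMat_append, Matrix.mul_apply]
  refine (mul_pos h₂ h₁).trans_le ?_
  exact Finset.single_le_sum (f := fun m => wordMat P l₂ i m * wordMat P l₁ m j)
    (fun m _ => mul_nonneg (wordMat_nonneg h hl₂ i m) (wordMat_nonneg h hl₁ m j))
    (Finset.mem_univ m)

theorem wordK_exists_pos (h : IsImitation A θ P) {l : List ℕ} (hl : ∀ a ∈ l, a ∈ A) (i : G) :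
    ∃ j, 0 < wordK P l i j := by
  by_contra! hcon
  have := wordMat_row h hl i
  have h2 : ∑ j, wordMat P l i j ≤ 0 := Finset.sum_nonpos fun j _ => hcon j
  linarith

theorem wordK_singleton (P : ℕ → G → G → ℝ) (k : ℕ) (i j : G) : wordK P [k] i j = P k i j := by
  rw [← wordMat_apply, wordMat_cons, wordMat_nil, one_mul, Matrix.of_apply]

theorem Communicates.trans (h : IsImitation A θ P) {i j k : G} (hij : Communicates A P i j)
    (hjk : Communicates A P j k) : Communicates A P i k := by
  obtain ⟨l₂, ⟨hn, hl₂⟩, h₂⟩ := hij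
  obtain ⟨l₁, ⟨-, hl₁⟩, h₁⟩ := hjk
  refine ⟨l₁ ++ l₂, ⟨by simp [hn], fun a ha => ?_⟩, wordK_append_pos h hl₁ hl₂ h₁ h₂⟩
  exact (List.mem_append.1 ha).elim (hl₁ a) (hl₂ a)

theorem Communicates.of_pos {k : ℕ} (hk : k ∈ A) {i j : G} (hp : 0 < P k i j) :
    Communicates A P i j :=
  ⟨[k], ⟨by simp, by simpa using hk⟩, by rwa [wordK_singleton]⟩

theorem exists_communicates (h : IsImitation A θ P) (hA : A.Nonempty) (i : G) :
    ∃ j, Communicates A P i j := by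
  obtain ⟨k, hk⟩ := hA
  have hl : ∀ a ∈ [k], a ∈ A := by simpa using hk
  obtain ⟨j, hj⟩ := wordK_exists_pos h hl i
  exact ⟨j, [k], ⟨by simp, hl⟩, hj⟩

theorem Intercommunicates.symm {i j : G} (hij : Intercommunicates A P i j) :
    Intercommunicates A P j i :=
  hij.imp Eq.symm And.symm

theorem Intercommunicates.trans (h : IsImitation A θ P) {i j k : G}
    (hij : Intercommunicates A P i j) (hjk : Intercommunicates A P j k) :
    Intercommunicates A P i k := by
  rcases hij with rfl | hij
  · exact hjk
  · rcases hjk with rfl | hjk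
    · exact Or.inr hij
    · exact Or.inr ⟨hij.1.trans h hjk.1, hjk.2.trans h hij.2⟩

theorem IsInterClass.eq_of_mem (h : IsImitation A θ P) {C D : Set G} (hC : IsInterClass A P C)
    (hD : IsInterClass A P D) {x : G} (hxC : x ∈ C) (hxD : x ∈ D) : C = D := by
  obtain ⟨a, rfl⟩ := hC
  obtain ⟨b, rfl⟩ := hD
  have hab : Intercommunicates A P a b := Intercommunicates.trans h hxC (Intercommunicates.symm hxD)
  ext y
  exact ⟨fun hy => Intercommunicates.trans h hab.symm hy, fun hy => Intercommunicates.trans h hab hy⟩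

theorem IsInterClass.nonempty {C : Set G} (hC : IsInterClass A P C) : C.Nonempty := by
  obtain ⟨a, rfl⟩ := hC
  exact ⟨a, Or.inl rfl⟩

/-- Any two states of a closed class, possibly equal, communicate. -/
theorem IsClosedClass.communicates (h : IsImitation A θ P) (hA : A.Nonempty) {C : Set G}
    (hC : IsInterClass A P C) (hcl : IsClosedClass A P C) {i j : G} (hi : i ∈ C) (hj : j ∈ C) :
    Communicates A P i j := by
  obtain ⟨y, hy⟩ := exists_communicates h hA i
  have hyC := hcl i hi y hy
  obtain ⟨a, rfl⟩ := hC
  have hyj : Intercommunicates A P y j := Intercommunicates.trans h (Intercommunicates.symm hyC) hj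
  rcases hyj with rfl | hyj
  · exact hy
  · exact hy.trans h hyj.1

/-- Every state communicates with a state of some closed class. -/
theorem exists_closed_class (h : IsImitation A θ P) (hA : A.Nonempty) (i : G) :
    ∃ C : Set G, IsInterClass A P C ∧ IsClosedClass A P C ∧ ∃ r ∈ C, Communicates A P i r := by
  obtain ⟨j, hij, hmin⟩ := Set.exists_min_image {j | Communicates A P i j}
    (fun j => Set.ncard {k | Communicates A P j k}) (Set.toFinite _) (exists_communicates h hA i)
  have hsub : ∀ y, Communicates A P j y →
      {k | Communicates A P y k} = {k | Communicates A P j k} := fun y hy =>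
    Set.eq_of_subset_of_ncard_le (fun k hk => hy.trans h hk) (hmin y (hij.trans h hy))
      (Set.toFinite _)
  obtain ⟨r, hjr⟩ := exists_communicates h hA j
  have hback : ∀ y, Communicates A P j y → Communicates A P y r := fun y hy => by
    have : r ∈ {k | Communicates A P y k} := by rw [hsub y hy]; exact hjr
    exact this
  refine ⟨{y | Intercommunicates A P r y}, ⟨r, rfl⟩, ?_, r, Or.inl rfl, hij.trans h hjr⟩
  intro x hx y hxy
  have hry : Communicates A P r y := by
    rcases hx with rfl | hx
    · exact hxy
    · exact hx.1.trans h hxy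
  exact Or.inr ⟨hry, hback y (hjr.trans h hry)⟩

/-- Modulo any positive integer, each multiple of the gcd of the letters is a depth. -/
theorem exists_depth_congr {d : ℕ} (hgcd : IsGCDOfSet A d) {e : ℕ} (he : 0 < e) (z : ℤ) :
    ∃ l : List ℕ, (∀ a ∈ l, a ∈ A) ∧ (e : ℤ) ∣ (l.sum : ℤ) - d * z := by
  let H : AddSubgroup ℤ :=
    { carrier := {y | ∃ l : List ℕ, (∀ a ∈ l, a ∈ A) ∧ (e : ℤ) ∣ (l.sum : ℤ) - y}
      zero_mem' := ⟨[], by simp, by simp⟩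
      add_mem' := by
        rintro x y ⟨l, hl, hx⟩ ⟨l', hl', hy⟩
        refine ⟨l ++ l', fun a ha => (List.mem_append.1 ha).elim (hl a) (hl' a), ?_⟩
        have := dvd_add hx hy
        rw [List.sum_append, Nat.cast_add]
        exact this.trans (dvd_of_eq (by ring))
      neg_mem' := by
        rintro x ⟨l, hl, hx⟩
        refine ⟨(List.replicate (e - 1) l).flatten, fun a ha => ?_, ?_⟩
        · obtain ⟨l', hl', ha⟩ := List.mem_flatten.1 ha
          rw [List.eq_of_mem_replicate hl'] at ha
          exact hl a ha
        · have h1 : ((List.replicate (e - 1) l).flatten.sum : ℤ) = (e - 1) * l.sum := by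
            rw [List.sum_flatten, List.map_replicate, List.sum_replicate, smul_eq_mul]
            push_cast [Nat.cast_sub he]
            ring
          rw [h1]
          exact ((dvd_mul_right (e : ℤ) (l.sum : ℤ)).sub hx).trans (dvd_of_eq (by ring)) }
  obtain ⟨g, hg⟩ := Int.subgroup_cyclic H
  have hmem : ∀ y, y ∈ H ↔ g ∣ y := fun y => by
    rw [hg, ← AddSubgroup.zmultiples_eq_closure, Int.mem_zmultiples_iff]
  have hdvd : ∀ a ∈ A, g.natAbs ∣ a := fun a ha =>
    Int.natAbs_dvd_natAbs.2 ((hmem a).1 ⟨[a], by simpa using ha, by simp⟩)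
  exact (hmem _).2 ((Int.natAbs_dvd.1 (Int.natCast_dvd_natCast.2 (hgcd.2 _ hdvd))).mul_right z)

theorem dvd_sum_of_word {d : ℕ} (hd : ∀ a ∈ A, d ∣ a) {l : List ℕ} (hl : ∀ a ∈ l, a ∈ A) :
    d ∣ l.sum :=
  List.dvd_sum fun a ha => hd a (hl a ha)

theorem sum_pos_of_word (hpos : ∀ a ∈ A, 0 < a) {l : List ℕ} (hl : IsWord A l) : 0 < l.sum := by
  obtain ⟨a, ha⟩ := List.exists_mem_of_ne_nil l hl.1
  exact (hpos a (hl.2 a ha)).trans_le (List.le_sum_of_mem ha)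

end Words

section Necessity

variable {G : Type*} [Fintype G] [DecidableEq G] [Nonempty G] [MeasurableSpace G]
  [MeasurableSingletonClass G] {A : Set ℕ} {θ : ℕ → ℝ} {P : ℕ → G → G → ℝ}

omit [DecidableEq G] in
/-- If the compatible measure is unique, then two families of sets which are stable under the
kernel always meet. -/
theorem inter_nonempty_of_unique (h : IsImitation A θ P)
    (huniq : ∃! μ : Measure (ℤ → G), IsProbabilityMeasure μ ∧ Compatible θ P μ)
    {S T : ℤ → Set G} (hneS : ∀ n, (S n).Nonempty) (hneT : ∀ n, (T n).Nonempty)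
    (hS : ∀ n, ∀ k ∈ A, ∀ i ∈ S (n - (k : ℤ)), ∀ j, 0 < P k i j → j ∈ S n)
    (hT : ∀ n, ∀ k ∈ A, ∀ i ∈ T (n - (k : ℤ)), ∀ j, 0 < P k i j → j ∈ T n) (n : ℤ) :
    (S n ∩ T n).Nonempty := by
  obtain ⟨μ, hμ, hμS⟩ := exists_compatible h S hneS hS
  obtain ⟨ν, hν, hνT⟩ := exists_compatible h T hneT hT
  obtain rfl := huniq.unique hμ hν
  have := hμ.1
  obtain ⟨x, hx⟩ := ((hμS n).and (hνT n)).exists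
  exact ⟨x n, hx⟩

theorem closed_class_of_unique (h : IsImitation A θ P) (hA : A.Nonempty)
    {d : ℕ} (hgcd : IsGCDOfSet A d)
    (huniq : ∃! μ : Measure (ℤ → G), IsProbabilityMeasure μ ∧ Compatible θ P μ) :
    ∃ R : Set G, IsInterClass A P R ∧ IsClosedClass A P R ∧
      (∀ C : Set G, IsInterClass A P C → IsClosedClass A P C → C = R) ∧
      (∀ i ∈ R, IsGCDOfSet (ReturnDepths A P i) d) := by
  obtain ⟨R, hR, hRcl, -⟩ := exists_closed_class h hA (Classical.arbitrary G)
  refine ⟨R, hR, hRcl, fun C hC hCcl => ?_, fun i hi => ⟨?_, fun e he => ?_⟩⟩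
  · obtain ⟨x, hxC, hxR⟩ := inter_nonempty_of_unique h huniq
      (S := fun _ => C) (T := fun _ => R) (fun _ => hC.nonempty) (fun _ => hR.nonempty)
      (fun _ k hk i hi j hj => hCcl i hi j (Communicates.of_pos hk hj))
      (fun _ k hk i hi j hj => hRcl i hi j (Communicates.of_pos hk hj)) 0
    exact hC.eq_of_mem h hR hxC hxR
  · rintro _ ⟨l, hl, -, rfl⟩
    exact dvd_sum_of_word hgcd.1 hl.2
  · obtain ⟨l₀, hl₀, hl₀pos⟩ := hRcl.communicates h hA hR hi hi
    have he0 : 0 < e := by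
      have := he _ ⟨l₀, hl₀, hl₀pos, rfl⟩
      exact Nat.pos_of_dvd_of_pos this (sum_pos_of_word h.pos hl₀)
    obtain ⟨k₀, hk₀⟩ := hA
    have hd0 : (d : ℤ) ≠ 0 := by
      rintro h0
      have := hgcd.1 k₀ hk₀
      have h1 := h.pos k₀ hk₀
      rw [Int.natCast_eq_zero.1 h0, zero_dvd_iff] at this
      omega
    let S : ℤ → ℤ → Set G := fun r n =>
      {j | ∃ l : List ℕ, (∀ a ∈ l, a ∈ A) ∧ 0 < wordK P l i j ∧
        (e : ℤ) ∣ (l.sum : ℤ) - d * (n / d + r)}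
    have hne : ∀ r n, (S r n).Nonempty := fun r n => by
      obtain ⟨l, hl, hdiv⟩ := exists_depth_congr hgcd he0 (n / d + r)
      obtain ⟨j, hj⟩ := wordK_exists_pos h hl i
      exact ⟨j, l, hl, hj, hdiv⟩
    have hS : ∀ r n, ∀ k ∈ A, ∀ x ∈ S r (n - (k : ℤ)), ∀ y, 0 < P k x y → y ∈ S r n := by
      rintro r n k hk x ⟨l, hl, hpos, hdiv⟩ y hxy
      have hl' : ∀ a ∈ [k], a ∈ A := by simpa using hk
      refine ⟨[k] ++ l, fun a ha => (List.mem_append.1 ha).elim (hl' a) (hl a),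
        wordK_append_pos h hl' hl (by rwa [wordK_singleton]) hpos, ?_⟩
      obtain ⟨c, rfl⟩ := hgcd.1 k hk
      have h1 : (n - ((d * c : ℕ) : ℤ)) / d = n / d - c := by
        rw [Nat.cast_mul, Int.sub_mul_ediv_left _ _ hd0]
      rw [h1] at hdiv
      convert hdiv using 1
      simp only [List.singleton_append, List.sum_cons]
      push_cast
      ring
    obtain ⟨j, ⟨l, hl, hlpos, hldiv⟩, l', hl', hlpos', hldiv'⟩ :=
      inter_nonempty_of_unique h huniq (hne 0) (hne 1) (hS 0) (hS 1) 0
    have hjR : j ∈ R := by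
      by_cases hln : l = []
      · subst hln
        have : i = j := by
          by_contra hij
          simp [wordK, hij] at hlpos
        exact this ▸ hi
      · exact hRcl i hi j ⟨l, ⟨hln, hl⟩, hlpos⟩
    obtain ⟨l'', hl'', hlpos''⟩ := hRcl.communicates h ⟨k₀, hk₀⟩ hR hjR hi
    have hret : ∀ m : List ℕ, (∀ a ∈ m, a ∈ A) → 0 < wordK P m i j →
        (e : ℤ) ∣ (l''.sum : ℤ) + m.sum := fun m hm hmpos => by
      have := he _ ⟨l'' ++ m, ⟨by simp [hl''.1],
        fun a ha => (List.mem_append.1 ha).elim (hl''.2 a) (hm a)⟩,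
        wordK_append_pos h hl''.2 hm hlpos'' hmpos, rfl⟩
      rw [List.sum_append] at this
      exact_mod_cast this
    have hfin := ((hret l' hl' hlpos').sub (hret l hl hlpos)).sub (hldiv'.sub hldiv)
    exact Int.natCast_dvd_natCast.1 (hfin.trans (dvd_of_eq (by ring)))

end Necessity

section UniformDepth

variable {G : Type*} [Fintype G] [DecidableEq G] {A : Set ℕ} {θ : ℕ → ℝ} {P : ℕ → G → G → ℝ}

theorem exists_word_of_mem_closure (h : IsImitation A θ P) {r : G} {n : ℕ}
    (hn : n ∈ AddSubmonoid.closure (ReturnDepths A P r)) :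
    ∃ l : List ℕ, (∀ a ∈ l, a ∈ A) ∧ l.sum = n ∧ 0 < wordK P l r r := by
  induction hn using AddSubmonoid.closure_induction with
  | mem n hn =>
    obtain ⟨l, hl, hpos, hsum⟩ := hn
    exact ⟨l, hl.2, hsum, hpos⟩
  | zero => exact ⟨[], by simp, rfl, by simp [wordK]⟩
  | add m n _ _ hm hn =>
    obtain ⟨l, hl, hsum, hpos⟩ := hm
    obtain ⟨l', hl', hsum', hpos'⟩ := hn
    exact ⟨l ++ l', fun a ha => (List.mem_append.1 ha).elim (hl a) (hl' a),
      by rw [List.sum_append, hsum, hsum'], wordK_append_pos h hl hl' hpos hpos'⟩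

/-- A state of the unique closed class which has the smallest possible period is reached from all
states by words of one common depth. -/
theorem exists_common_depth (h : IsImitation A θ P) (hA : A.Nonempty) {d : ℕ}
    (hd : ∀ a ∈ A, d ∣ a) {R : Set G} (hR : IsInterClass A P R) (hRcl : IsClosedClass A P R)
    (huniq : ∀ C : Set G, IsInterClass A P C → IsClosedClass A P C → C = R) {r : G} (hr : r ∈ R)
    (hgcd : IsGCDOfSet (ReturnDepths A P r) d) :
    ∃ s : ℕ, ∀ i : G, ∃ l : List ℕ, (∀ a ∈ l, a ∈ A) ∧ l.sum = s ∧ 0 < wordK P l i r := by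
  have hcom : ∀ i, Communicates A P i r := fun i => by
    obtain ⟨C, hC, hCcl, q, hq, hiq⟩ := exists_closed_class h hA i
    rw [huniq C hC hCcl] at hq
    exact hiq.trans h (hRcl.communicates h hA hR hq hr)
  choose l hl hpos using hcom
  have hd0 : 0 < d := by
    obtain ⟨a, ha⟩ := hA
    exact Nat.pos_of_dvd_of_pos (hd a ha) (h.pos a ha)
  have hset : Nat.setGcd (ReturnDepths A P r) ∣ d :=
    hgcd.2 _ (Nat.dvd_setGcd_iff.1 dvd_rfl)
  obtain ⟨N, hN⟩ := Nat.exists_mem_closure_of_ge (ReturnDepths A P r)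
  refine ⟨d * (N + ∑ i, (l i).sum), fun i => ?_⟩
  have hle : N + (l i).sum ≤ d * (N + ∑ i, (l i).sum) :=
    (Nat.add_le_add_left (Finset.single_le_sum (f := fun i => (l i).sum)
      (fun _ _ => Nat.zero_le _) (Finset.mem_univ i)) N).trans (Nat.le_mul_of_pos_left _ hd0)
  obtain ⟨l', hl', hsum, hpos'⟩ := exists_word_of_mem_closure h
    (hN (d * (N + ∑ i, (l i).sum) - (l i).sum) (by omega)
      (hset.trans (Nat.dvd_sub (dvd_mul_right _ _) (dvd_sum_of_word hd (hl i).2))))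
  exact ⟨l' ++ l i, fun a ha => (List.mem_append.1 ha).elim (hl' a) ((hl i).2 a),
    by rw [List.sum_append, hsum]; omega, wordK_append_pos h hl' (hl i).2 hpos' (hpos i)⟩

end UniformDepth

section Discrepancy

variable {G : Type*} [Fintype G] {ι : Type*} [Fintype ι] [DecidableEq ι]

/-- The action of a family of matrices, one for each coordinate, on functions of several
coordinates. -/
noncomputable def coordAct (H : (ι → G) → ℝ) :
    MultilinearMap ℝ (fun _ : ι => Matrix G G ℝ) ((ι → G) → ℝ) where
  toFun M u := ∑ v, (∏ i, M i (u i) (v i)) * H v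
  map_update_add' M j X Y := by
    ext u
    simp only [Pi.add_apply, ← Finset.sum_add_distrib]
    refine Finset.sum_congr rfl fun v _ => ?_
    rw [← add_mul]
    congr 1
    simp only [← Finset.mul_prod_erase Finset.univ _ (Finset.mem_univ j), Function.update_self,
      Matrix.add_apply, add_mul]
    congr 2 <;> refine Finset.prod_congr rfl fun i hi => ?_ <;>
      simp [Function.update_of_ne (Finset.ne_of_mem_erase hi)]
  map_update_smul' M j c X := by
    ext u
    simp only [Pi.smul_apply, smul_eq_mul, Finset.mul_sum]
    refine Finset.sum_congr rfl fun v _ => ?_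
    rw [← mul_assoc]
    congr 1
    simp only [← Finset.mul_prod_erase Finset.univ _ (Finset.mem_univ j), Function.update_self,
      Matrix.smul_apply, smul_eq_mul, mul_assoc]
    congr 2
    refine Finset.prod_congr rfl fun i hi => ?_
    simp [Function.update_of_ne (Finset.ne_of_mem_erase hi)]

theorem coordAct_apply (H : (ι → G) → ℝ) (M : ι → Matrix G G ℝ) (u : ι → G) :
    coordAct H M u = ∑ v, (∏ i, M i (u i) (v i)) * H v := rfl

theorem coordAct_update_apply (H : (ι → G) → ℝ) (M : ι → Matrix G G ℝ) (j : ι)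
    (X : Matrix G G ℝ) (u : ι → G) :
    coordAct H (Function.update M j X) u
      = ∑ v, X (u j) (v j) * ((∏ i ∈ Finset.univ.erase j, M i (u i) (v i)) * H v) := by
  rw [coordAct_apply]
  refine Finset.sum_congr rfl fun v _ => ?_
  rw [← Finset.mul_prod_erase Finset.univ _ (Finset.mem_univ j), Function.update_self, mul_assoc]
  congr 2
  refine Finset.prod_congr rfl fun i hi => ?_
  rw [Function.update_of_ne (Finset.ne_of_mem_erase hi)]

theorem coordAct_one [DecidableEq G] (H : (ι → G) → ℝ) : coordAct H (fun _ => 1) = H := by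
  ext u
  rw [coordAct_apply, Finset.sum_eq_single u]
  · simp
  · intro v _ hv
    obtain ⟨i, hi⟩ := Function.ne_iff.1 hv
    have h0 : (1 : Matrix G G ℝ) (u i) (v i) = 0 := Matrix.one_apply_ne hi.symm
    rw [Finset.prod_eq_zero (Finset.mem_univ i) h0, zero_mul]
  · simp

/-- Resampling the coordinate `j` by means of `X` multiplies the `j`-th matrix by `X`. -/
theorem coordAct_mul (H : (ι → G) → ℝ) (M : ι → Matrix G G ℝ) (j : ι) (X : Matrix G G ℝ)
    (u : ι → G) :
    ∑ g, X (u j) g * coordAct H M (Function.update u j g)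
      = coordAct H (Function.update M j (X * M j)) u := by
  have h1 : ∀ g, coordAct H M (Function.update u j g)
      = ∑ v, M j g (v j) * ((∏ i ∈ Finset.univ.erase j, M i (u i) (v i)) * H v) := fun g => by
    conv_lhs => rw [← Function.update_eq_self j M]
    rw [coordAct_update_apply]
    refine Finset.sum_congr rfl fun v _ => ?_
    rw [Function.update_self]
    congr 2
    refine Finset.prod_congr rfl fun i hi => ?_
    rw [Function.update_of_ne (Finset.ne_of_mem_erase hi)]
  simp only [h1, coordAct_update_apply, Finset.mul_sum, Matrix.mul_apply, Finset.sum_mul]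
  rw [Finset.sum_comm]
  exact Finset.sum_congr rfl fun v _ => Finset.sum_congr rfl fun g _ => by ring

theorem abs_coordAct_le {H : (ι → G) → ℝ} (hH : ∀ u, |H u| ≤ 1) {M : ι → Matrix G G ℝ}
    (hM : ∀ i g g', 0 ≤ M i g g') (u : ι → G) :
    |coordAct H M u| ≤ ∏ i, ∑ g, M i (u i) g := by
  classical
  rw [Finset.prod_univ_sum, coordAct_apply, Fintype.piFinset_univ]
  refine (Finset.abs_sum_le_sum_abs _ _).trans (Finset.sum_le_sum fun v _ => ?_)
  have h0 : 0 ≤ ∏ i, M i (u i) (v i) := Finset.prod_nonneg fun i _ => hM i _ _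
  rw [abs_mul, abs_of_nonneg h0]
  exact mul_le_of_le_one_right h0 (hH v)

end Discrepancy

section Contraction

variable {G : Type*} [Fintype G] [DecidableEq G] {ι : Type*} [Fintype ι] [DecidableEq ι]
  {A : Set ℕ} {θ : ℕ → ℝ} {P : ℕ → G → G → ℝ}
  {D : (ι → ℤ) → ((ι → G) → ℝ) →ₗ[ℝ] ℝ}

/-- The properties of the difference `D n H` of the expectations of `H (x ∘ n)` under two compatible
measures whose marginals on fewer than `card ι` coordinates agree. -/
structure IsDiscrepancy (θ : ℕ → ℝ) (P : ℕ → G → G → ℝ)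
    (D : (ι → ℤ) → ((ι → G) → ℝ) →ₗ[ℝ] ℝ) : Prop where
  step : ∀ (n : ι → ℤ) (j : ι) (H : (ι → G) → ℝ), (∀ i, i ≠ j → n i < n j) →
    HasSum (fun k : ℕ => θ k * D (Function.update n j (n j - k))
      (fun u => ∑ g, P k (u j) g * H (Function.update u j g))) (D n H)
  eq_zero_of_not_injective : ∀ n H, ¬ Function.Injective n → D n H = 0
  eq_zero_of_indep : ∀ n j H, (∀ u g, H (Function.update u j g) = H u) → D n H = 0
  le_two : ∀ n H, (∀ u, |H u| ≤ 1) → D n H ≤ 2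

theorem wordMat_mem_rowStochastic (h : IsImitation A θ P) {l : List ℕ} (hl : ∀ a ∈ l, a ∈ A) :
    wordMat P l ∈ Matrix.rowStochastic ℝ G :=
  Matrix.mem_rowStochastic_iff_sum.2 ⟨wordMat_nonneg h hl, wordMat_row h hl⟩

theorem of_mem_rowStochastic (h : IsImitation A θ P) {a : ℕ} (ha : a ∈ A) :
    Matrix.of (P a) ∈ Matrix.rowStochastic ℝ G :=
  Matrix.mem_rowStochastic_iff_sum.2 ⟨h.nonneg a ha, h.row a ha⟩

theorem abs_coordAct_le_one {H : (ι → G) → ℝ} (hH : ∀ u, |H u| ≤ 1) {M : ι → Matrix G G ℝ}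
    (hM : ∀ i, M i ∈ Matrix.rowStochastic ℝ G) (u : ι → G) : |coordAct H M u| ≤ 1 := by
  refine (abs_coordAct_le hH (fun i g g' => Matrix.nonneg_of_mem_rowStochastic (hM i)) u).trans ?_
  simp [Matrix.sum_row_of_mem_rowStochastic (hM _)]

omit [Fintype ι] in
theorem update_mem_rowStochastic {M : ι → Matrix G G ℝ}
    (hM : ∀ i, M i ∈ Matrix.rowStochastic ℝ G) (j : ι) {X : Matrix G G ℝ}
    (hX : X ∈ Matrix.rowStochastic ℝ G) (i : ι) :
    Function.update M j X i ∈ Matrix.rowStochastic ℝ G := by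
  rcases eq_or_ne i j with rfl | hij
  · rwa [Function.update_self]
  · rw [Function.update_of_ne hij]
    exact hM i

/-- If `D` is nearly maximal at `n`, it stays nearly maximal when the latest coordinate of `n` is
moved back by a letter. -/
theorem IsDiscrepancy.lt_of_move (hD : IsDiscrepancy θ P D) (h : IsImitation A θ P) {c : ℝ}
    (hc : ∀ n H, (∀ u, |H u| ≤ 1) → D n H ≤ c) {H : (ι → G) → ℝ} (hH : ∀ u, |H u| ≤ 1)
    {M : ι → Matrix G G ℝ} (hM : ∀ i, M i ∈ Matrix.rowStochastic ℝ G) {n : ι → ℤ} {j : ι}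
    (hj : ∀ i, i ≠ j → n i < n j) {a : ℕ} {w δ : ℝ} (hw : w ≤ θ a) (hδ : 0 ≤ δ)
    (hlt : c - w * δ < D n (coordAct H M)) :
    c - δ < D (Function.update n j (n j - a))
      (coordAct H (Function.update M j (Matrix.of (P a) * M j))) := by
  have hsum := hD.step n j (coordAct H M) hj
  have hrw : ∀ k, (fun u => ∑ g, P k (u j) g * coordAct H M (Function.update u j g))
      = coordAct H (Function.update M j (Matrix.of (P k) * M j)) := fun k =>
    funext fun u => coordAct_mul H M j (Matrix.of (P k)) u
  simp only [hrw] at hsum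
  set V : ℕ → ℝ := fun k => D (Function.update n j (n j - k))
    (coordAct H (Function.update M j (Matrix.of (P k) * M j))) with hV
  have hle : ∀ k ∈ A, V k ≤ c := fun k hk => hc _ _ <| abs_coordAct_le_one hH <|
    update_mem_rowStochastic hM j (mul_mem (of_mem_rowStochastic h hk) (hM j))
  have hdiff : HasSum (fun k => θ k * (c - V k)) (c - D n (coordAct H M)) := by
    simpa [mul_sub] using (h.weight_sum.mul_right c).sub hsum
  have hone : θ a * (c - V a) ≤ c - D n (coordAct H M) :=
    le_hasSum hdiff a fun k _ => by
      by_cases hk : k ∈ A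
      · exact mul_nonneg (h.weight_nonneg k) (sub_nonneg.2 (hle k hk))
      · simp [h.weight_zero k hk]
  have h2 : θ a * (c - V a) < θ a * δ :=
    (hone.trans_lt (by linarith)).trans_le (mul_le_mul_of_nonneg_right hw hδ)
  have := lt_of_mul_lt_mul_left h2 (h.weight_nonneg a)
  change c - δ < V a
  linarith

/-- Moving the latest coordinate repeatedly, along prescribed words, keeps `D` nearly maximal. -/
theorem IsDiscrepancy.lt_of_words (hD : IsDiscrepancy θ P D) (h : IsImitation A θ P) {c : ℝ}
    (hc : ∀ n H, (∀ u, |H u| ≤ 1) → D n H ≤ c) {H : (ι → G) → ℝ} (hH : ∀ u, |H u| ≤ 1)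
    {w e : ℝ} (hw0 : 0 ≤ w) (hw1 : w ≤ 1) (he : 0 ≤ e) (hec : e ≤ c) (j : ι) (t : ℤ) (T : ℕ)
    (l : ι → List ℕ) (hl : ∀ i, ∀ a ∈ l i, a ∈ A ∧ w ≤ θ a) (hT : ∑ i, (l i).length = T)
    (n : ι → ℤ) (hj : n j - (l j).sum = t)
    (hi : ∀ i, i ≠ j → n i - (l i).sum ≤ t ∧ ∀ a ∈ l i, t < n i - (l i).sum + a)
    (M : ι → Matrix G G ℝ) (hM : ∀ i, M i ∈ Matrix.rowStochastic ℝ G)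
    (hlt : c - w ^ T * e < D n (coordAct H M)) :
    c - e < D (fun i => n i - (l i).sum) (coordAct H fun i => wordMat P (l i) * M i) := by
  induction T generalizing l n M with
  | zero =>
    have hnil : ∀ i, l i = [] := fun i => List.length_eq_zero_iff.1
      ((Finset.sum_eq_zero_iff.1 hT) i (Finset.mem_univ i))
    simpa [hnil, wordMat_nil] using hlt
  | succ T ih =>
    have hinj : Function.Injective n := by
      by_contra hn
      rw [hD.eq_zero_of_not_injective _ _ hn] at hlt
      have := mul_le_of_le_one_left he (pow_le_one₀ hw0 hw1 (n := T + 1))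
      linarith
    obtain ⟨p, -, hp⟩ := Finset.exists_max_image Finset.univ n ⟨j, Finset.mem_univ j⟩
    have htop : ∀ i, i ≠ p → n i < n p := fun i hip =>
      (hp i (Finset.mem_univ i)).lt_of_ne fun hne => hip (hinj hne)
    have hsum0 : ∀ i, l i ≠ [] → i ≠ j → t < n i := fun i hne hij => by
      obtain ⟨a, ha⟩ := List.exists_mem_of_ne_nil _ hne
      have h1 := (hi i hij).2 a ha
      have h2 : (a : ℤ) ≤ (l i).sum := by exact_mod_cast List.le_sum_of_mem ha
      linarith
    have hne : l p ≠ [] := by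
      intro hnil
      rcases eq_or_ne p j with rfl | hpj
      · have htn : n p = t := by simpa [hnil] using hj
        obtain ⟨i, -, hi0⟩ := Finset.exists_ne_zero_of_sum_ne_zero
          (hT.trans_ne (Nat.succ_ne_zero T))
        have hil : l i ≠ [] := fun h0 => hi0 (by simp [h0])
        have hip : i ≠ p := fun h0 => hil (h0 ▸ hnil)
        have := hsum0 i hil hip
        have := htop i hip
        linarith
      · have h1 := (hi p hpj).1
        have h2 := htop j hpj.symm
        rw [hnil] at h1
        have h3 : (0 : ℤ) ≤ (l j).sum := Nat.cast_nonneg _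
        simp only [List.sum_nil, Nat.cast_zero, sub_zero] at h1
        linarith
    obtain ⟨a, l', hal⟩ := List.exists_cons_of_ne_nil hne
    have haA := hl p a (by simp [hal])
    have hmove := hD.lt_of_move h hc hH hM htop haA.2 (mul_nonneg (pow_nonneg hw0 T) he)
      (by rwa [← mul_assoc, ← pow_succ'])
    have hpn : Function.update n p (n p - a) p - (l'.sum : ℤ) = n p - (l p).sum := by
      rw [hal, Function.update_self, List.sum_cons]
      push_cast
      ring
    have hn' : (fun i => Function.update n p (n p - a) i - ((Function.update l p l' i).sum : ℤ))
        = fun i => n i - ((l i).sum : ℤ) := by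
      ext i
      rcases eq_or_ne i p with rfl | hip
      · rw [← hpn, Function.update_self, Function.update_self]
      · rw [Function.update_of_ne hip, Function.update_of_ne hip]
    have hM' : (fun i => wordMat P (Function.update l p l' i)
          * Function.update M p (Matrix.of (P a) * M p) i)
        = fun i => wordMat P (l i) * M i := by
      ext1 i
      rcases eq_or_ne i p with rfl | hip
      · rw [Function.update_self, Function.update_self, hal, wordMat_cons, Matrix.mul_assoc]
      · rw [Function.update_of_ne hip, Function.update_of_ne hip]
    have hsub : ∀ i, ∀ b ∈ Function.update l p l' i, b ∈ l i := fun i b hb => by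
      rcases eq_or_ne i p with rfl | hip
      · rw [Function.update_self] at hb
        rw [hal]
        exact List.mem_cons_of_mem _ hb
      · rwa [Function.update_of_ne hip] at hb
    have key := ih (Function.update l p l') (fun i b hb => hl i b (hsub i b hb)) ?_
      (Function.update n p (n p - a)) ((congrFun hn' j).trans hj)
      (fun i hij => by
        rw [congrFun hn' i]
        exact ⟨(hi i hij).1, fun b hb => (hi i hij).2 b (hsub i b hb)⟩)
      _ (update_mem_rowStochastic hM p (mul_mem (of_mem_rowStochastic h haA.1) (hM p))) hmove
    · rwa [hn', hM'] at key
    · have h1 := Finset.add_sum_erase Finset.univ (fun i => (l i).length) (Finset.mem_univ p)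
      have h2 := Finset.add_sum_erase Finset.univ
        (fun i => (Function.update l p l' i).length) (Finset.mem_univ p)
      have h3 : ∑ i ∈ Finset.univ.erase p, (Function.update l p l' i).length
          = ∑ i ∈ Finset.univ.erase p, (l i).length := Finset.sum_congr rfl fun i hi' => by
        rw [Function.update_of_ne (Finset.ne_of_mem_erase hi')]
      simp only [Function.update_self, hal, List.length_cons] at h1 h2
      omega

/-- Moving back by steps of a fixed length, one falls into a window of that length. -/
theorem exists_steps {a : ℕ} (ha : 0 < a) (t : ℤ) (s : ℕ) (y : ℤ) (hy : y ≤ t + s) :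
    ∃ b ≤ s, y - (b * a : ℕ) ≤ t ∧ (b ≠ 0 → t < y - (b * a : ℕ) + a) := by
  induction s generalizing y with
  | zero => exact ⟨0, le_rfl, by simpa using hy, by simp⟩
  | succ s ih =>
    by_cases hyt : y ≤ t
    · exact ⟨0, Nat.zero_le _, by simpa using hyt, by simp⟩
    · obtain ⟨b, hb, h1, h2⟩ := ih (y - a) (by push_cast at hy; omega)
      refine ⟨b + 1, by omega, ?_, fun _ => ?_⟩
      · rw [add_mul, one_mul]
        push_cast at h1 ⊢
        linarith
      · rw [add_mul, one_mul]
        rcases eq_or_ne b 0 with rfl | hb0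
        · push_cast
          linarith
        · have := h2 hb0
          push_cast at this ⊢
          linarith

omit [DecidableEq G] in
theorem exists_lower_bound (h : IsImitation A θ P) (S : Finset ℕ) (hS : ∀ a ∈ S, a ∈ A) :
    ∃ w, 0 < w ∧ w ≤ 1 ∧ ∀ a ∈ S, w ≤ θ a := by
  induction S using Finset.induction_on with
  | empty => exact ⟨1, one_pos, le_rfl, by simp⟩
  | insert a S _ ih =>
    obtain ⟨w, hw0, hw1, hw⟩ := ih fun b hb => hS b (Finset.mem_insert_of_mem hb)
    refine ⟨min (θ a) w, lt_min (h.weight_pos a (hS a (Finset.mem_insert_self a S))) hw0,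
      (min_le_right _ _).trans hw1, fun b hb => ?_⟩
    rcases Finset.mem_insert.1 hb with rfl | hb
    · exact min_le_left _ _
    · exact (min_le_right _ _).trans (hw b hb)

/-- A lower bound for `D`, uniform in one matrix entry, forces the supremum of `D` to vanish. -/
theorem IsDiscrepancy.not_forall_lt (hD : IsDiscrepancy θ P D) {c κ : ℝ}
    (hc : ∀ n H, (∀ u, |H u| ≤ 1) → D n H ≤ c) {H : (ι → G) → ℝ} (hH : ∀ u, |H u| ≤ 1)
    (n : ι → ℤ) (j : ι) {N : ι → Matrix G G ℝ} (hN : ∀ i, N i ∈ Matrix.rowStochastic ℝ G)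
    {Q : G → Matrix G G ℝ} (hQ : ∀ g, Q g ∈ Matrix.rowStochastic ℝ G) (r : G)
    (hκ : ∀ g, κ ≤ Q g g r)
    (hlt : ∀ g, c - κ * c / Fintype.card G < D n (coordAct H (Function.update N j (Q g)))) :
    False := by
  have hcard : (0 : ℝ) < Fintype.card G := Nat.cast_pos.2 (Fintype.card_pos_iff.2 ⟨r⟩)
  set L : Matrix G G ℝ →ₗ[ℝ] ℝ := (D n).comp ((coordAct H).toLinearMap N j) with hL
  have hLapp : ∀ X, L X = D n (coordAct H (Function.update N j X)) := fun X => rfl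
  set E : Matrix G G ℝ := Matrix.of fun _ g => if g = r then 1 else 0 with hE
  have hLE : L E = 0 := by
    refine hD.eq_zero_of_indep n j _ fun u g => ?_
    change coordAct H (Function.update N j E) _ = coordAct H (Function.update N j E) u
    rw [coordAct_update_apply, coordAct_update_apply]
    refine Finset.sum_congr rfl fun v _ => ?_
    refine congrArg₂ (· * ·) rfl
      (congrArg (· * H v) (Finset.prod_congr rfl fun i hi => ?_))
    rw [Function.update_of_ne (Finset.ne_of_mem_erase hi)]
  set Q' : Matrix G G ℝ := ∑ g, Q g - κ • E with hQ'
  have hnn : ∀ g g', 0 ≤ Q' g g' := fun g g' => by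
    have h1 : Q g g g' ≤ ∑ x, Q x g g' := Finset.single_le_sum (f := fun x => Q x g g')
      (fun x _ => Matrix.nonneg_of_mem_rowStochastic (hQ x)) (Finset.mem_univ g)
    have h2 : 0 ≤ Q g g g' := Matrix.nonneg_of_mem_rowStochastic (hQ g)
    simp only [hQ', hE, Matrix.sub_apply, Matrix.sum_apply, Matrix.smul_apply, Matrix.of_apply,
      smul_eq_mul, mul_ite, mul_one, mul_zero]
    split_ifs with hgr
    · have := hκ g
      rw [← hgr] at this
      linarith
    · linarith
  have hrow : ∀ g, ∑ g', Q' g g' = Fintype.card G - κ := fun g => by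
    simp only [hQ', hE, Matrix.sub_apply, Matrix.sum_apply, Matrix.smul_apply, Matrix.of_apply,
      smul_eq_mul, mul_ite, mul_one, mul_zero, Finset.sum_sub_distrib]
    rw [Finset.sum_comm]
    simp [Matrix.sum_row_of_mem_rowStochastic (hQ _)]
  have hκ0 : 0 ≤ Fintype.card G - κ := by
    rw [← hrow r]
    exact Finset.sum_nonneg fun g _ => hnn r g
  have hLQ' : L Q' ≤ (Fintype.card G - κ) * c := by
    rcases hκ0.eq_or_lt with h0 | h0
    · have : Q' = 0 := by
        ext g g'
        have h1 := (Finset.sum_eq_zero_iff_of_nonneg fun g' _ => hnn g g').1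
          ((hrow g).trans h0.symm)
        exact h1 g' (Finset.mem_univ g')
      rw [this, map_zero, ← h0, zero_mul]
    · have hst : (Fintype.card G - κ)⁻¹ • Q' ∈ Matrix.rowStochastic ℝ G := by
        refine Matrix.mem_rowStochastic_iff_sum.2 ⟨fun g g' => ?_, fun g => ?_⟩
        · exact mul_nonneg (inv_nonneg.2 hκ0) (hnn g g')
        · simp only [Matrix.smul_apply, smul_eq_mul, ← Finset.mul_sum, hrow]
          exact inv_mul_cancel₀ h0.ne'
      have h1 := hc n _ (abs_coordAct_le_one hH (update_mem_rowStochastic hN j hst))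
      rw [← hLapp, map_smul, smul_eq_mul, inv_mul_le_iff₀ h0] at h1
      exact h1
  have hsum : ∑ g, L (Q g) = L Q' := by
    rw [hQ', map_sub, map_smul, hLE, smul_zero, sub_zero, map_sum]
  have hlt' : ∑ _g : G, (c - κ * c / Fintype.card G) < ∑ g, L (Q g) :=
    Finset.sum_lt_sum_of_nonempty ⟨r, Finset.mem_univ r⟩ fun g _ => hlt g
  rw [Finset.sum_const, Finset.card_univ, nsmul_eq_mul, mul_sub, mul_div_cancel₀ _ hcard.ne'] at hlt'
  linarith

/-- If all states are driven to one state by words of a common depth, every discrepancy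
vanishes. -/
theorem IsDiscrepancy.eq_zero [Nonempty ι] (hD : IsDiscrepancy θ P D) (h : IsImitation A θ P)
    (hA : A.Nonempty) {s : ℕ} {r : G}
    (hs : ∀ g : G, ∃ l : List ℕ, (∀ a ∈ l, a ∈ A) ∧ l.sum = s ∧ 0 < wordK P l g r)
    (n : ι → ℤ) (H : (ι → G) → ℝ) : D n H = 0 := by
  obtain ⟨a₀, ha₀⟩ := hA
  choose l hl hls hpos using hs
  have : Nonempty G := ⟨r⟩
  obtain ⟨g₀, hg₀⟩ := Finite.exists_min fun g => wordK P (l g) g r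
  set κ := wordK P (l g₀) g₀ r with hκ
  obtain ⟨w, hw0, hw1, hw⟩ := exists_lower_bound h
    (insert a₀ (Finset.univ.biUnion fun g => (l g).toFinset)) (by
      intro a ha
      simp only [Finset.mem_insert, Finset.mem_biUnion, Finset.mem_univ, true_and,
        List.mem_toFinset] at ha
      rcases ha with rfl | ⟨g, hg⟩
      · exact ha₀
      · exact hl g a hg)
  have hwa₀ : w ≤ θ a₀ := hw a₀ (Finset.mem_insert_self _ _)
  have hwl : ∀ g, ∀ a ∈ l g, w ≤ θ a := fun g a ha => hw a <| Finset.mem_insert_of_mem <|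
    Finset.mem_biUnion.2 ⟨g, Finset.mem_univ g, List.mem_toFinset.2 ha⟩
  set B : Set ℝ := {x | ∃ n H, (∀ u, |H u| ≤ 1) ∧ D n H = x} with hB
  have hBbdd : BddAbove B := ⟨2, by
    rintro _ ⟨n, H, hH, rfl⟩
    exact hD.le_two n H hH⟩
  have hc : ∀ n H, (∀ u, |H u| ≤ 1) → D n H ≤ sSup B := fun n H hH =>
    le_csSup hBbdd ⟨n, H, hH, rfl⟩
  have hBne : B.Nonempty := ⟨_, 0, 0, by simp, rfl⟩
  set c := sSup B with hcdef
  have hcard : (0 : ℝ) < Fintype.card G := Nat.cast_pos.2 Fintype.card_pos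
  have hκ0 : 0 < κ := hpos g₀
  have hκ1 : κ ≤ Fintype.card G :=
    (Matrix.le_one_of_mem_rowStochastic (wordMat_mem_rowStochastic h (hl g₀))).trans
      (Nat.one_le_cast.2 Fintype.card_pos)
  have hle : c ≤ 0 := by
    by_contra! hc0
    set e := κ * c / Fintype.card G with he
    have he0 : 0 < e := by positivity
    have hec : e ≤ c := by
      rw [he, div_le_iff₀ hcard, mul_comm]
      exact mul_le_mul_of_nonneg_left hκ1 hc0.le
    obtain ⟨_, ⟨n, H, hH, rfl⟩, hlt⟩ := exists_lt_of_lt_csSup hBne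
      (show c - w ^ (Fintype.card ι * s) * e < sSup B by
        have : 0 < w ^ (Fintype.card ι * s) * e := by positivity
        linarith)
    obtain ⟨j, -, hj⟩ := Finset.exists_max_image Finset.univ n Finset.univ_nonempty
    have hb := fun i => exists_steps (h.pos a₀ ha₀) (n j - s) s (n i)
      (by simpa using hj i (Finset.mem_univ i))
    choose b hbs hb1 hb2 using hb
    set W : G → ι → List ℕ := fun g => Function.update (fun i => List.replicate (b i) a₀) j (l g)
      with hW
    have hWj : ∀ g, W g j = l g := fun g => Function.update_self _ _ _
    have hWi : ∀ g i, i ≠ j → W g i = List.replicate (b i) a₀ := fun g i hij =>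
      Function.update_of_ne hij _ _
    have hlen : ∀ g i, (W g i).length ≤ s := fun g i => by
      rcases eq_or_ne i j with rfl | hij
      · rw [hWj, ← hls g]
        exact List.length_le_sum_of_one_le _ fun a ha => h.pos a (hl g a ha)
      · rw [hWi g i hij, List.length_replicate]
        exact hbs i
    refine hD.not_forall_lt (κ := κ) hc hH
      (fun i => n i - (if i = j then s else b i * a₀ : ℕ)) j
      (N := fun i => wordMat P (List.replicate (b i) a₀)) (fun i =>
        wordMat_mem_rowStochastic h fun a ha => by rwa [List.eq_of_mem_replicate ha])
      (Q := fun g => wordMat P (l g)) (fun g => wordMat_mem_rowStochastic h (hl g)) r hg₀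
      fun g => ?_
    have key := hD.lt_of_words h hc hH hw0.le hw1 he0.le hec j (n j - s) _ (W g) ?_ rfl n ?_ ?_
      (fun _ => 1) (fun _ => one_mem _) ?_
    · convert key using 2
      · congr 1
        ext i
        rcases eq_or_ne i j with rfl | hij
        · rw [if_pos rfl, hWj, hls]
        · rw [if_neg hij, hWi g i hij, List.sum_replicate, smul_eq_mul]
      · congr 1
        ext1 i
        rw [Matrix.mul_one]
        rcases eq_or_ne i j with rfl | hij
        · rw [Function.update_self, hWj]
        · rw [Function.update_of_ne hij, hWi g i hij]
    · intro i a ha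
      rcases eq_or_ne i j with rfl | hij
      · rw [hWj] at ha
        exact ⟨hl g a ha, hwl g a ha⟩
      · rw [hWi g i hij] at ha
        obtain rfl := List.eq_of_mem_replicate ha
        exact ⟨ha₀, hwa₀⟩
    · rw [hWj, hls]
    · intro i hij
      rw [hWi g i hij, List.sum_replicate, smul_eq_mul]
      refine ⟨hb1 i, fun a ha => ?_⟩
      obtain rfl := List.eq_of_mem_replicate ha
      refine hb2 i fun h0 => ?_
      simp [h0] at ha
    · rw [coordAct_one]
      refine lt_of_le_of_lt ?_ hlt
      have hT : ∑ i, (W g i).length ≤ Fintype.card ι * s :=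
        (Finset.sum_le_card_nsmul _ _ s fun i _ => hlen g i).trans_eq (by simp)
      have := mul_le_mul_of_nonneg_right (pow_le_pow_of_le_one hw0.le hw1 hT) he0.le
      linarith
  have hnonpos : ∀ H : (ι → G) → ℝ, D n H ≤ 0 := fun H => by
    obtain ⟨K, hK⟩ := Finite.exists_max fun u => |H u|
    have hK0 : 0 < |H K| + 1 := by positivity
    have h1 := (hc n ((|H K| + 1)⁻¹ • H) fun u => by
      rw [Pi.smul_apply, smul_eq_mul, abs_mul, abs_of_pos (inv_pos.2 hK0), inv_mul_le_one₀ hK0]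
      linarith [hK u]).trans hle
    rw [map_smul, smul_eq_mul] at h1
    exact nonpos_of_mul_nonpos_right h1 (inv_pos.2 hK0)
  have h1 := hnonpos (-H)
  rw [map_neg] at h1
  linarith [hnonpos H]

end Contraction

section Uniqueness

variable {G : Type*} [Fintype G] [MeasurableSpace G] [MeasurableSingletonClass G]
  {A : Set ℕ} {θ : ℕ → ℝ} {P : ℕ → G → G → ℝ}

theorem measurable_comp_coord {ι : Type*} [Fintype ι] (n : ι → ℤ) (H : (ι → G) → ℝ) :
    Measurable fun x : ℤ → G => H fun i => x (n i) :=
  (measurable_of_countable H).comp (measurable_pi_lambda _ fun _ => measurable_pi_apply _)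

theorem integrable_comp_coord {ι : Type*} [Fintype ι] (μ : Measure (ℤ → G)) [IsFiniteMeasure μ]
    (n : ι → ℤ) (H : (ι → G) → ℝ) : Integrable (fun x : ℤ → G => H fun i => x (n i)) μ := by
  classical
  refine Integrable.of_bound (measurable_comp_coord n H).aestronglyMeasurable (∑ u, ‖H u‖)
    (ae_of_all _ fun x => ?_)
  exact Finset.single_le_sum (f := fun u => ‖H u‖) (fun _ _ => norm_nonneg _) (Finset.mem_univ _)

/-- The expectation of a function of finitely many coordinates. -/
noncomputable def coordMean {ι : Type*} [Fintype ι] (μ : Measure (ℤ → G)) [IsFiniteMeasure μ]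
    (n : ι → ℤ) : ((ι → G) → ℝ) →ₗ[ℝ] ℝ where
  toFun H := ∫ x, H (fun i => x (n i)) ∂μ
  map_add' H K := integral_add (integrable_comp_coord μ n H) (integrable_comp_coord μ n K)
  map_smul' c _ := integral_const_mul c _

theorem coordMean_apply {ι : Type*} [Fintype ι] (μ : Measure (ℤ → G)) [IsFiniteMeasure μ]
    (n : ι → ℤ) (H : (ι → G) → ℝ) : coordMean μ n H = ∫ x, H (fun i => x (n i)) ∂μ := rfl

theorem coordMean_congr {ι κ : Type*} [Fintype ι] [Fintype κ] (μ : Measure (ℤ → G))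
    [IsFiniteMeasure μ] {n : ι → ℤ} {m : κ → ℤ} {H : (ι → G) → ℝ} {K : (κ → G) → ℝ}
    (hHK : ∀ x : ℤ → G, H (fun i => x (n i)) = K fun i => x (m i)) :
    coordMean μ n H = coordMean μ m K := by
  rw [coordMean_apply, coordMean_apply]
  exact congrArg (fun f => ∫ x, f x ∂μ) (funext hHK)

/-- Compatibility with the kernel, at the latest of finitely many coordinates. -/
theorem coordMean_eq_integral_kernel {ι : Type*} [Fintype ι] [DecidableEq ι]
    (h : IsImitation A θ P) {μ : Measure (ℤ → G)} [IsProbabilityMeasure μ]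
    (hμ : Compatible θ P μ) (n : ι → ℤ) (j : ι) (hj : ∀ i, i ≠ j → n i < n j)
    (H : (ι → G) → ℝ) :
    coordMean μ n H = ∫ x, ∑ g, imitKernel θ P (n j) x g
      * H (Function.update (fun i => x (n i)) j g) ∂μ := by
  classical
  set π : (ℤ → G) → (ι → G) := fun x i => x (n i) with hπ
  have hπm : Measurable π := measurable_pi_lambda _ fun _ => measurable_pi_apply _
  set E : (ι → G) → Set (ℤ → G) := fun u => {x | ∀ i, i ≠ j → x (n i) = u i} with hE
  have hEm : ∀ u, MeasurableSet (E u) := fun u => by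
    convert measurableSet_cylinder (G := G) (Finset.univ.erase j) n u using 1
    ext x
    simp [hE]
  have hEpast : ∀ u, PastMeasurable (n j) (E u) := fun u => by
    refine ⟨_, measurableSet_cylinder (G := G) (Finset.univ : Finset {i // i ≠ j})
      (fun i => (⟨n i, hj i i.2⟩ : {m : ℤ // m < n j})) fun i => u i, ?_⟩
    ext x
    simp [hE]
  have hint : ∀ g, Integrable (fun x => imitKernel θ P (n j) x g) μ := fun g =>
    Integrable.of_bound (h.measurable_kernel (n j) g).aestronglyMeasurable 1
      (ae_of_all _ fun x => by
        rw [Real.norm_of_nonneg (h.kernel_nonneg (n j) x g)]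
        exact h.kernel_le_one (n j) x g)
  have hmass : ∀ u, (μ.map π).real {u} = ∫ x in E u, imitKernel θ P (n j) x (u j) ∂μ := fun u => by
    rw [map_measureReal_apply hπm (measurableSet_singleton u)]
    refine Eq.trans ?_ (hμ (n j) (u j) (E u) (hEpast u))
    refine congrArg (fun s => (μ s).toReal) ?_
    ext x
    simp only [hπ, hE, Set.mem_preimage, Set.mem_singleton_iff, Set.mem_inter_iff,
      Set.mem_ofPred_eq, funext_iff]
    refine ⟨fun hx => ⟨fun i _ => hx i, hx j⟩, fun hx i => ?_⟩
    rcases eq_or_ne i j with rfl | hij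
    · exact hx.2
    · exact hx.1 i hij
  have h1 : coordMean μ n H = ∫ u, H u ∂(μ.map π) :=
    (integral_map hπm.aemeasurable (measurable_of_countable H).aestronglyMeasurable).symm
  have : IsProbabilityMeasure (μ.map π) := Measure.isProbabilityMeasure_map hπm.aemeasurable
  rw [h1, integral_fintype (Integrable.of_finite)]
  simp only [hmass, smul_eq_mul, ← integral_mul_const]
  simp only [← integral_indicator (hEm _)]
  rw [← integral_finsetSum _ fun u _ => ((hint (u j)).mul_const (H u)).indicator (hEm u)]
  congr 1
  ext x
  simp only [Set.indicator_apply]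
  rw [← Finset.sum_filter]
  symm
  refine Finset.sum_bij' (fun g _ => Function.update (π x) j g) (fun u _ => u j)
    (fun g _ => ?_) (fun _ _ => Finset.mem_univ _) (fun g _ => Function.update_self _ _ _)
    (fun u hu => ?_) fun g _ => by rw [Function.update_self]
  · refine Finset.mem_filter.2 ⟨Finset.mem_univ _, fun i hij => ?_⟩
    rw [Function.update_of_ne hij]
  · ext i
    rcases eq_or_ne i j with rfl | hij
    · rw [Function.update_self]
    · rw [Function.update_of_ne hij]
      exact (Finset.mem_filter.1 hu).2 i hij

theorem hasSum_coordMean {ι : Type*} [Fintype ι] [DecidableEq ι]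
    (h : IsImitation A θ P) {μ : Measure (ℤ → G)} [IsProbabilityMeasure μ]
    (hμ : Compatible θ P μ) (n : ι → ℤ) (j : ι) (hj : ∀ i, i ≠ j → n i < n j)
    (H : (ι → G) → ℝ) :
    HasSum (fun k : ℕ => θ k * coordMean μ (Function.update n j (n j - k))
      fun u => ∑ g, P k (u j) g * H (Function.update u j g)) (coordMean μ n H) := by
  classical
  rw [coordMean_eq_integral_kernel h hμ n j hj H]
  set C := ∑ u, |H u| with hC
  have hHC : ∀ u, |H u| ≤ C := fun u =>
    Finset.single_le_sum (f := fun u => |H u|) (fun _ _ => abs_nonneg _) (Finset.mem_univ u)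
  simp only [coordMean_apply, ← integral_const_mul]
  have hrw : ∀ (k : ℕ) (x : ℤ → G), θ k * ∑ g, P k (x (Function.update n j (n j - k) j)) g
        * H (Function.update (fun i => x (Function.update n j (n j - k) i)) j g)
      = ∑ g, θ k * P k (x (n j - k)) g * H (Function.update (fun i => x (n i)) j g) := fun k x => by
    rw [Finset.mul_sum]
    refine Finset.sum_congr rfl fun g _ => ?_
    rw [mul_assoc, Function.update_self]
    congr 3
    ext i
    rcases eq_or_ne i j with rfl | hij
    · rw [Function.update_self, Function.update_self]
    · rw [Function.update_of_ne hij, Function.update_of_ne hij, Function.update_of_ne hij]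
  refine hasSum_integral_of_dominated_convergence (fun k _ => θ k * (Fintype.card G * C))
    (fun k => ?_) (fun k => ae_of_all _ fun x => ?_)
    (ae_of_all _ fun _ => h.weight_sum.summable.mul_right _) (integrable_const _)
    (ae_of_all _ fun x => ?_)
  · exact ((measurable_comp_coord (Function.update n j (n j - k)) fun u =>
      ∑ g, P k (u j) g * H (Function.update u j g)).const_mul (θ k)).aestronglyMeasurable
  · rw [hrw]
    refine (norm_sum_le _ _).trans ((Finset.sum_le_card_nsmul _ _ (θ k * C) fun g _ => ?_).trans_eq
      (by rw [Finset.card_univ, nsmul_eq_mul]; ring))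
    rw [norm_mul]
    exact mul_le_mul (h.term_norm_le k _ _) (hHC _) (abs_nonneg _) (h.weight_nonneg k)
  · simp only [hrw]
    exact hasSum_sum fun g _ => (h.hasSum_kernel (n j) x g).mul_right _

theorem abs_coordMean_le_one {ι : Type*} [Fintype ι] (μ : Measure (ℤ → G))
    [IsProbabilityMeasure μ] (n : ι → ℤ) {H : (ι → G) → ℝ} (hH : ∀ u, |H u| ≤ 1) :
    |coordMean μ n H| ≤ 1 := by
  refine (norm_integral_le_of_norm_le_const (f := fun x : ℤ → G => H fun i => x (n i))
    (C := 1) (ae_of_all _ fun x => hH _)).trans_eq ?_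
  simp

theorem isDiscrepancy_coordMean [Nonempty G] (h : IsImitation A θ P) {μ ν : Measure (ℤ → G)}
    [IsProbabilityMeasure μ] [IsProbabilityMeasure ν] (hμ : Compatible θ P μ)
    (hν : Compatible θ P ν) {ι : Type*} [Fintype ι] [DecidableEq ι]
    (hlow : ∀ (j : ι) (n : {i // i ≠ j} → ℤ) (H : ({i // i ≠ j} → G) → ℝ),
      coordMean μ n H = coordMean ν n H) :
    IsDiscrepancy θ P fun n : ι → ℤ => coordMean μ n - coordMean ν n where
  step n j H hj := by
    simpa only [LinearMap.sub_apply, mul_sub] using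
      (hasSum_coordMean h hμ n j hj H).sub (hasSum_coordMean h hν n j hj H)
  eq_zero_of_not_injective n H hn := by
    obtain ⟨a, b, hab, hne⟩ : ∃ a b, n a = n b ∧ a ≠ b := by
      simpa [Function.Injective] using hn
    set m : {i // i ≠ b} → ℤ := fun i => n i
    set K : ({i // i ≠ b} → G) → ℝ := fun v =>
      H fun i => if hi : i = b then v ⟨a, hne⟩ else v ⟨i, hi⟩
    have hHK : ∀ x : ℤ → G, H (fun i => x (n i)) = K fun i => x (m i) := fun x => by
      refine congrArg H (funext fun i => ?_)
      split_ifs with hi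
      · rw [hi, ← hab]
      · rfl
    rw [LinearMap.sub_apply, sub_eq_zero, coordMean_congr μ hHK, coordMean_congr ν hHK]
    exact hlow b _ _
  eq_zero_of_indep n j H hH := by
    obtain ⟨g⟩ := ‹Nonempty G›
    set m : {i // i ≠ j} → ℤ := fun i => n i with hm
    set K : ({i // i ≠ j} → G) → ℝ := fun v =>
      H fun i => if hi : i = j then g else v ⟨i, hi⟩
    have hHK : ∀ x : ℤ → G, H (fun i => x (n i)) = K fun i => x (m i) := fun x => by
      rw [← hH _ g]
      refine congrArg H (funext fun i => ?_)
      rcases eq_or_ne i j with rfl | hij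
      · simp
      · simp [hm, hij]
    rw [LinearMap.sub_apply, sub_eq_zero, coordMean_congr μ hHK, coordMean_congr ν hHK]
    exact hlow j _ _
  le_two n H hH := by
    have h1 := abs_le.1 (abs_coordMean_le_one μ n hH)
    have h2 := abs_le.1 (abs_coordMean_le_one ν n hH)
    rw [LinearMap.sub_apply]
    linarith [h1.2, h2.1]

variable [DecidableEq G]

/-- All finite-dimensional marginals of two compatible measures agree, by induction on the number
of coordinates. -/
theorem coordMean_eq_of_compatible (h : IsImitation A θ P) (hA : A.Nonempty) {s : ℕ} {r : G}
    (hs : ∀ g : G, ∃ l : List ℕ, (∀ a ∈ l, a ∈ A) ∧ l.sum = s ∧ 0 < wordK P l g r)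
    {μ ν : Measure (ℤ → G)} [IsProbabilityMeasure μ] [IsProbabilityMeasure ν]
    (hμ : Compatible θ P μ) (hν : Compatible θ P ν) (N : ℕ) {ι : Type*} [Fintype ι]
    (hN : Fintype.card ι = N) (n : ι → ℤ) (H : (ι → G) → ℝ) :
    coordMean μ n H = coordMean ν n H := by
  classical
  have : Nonempty G := ⟨r⟩
  induction N generalizing ι with
  | zero =>
    have : IsEmpty ι := Fintype.card_eq_zero_iff.1 hN
    have hconst : ∀ x : ℤ → G, H (fun i => x (n i)) = H isEmptyElim := fun x =>
      congrArg H (Subsingleton.elim _ _)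
    simp [coordMean_apply, hconst]
  | succ N ih =>
    have : Nonempty ι := Fintype.card_pos_iff.1 (by omega)
    have hD := isDiscrepancy_coordMean h hμ hν (ι := ι) fun j n H =>
      ih (by rw [Fintype.card_subtype_compl, Fintype.card_subtype_eq, hN]; rfl) n H
    exact sub_eq_zero.1 (hD.eq_zero h hA hs n H)

theorem eq_of_compatible (h : IsImitation A θ P) (hA : A.Nonempty) {s : ℕ} {r : G}
    (hs : ∀ g : G, ∃ l : List ℕ, (∀ a ∈ l, a ∈ A) ∧ l.sum = s ∧ 0 < wordK P l g r)
    {μ ν : Measure (ℤ → G)} [IsProbabilityMeasure μ] [IsProbabilityMeasure ν]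
    (hμ : Compatible θ P μ) (hν : Compatible θ P ν) : μ = ν := by
  have : Nonempty G := ⟨r⟩
  refine Measure.ext_of_forall_cylinder μ ν fun F v => ?_
  have hm : MeasurableSet {x : ℤ → G | ∀ i ∈ F, x i = v i} := measurableSet_cylinder F id v
  have hind : ∀ (ρ : Measure (ℤ → G)) [IsProbabilityMeasure ρ],
      coordMean ρ (fun i : F => (i : ℤ)) (fun u => if ∀ i, u i = v i then 1 else 0)
        = ρ.real {x | ∀ i ∈ F, x i = v i} := fun ρ _ => by
    rw [← integral_indicator_one hm, coordMean_apply]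
    congr 1
    ext x
    simp [Set.indicator_apply]
  refine (measureReal_eq_measureReal_iff).1 ?_
  rw [← hind μ, ← hind ν]
  exact coordMean_eq_of_compatible h hA hs hμ hν _ rfl _ _

end Uniqueness

/-- complete characterization of uniqueness: `𝒢(p)` is a
singleton iff `P_(·)` has exactly one closed intercommunicating class `R` and
every state of `R` has period equal to `gcd(A)`. -/
theorem stmt_17 {G : Type*} [Fintype G] [DecidableEq G] [Nonempty G]
    [MeasurableSpace G] [MeasurableSingletonClass G]
    (A : Set ℕ) (hA : A.Nonempty) (hApos : ∀ k ∈ A, 0 < k)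
    (θ : ℕ → ℝ) (hθpos : ∀ k ∈ A, 0 < θ k) (hθ0 : ∀ k, k ∉ A → θ k = 0)
    (hθsum : HasSum θ 1)
    (P : ℕ → G → G → ℝ)
    (hPnn : ∀ k ∈ A, ∀ i j : G, 0 ≤ P k i j)
    (hProw : ∀ k ∈ A, ∀ i : G, ∑ j, P k i j = 1)
    (d : ℕ) (hgcd : IsGCDOfSet A d) :
    (∃! μ : Measure (ℤ → G), IsProbabilityMeasure μ ∧ Compatible θ P μ) ↔
      (∃ R : Set G, IsInterClass A P R ∧ IsClosedClass A P R ∧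
        (∀ C : Set G, IsInterClass A P C → IsClosedClass A P C → C = R) ∧
        (∀ i ∈ R, IsGCDOfSet (ReturnDepths A P i) d)) := by
  have h : IsImitation A θ P := ⟨hApos, hθpos, hθ0, hθsum, hPnn, hProw⟩
  refine ⟨closed_class_of_unique h hA hgcd, ?_⟩
  rintro ⟨R, hR, hRcl, huniq, hper⟩
  obtain ⟨r, hr⟩ := hR.nonempty
  obtain ⟨s, hs⟩ := exists_common_depth h hA hgcd.1 hR hRcl huniq hr (hper r hr)
  obtain ⟨μ, hμ, -⟩ := exists_compatible h (fun _ => Set.univ) (fun _ => Set.univ_nonempty)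
    fun _ _ _ _ _ _ _ => Set.mem_univ _
  refine ⟨μ, hμ, fun ν hν => ?_⟩
  have := hμ.1
  have := hν.1
  exact eq_of_compatible h hA hs hν.2 hμ.2
end

section
/- Let G be countably infinite (say G = ℕ_+) and let p be an imitation kernel on G satisfying the following Doeblin-type hypothesis: there exist a state g_0 ∈ G, an integer n̄_0 ∈ ℕ_+ and ε > 0 such that for every i ∈ G there is a word 𝐛_i with depth s(𝐛_i) = n̄_0 and P_{𝐛_i}(i, g_0) ≥ ε. Then 𝒢(p) has exactly one element. -/
open MeasureTheory
open scoped BigOperators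

/-- The kernel of a word `𝐚 = (a_1, …, a_n)` (encoded as a list `[a_1, …, a_n]`)
on a countable alphabet: `P_𝐚 = P_(a_n) ⋯ P_(a_1)` as composition of kernels. -/
noncomputable def wordKc {G : Type*} [DecidableEq G]
    (P : ℕ → G → G → ℝ) : List ℕ → G → G → ℝ
  | [] => fun i j => if i = j then 1 else 0
  | a :: l => fun i j => ∑' m : G, wordKc P l i m * P a m j

/-- `μ` is compatible with the imitation kernel
`p(g | w_{-1}, w_{-2}, …) = ∑_{k ∈ A} θ_k P_(k)(w_{-k}, g)` (here `θ` vanishes off `A`). -/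
def CompatibleC {G : Type*} [MeasurableSpace G] (θ : ℕ → ℝ) (P : ℕ → G → G → ℝ)
    (μ : Measure (ℤ → G)) : Prop :=
  ∀ (n : ℤ) (g : G) (E : Set (ℤ → G)),
    MeasurableSet[MeasurableSpace.comap
      (fun x : ℤ → G => fun m : {m : ℤ // m < n} => x m.1) MeasurableSpace.pi] E →
    (μ (E ∩ {x | x n = g})).toReal
      = ∫ x in E, (∑' k : ℕ, θ k * P k (x (n - (k : ℤ))) g) ∂μ

/-- The average of `h` against the weights `w`. -/
noncomputable def rowAvg {G : Type*} (w h : G → ℝ) : ℝ := ∑' g, w g * h g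

/-- `F` is a bounded function of the coordinates in the finite set `S`. -/
def IsLocal {G : Type*} (S : Finset ℤ) (F : (ℤ → G) → ℝ) : Prop :=
  DependsOn F (S : Set ℤ) ∧ ∃ C, ∀ x, |F x| ≤ C

/-- Resample the coordinate `m` using the kernel `Q` applied to the coordinate `m - k`. -/
noncomputable def copyOp {G : Type*} (Q : G → G → ℝ) (k : ℕ) (m : ℤ) (F : (ℤ → G) → ℝ)
    (x : ℤ → G) : ℝ :=
  rowAvg (Q (x (m - k))) fun g => F (Function.update x m g)

/-- The total contribution at level `0` of the functions `h j` put at the levels `j ≤ d`, when all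
of them are pushed down to level `0` along the imitation walk. -/
noncomputable def pushDown {G : Type*} (θ : ℕ → ℝ) (P : ℕ → G → G → ℝ) :
    ℕ → (ℕ → G → ℝ) → G → ℝ
  | 0, h => h 0
  | d + 1, h => pushDown θ P d fun j i => h j i + θ (d + 1 - j) * rowAvg (P (d + 1 - j) i) (h (d + 1))

section RowAvg

variable {G : Type*} {w : G → ℝ}

theorem rowAvg_summable (hw : ∀ g, 0 ≤ w g) (hw1 : HasSum w 1) {h : G → ℝ} {C : ℝ}
    (hC : ∀ g, |h g| ≤ C) : Summable fun g => w g * h g := by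
  refine Summable.of_norm_bounded (hw1.summable.mul_right C) fun g => ?_
  rw [Real.norm_eq_abs, abs_mul, abs_of_nonneg (hw g)]
  exact mul_le_mul_of_nonneg_left (hC g) (hw g)

theorem rowAvg_mono (hw : ∀ g, 0 ≤ w g) (hw1 : HasSum w 1) {h h' : G → ℝ} {C C' : ℝ}
    (hC : ∀ g, |h g| ≤ C) (hC' : ∀ g, |h' g| ≤ C') (hle : ∀ g, h g ≤ h' g) :
    rowAvg w h ≤ rowAvg w h' :=
  (rowAvg_summable hw hw1 hC).tsum_le_tsum (fun g => mul_le_mul_of_nonneg_left (hle g) (hw g))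
    (rowAvg_summable hw hw1 hC')

theorem rowAvg_affine (hw : ∀ g, 0 ≤ w g) (hw1 : HasSum w 1) {h : G → ℝ} {C : ℝ}
    (hC : ∀ g, |h g| ≤ C) (a b : ℝ) : rowAvg w (fun g => a + b * h g) = a + b * rowAvg w h := by
  have h1 := (hw1.mul_right a).add ((rowAvg_summable hw hw1 hC).hasSum.mul_left b)
  rw [one_mul] at h1
  refine Eq.trans (tsum_congr fun g => ?_) h1.tsum_eq
  ring

theorem rowAvg_const (hw1 : HasSum w 1) (a : ℝ) : rowAvg w (fun _ => a) = a := by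
  have := (hw1.mul_right a).tsum_eq
  simpa [rowAvg] using this

theorem rowAvg_nonneg (hw : ∀ g, 0 ≤ w g) {h : G → ℝ} (h0 : ∀ g, 0 ≤ h g) : 0 ≤ rowAvg w h :=
  tsum_nonneg fun g => mul_nonneg (hw g) (h0 g)

theorem rowAvg_le (hw : ∀ g, 0 ≤ w g) (hw1 : HasSum w 1) {h : G → ℝ} {C a : ℝ}
    (hC : ∀ g, |h g| ≤ C) (ha : ∀ g, h g ≤ a) : rowAvg w h ≤ a :=
  (rowAvg_mono hw hw1 hC (h' := fun _ => a) (fun _ => le_rfl) ha).trans_eq (rowAvg_const hw1 a)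

theorem abs_rowAvg_le (hw : ∀ g, 0 ≤ w g) (hw1 : HasSum w 1) {h : G → ℝ} {C : ℝ}
    (hC : ∀ g, |h g| ≤ C) : |rowAvg w h| ≤ C := by
  refine abs_le.2 ⟨?_, rowAvg_le hw hw1 hC fun g => (abs_le.1 (hC g)).2⟩
  refine (rowAvg_const hw1 (-C)).symm.trans_le ?_
  exact rowAvg_mono hw hw1 (fun _ => le_rfl) hC fun g => (abs_le.1 (hC g)).1

end RowAvg

section IsLocal

variable {G : Type*} {S T : Finset ℤ} {F F' : (ℤ → G) → ℝ}

theorem IsLocal.mono (h : IsLocal S F) (hST : S ⊆ T) : IsLocal T F :=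
  ⟨h.1.mono (Finset.coe_subset.2 hST), h.2⟩

theorem IsLocal.const (S : Finset ℤ) (a : ℝ) : IsLocal S fun _ : ℤ → G => a :=
  ⟨fun _ _ _ => rfl, |a|, fun _ => le_rfl⟩

theorem IsLocal.add (h : IsLocal S F) (h' : IsLocal S F') : IsLocal S fun x => F x + F' x := by
  obtain ⟨h1, C, hC⟩ := h
  obtain ⟨h2, C', hC'⟩ := h'
  exact ⟨fun x y hxy => by simp only [h1 hxy, h2 hxy], C + C',
    fun x => (abs_add_le _ _).trans (add_le_add (hC x) (hC' x))⟩

theorem IsLocal.const_mul (h : IsLocal S F) (a : ℝ) : IsLocal S fun x => a * F x := by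
  obtain ⟨h1, C, hC⟩ := h
  refine ⟨fun x y hxy => by simp only [h1 hxy], |a| * C, fun x => ?_⟩
  rw [abs_mul]
  exact mul_le_mul_of_nonneg_left (hC x) (abs_nonneg a)

theorem IsLocal.copyOp {Q : G → G → ℝ} (hQ : ∀ i j, 0 ≤ Q i j) (hQ1 : ∀ i, HasSum (Q i) 1)
    (h : IsLocal S F) (k : ℕ) (m : ℤ) :
    IsLocal (insert (m - k) (S.erase m)) (copyOp Q k m F) := by
  obtain ⟨h1, C, hC⟩ := h
  refine ⟨fun x y hxy => ?_, C, fun x => abs_rowAvg_le (hQ _) (hQ1 _) fun g => hC _⟩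
  unfold _root_.copyOp
  rw [hxy (m - k) (by simp)]
  congr 1
  funext g
  refine h1 fun s hs => ?_
  by_cases hsm : s = m
  · subst hsm; simp
  · simp only [Function.update_of_ne hsm]
    exact hxy s (by simp_all)

end IsLocal

section PushDown

variable {G : Type*} {θ : ℕ → ℝ} {P : ℕ → G → G → ℝ}

theorem sum_reflect_le_one (hθ : ∀ k, 0 ≤ θ k) (hθ1 : HasSum θ 1) (d : ℕ) :
    ∑ j ∈ Finset.range (d + 1), θ (d + 1 - j) ≤ 1 := by
  have hinj : Set.InjOn (fun j => d + 1 - j) (Finset.range (d + 1) : Set ℕ) := by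
    intro a ha b hb hab
    simp at ha hb hab
    omega
  rw [← Finset.sum_image (f := θ) hinj]
  exact sum_le_hasSum _ (fun k _ => hθ k) hθ1

theorem pushDown_le_add (hθ : ∀ k, 0 ≤ θ k) (hθ1 : HasSum θ 1)
    (hP : ∀ k i j, 0 ≤ P k i j) (hP1 : ∀ k i, HasSum (P k i) 1) (d : ℕ) :
    ∀ (h h' : ℕ → G → ℝ) (a : ℕ → ℝ), (∀ j ≤ d, ∃ C, ∀ i, |h j i| ≤ C) →
      (∀ j ≤ d, ∃ C, ∀ i, |h' j i| ≤ C) → (∀ j ≤ d, 0 ≤ a j) →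
      (∀ j ≤ d, ∀ i, h' j i ≤ h j i + a j) →
      ∀ i, pushDown θ P d h' i ≤ pushDown θ P d h i + ∑ j ∈ Finset.range (d + 1), a j := by
  induction d with
  | zero =>
    intro h h' a _ _ _ hle i
    simpa [pushDown] using hle 0 le_rfl i
  | succ d ih =>
    intro h h' a hC hC' ha hle i
    have bdd : ∀ h : ℕ → G → ℝ, (∀ j ≤ d + 1, ∃ C, ∀ i, |h j i| ≤ C) → ∀ j ≤ d, ∃ C, ∀ i,
        |h j i + θ (d + 1 - j) * rowAvg (P (d + 1 - j) i) (h (d + 1))| ≤ C := by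
      intro h hC j hj
      obtain ⟨C, hC1⟩ := hC j (by omega)
      obtain ⟨C', hC2⟩ := hC (d + 1) le_rfl
      refine ⟨C + θ (d + 1 - j) * C', fun i => (abs_add_le _ _).trans (add_le_add (hC1 i) ?_)⟩
      rw [abs_mul, abs_of_nonneg (hθ _)]
      exact mul_le_mul_of_nonneg_left (abs_rowAvg_le (hP _ _) (hP1 _ _) hC2) (hθ _)
    have key := ih _ _ (fun j => a j + θ (d + 1 - j) * a (d + 1)) (bdd h hC) (bdd h' hC')
      (fun j hj => add_nonneg (ha j (by omega)) (mul_nonneg (hθ _) (ha _ le_rfl)))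
      (fun j hj i => by
        obtain ⟨C, hC1⟩ := hC (d + 1) le_rfl
        obtain ⟨C', hC2⟩ := hC' (d + 1) le_rfl
        have h1 : rowAvg (P (d + 1 - j) i) (h' (d + 1))
            ≤ a (d + 1) + 1 * rowAvg (P (d + 1 - j) i) (h (d + 1)) := by
          rw [← rowAvg_affine (hP _ _) (hP1 _ _) hC1]
          refine rowAvg_mono (hP _ _) (hP1 _ _) hC2 (C' := |a (d + 1)| + C)
            (fun g => (abs_add_le _ _).trans ?_) fun g => ?_
          · rw [one_mul]; gcongr; exact hC1 g
          · linarith [hle (d + 1) le_rfl g]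
        have h2 := mul_le_mul_of_nonneg_left h1 (hθ (d + 1 - j))
        have h3 := hle j (by omega) i
        nlinarith) i
    refine key.trans ?_
    rw [Finset.sum_add_distrib, ← Finset.sum_mul, Finset.sum_range_succ _ (d + 1)]
    have := mul_le_mul_of_nonneg_right (sum_reflect_le_one hθ hθ1 d) (ha _ le_rfl)
    simp only [pushDown]
    linarith

end PushDown

/-- A linear functional on bounded local functions which vanishes on functions of at most `r`
coordinates, is at most `c` on functions of at most `r + 1` coordinates with values in `[0, 1]`, and
is compatible with the imitation dynamics. -/
structure IsContrast {G : Type*} (θ : ℕ → ℝ) (P : ℕ → G → G → ℝ) (r : ℕ) (c : ℝ)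
    (D : ((ℤ → G) → ℝ) → ℝ) : Prop where
  add : ∀ S F F', IsLocal S F → IsLocal S F' → D (fun x => F x + F' x) = D F + D F'
  const_mul : ∀ a F, D (fun x => a * F x) = a * D F
  eq_zero : ∀ S F, S.card ≤ r → IsLocal S F → D F = 0
  le_mul : ∀ S F u, S.card ≤ r + 1 → IsLocal S F → (∀ x, 0 ≤ F x) → (∀ x, F x ≤ u) → D F ≤ c * u
  hasSum_copyOp : ∀ m S F, (∀ s ∈ S, s ≤ m) → IsLocal S F → (∀ x, 0 ≤ F x) →
    HasSum (fun k => θ k * D (copyOp (P k) k m F)) (D F)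

theorem hasSum_sub_sum_reflect_le {θ b : ℕ → ℝ} (hθ : ∀ k, 0 ≤ θ k) (hθ1 : HasSum θ 1) {B M : ℝ}
    (hB : HasSum (fun k => θ k * b k) B) (hb : ∀ k, b k ≤ M) (d : ℕ) :
    B - ∑ j ∈ Finset.range (d + 1), θ (d + 1 - j) * b (d + 1 - j)
      ≤ M * (1 - ∑ j ∈ Finset.range (d + 1), θ (d + 1 - j)) := by
  have hinj : Set.InjOn (fun j => d + 1 - j) (Finset.range (d + 1) : Set ℕ) := by
    intro a ha b hb hab
    simp at ha hb hab
    omega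
  have h1 : HasSum (fun k => θ k * (M - b k)) (M - B) := by
    have := (hθ1.mul_right M).sub hB
    rw [one_mul] at this
    simpa only [mul_sub] using this
  have h2 := sum_le_hasSum ((Finset.range (d + 1)).image fun j => d + 1 - j)
    (fun k _ => mul_nonneg (hθ k) (sub_nonneg.2 (hb k))) h1
  rw [Finset.sum_image hinj] at h2
  simp only [mul_sub, Finset.sum_sub_distrib, ← Finset.sum_mul] at h2
  linarith

theorem IsContrast.sum_le {G : Type*} {θ : ℕ → ℝ} {P : ℕ → G → G → ℝ} {r : ℕ} {c : ℝ}
    {D : ((ℤ → G) → ℝ) → ℝ} (hD : IsContrast θ P r c D) (hc : 0 ≤ c)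
    (hθ : ∀ k, 0 ≤ θ k) (hθz : θ 0 = 0) (hθ1 : HasSum θ 1)
    (hP : ∀ k i j, 0 ≤ P k i j) (hP1 : ∀ k i, HasSum (P k i) 1) (t : ℤ) (d : ℕ) :
    ∀ (J : Finset ℤ) (φ : (ℤ → G) → ℝ) (F : ℕ → (ℤ → G) → ℝ) (h : ℕ → G → ℝ) (u : ℕ → ℝ) (κ : ℝ),
      J.card ≤ r → (∀ s ∈ J, s ≤ t + d) → DependsOn φ (J : Set ℤ) → (∀ x, 0 ≤ φ x) →
      (∀ x, φ x ≤ 1) → (∀ j ≤ d, IsLocal (insert (t + j) J) (F j)) → (∀ j ≤ d, ∀ i, 0 ≤ h j i) →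
      (∀ j ≤ d, ∀ x, φ x * h j (x (t + j)) ≤ F j x) →
      (∀ j ≤ d, ∀ x, F j x ≤ u j - h j (x (t + j)) * (1 - φ x)) →
      (∀ i, κ ≤ pushDown θ P d h i) →
      ∑ j ∈ Finset.range (d + 1), D (F j) ≤ c * (∑ j ∈ Finset.range (d + 1), u j - κ) := by
  induction d with
  | zero =>
    intro J φ F h u κ hJ hJt hφ hφ0 hφ1 hF hh hlo hup hκ
    have hφl : IsLocal J φ := ⟨hφ, 1, fun x => abs_le.2 ⟨by linarith [hφ0 x], hφ1 x⟩⟩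
    have hlo := hlo 0 le_rfl
    have hup := hup 0 le_rfl
    have hh := hh 0 le_rfl
    have hF := hF 0 le_rfl
    have hcard : (insert (t + ((0 : ℕ) : ℤ)) J).card ≤ r + 1 :=
      (Finset.card_insert_le _ _).trans (by omega)
    simp only [zero_add, Finset.sum_range_one]
    simp only [pushDown] at hκ
    have hF0 : ∀ x, 0 ≤ F 0 x := fun x => (mul_nonneg (hφ0 x) (hh _)).trans (hlo x)
    rcases le_total κ 0 with hκ0 | hκ0
    · refine (hD.le_mul _ _ (u 0) hcard hF hF0 fun x => ?_).trans ?_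
      · nlinarith [hup x, mul_nonneg (hh (x (t + (0 : ℕ)))) (sub_nonneg.2 (hφ1 x))]
      · exact mul_le_mul_of_nonneg_left (by linarith) hc
    · have hl : IsLocal (insert (t + ((0 : ℕ) : ℤ)) J) fun x => F 0 x + -κ * φ x :=
        hF.add ((hφl.mono (Finset.subset_insert _ _)).const_mul _)
      have h1 := hD.add _ _ _ hF ((hφl.mono (Finset.subset_insert (t + ((0 : ℕ) : ℤ)) J)).const_mul (-κ))
      rw [hD.const_mul, hD.eq_zero J φ hJ hφl] at h1
      have h2 := hD.le_mul _ _ (u 0 - κ) hcard hl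
        (fun x => by nlinarith [hlo x, hκ (x (t + (0 : ℕ))), hφ0 x])
        (fun x => by nlinarith [hup x, hκ (x (t + (0 : ℕ))), hφ1 x])
      linarith
  | succ d ih =>
    intro J φ F h u κ hJ hJt hφ hφ0 hφ1 hF hh hlo hup hκ
    have hφb : ∀ x, |φ x| ≤ 1 := fun x => abs_le.2 ⟨by linarith [hφ0 x], hφ1 x⟩
    have hφl : IsLocal J φ := ⟨hφ, 1, hφb⟩
    have hF0 : ∀ j ≤ d + 1, ∀ x, 0 ≤ F j x := fun j hj x =>
      (mul_nonneg (hφ0 x) (hh j hj _)).trans (hlo j hj x)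
    have hhu : ∀ j ≤ d + 1, ∀ i, h j i ≤ u j := fun j hj i => by
      have h1 := hlo j hj fun _ => i
      have h2 := hup j hj fun _ => i
      linarith
    have hhb : ∀ j ≤ d + 1, ∀ i, |h j i| ≤ u j := fun j hj i => by
      rw [abs_of_nonneg (hh j hj i)]
      exact hhu j hj i
    have hFu : ∀ j ≤ d + 1, ∀ x, F j x ≤ u j := fun j hj x => by
      nlinarith [hup j hj x, mul_nonneg (hh j hj (x (t + j))) (sub_nonneg.2 (hφ1 x))]
    have hFb : ∀ j ≤ d + 1, ∀ x, |F j x| ≤ u j := fun j hj x => by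
      rw [abs_of_nonneg (hF0 j hj x)]
      exact hFu j hj x
    set m : ℤ := t + ((d + 1 : ℕ) : ℤ) with hm
    by_cases hmJ : m ∈ J
    · have hkill : D (F (d + 1)) = 0 :=
        hD.eq_zero J _ hJ (by
          have := hF (d + 1) le_rfl
          rwa [← hm, Finset.insert_eq_of_mem hmJ] at this)
      have hκ' : ∀ i, κ - u (d + 1) ≤ pushDown θ P d h i := by
        intro i
        have u0 : 0 ≤ u (d + 1) := (hh _ le_rfl i).trans (hhu _ le_rfl i)
        have h1 : pushDown θ P (d + 1) h i ≤ _ :=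
          pushDown_le_add hθ hθ1 hP hP1 d h _ (fun j => θ (d + 1 - j) * u (d + 1))
            (fun j hj => ⟨u j, hhb j (by omega)⟩)
            (fun j hj => ⟨u j + θ (d + 1 - j) * u (d + 1), fun i =>
              (abs_add_le _ _).trans (add_le_add (hhb j (by omega) i) (by
                rw [abs_mul, abs_of_nonneg (hθ _)]
                exact mul_le_mul_of_nonneg_left
                  (abs_rowAvg_le (hP _ _) (hP1 _ _) (hhb _ le_rfl)) (hθ _)))⟩)
            (fun j _ => mul_nonneg (hθ _) u0)
            (fun j hj i => by
              have := mul_le_mul_of_nonneg_left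
                (rowAvg_le (hP (d + 1 - j) i) (hP1 _ _) (hhb _ le_rfl) (hhu _ le_rfl))
                (hθ (d + 1 - j))
              linarith) i
        rw [← Finset.sum_mul] at h1
        have h2 := mul_le_mul_of_nonneg_right (sum_reflect_le_one hθ hθ1 d) u0
        linarith [hκ i]
      have hsum : HasSum (fun k => θ k * ∑ j ∈ Finset.range (d + 1), D (copyOp (P k) k m (F j)))
          (∑ j ∈ Finset.range (d + 1), D (F j)) := by
        simp_rw [Finset.mul_sum]
        refine hasSum_sum fun j hj => ?_
        have hj' := Finset.mem_range.1 hj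
        refine hD.hasSum_copyOp m _ _ (fun s hs => ?_) (hF j (by omega)) (hF0 j (by omega))
        rcases Finset.mem_insert.1 hs with rfl | hs
        · rw [hm]; push_cast; omega
        · exact hJt s hs
      have hle : ∀ k, θ k * ∑ j ∈ Finset.range (d + 1), D (copyOp (P k) k m (F j))
          ≤ θ k * (c * (∑ j ∈ Finset.range (d + 1), u j - (κ - u (d + 1)))) := by
        intro k
        rcases Nat.eq_zero_or_pos k with rfl | hk
        · simp [hθz]
        refine mul_le_mul_of_nonneg_left ?_ (hθ k)
        have hne : ∀ j ≤ d, t + (j : ℤ) ≠ m := fun j hj => by rw [hm]; push_cast; omega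
        refine ih (insert (m - k) (J.erase m)) (copyOp (P k) k m φ) _ h u _ ?_ ?_
          (hφl.copyOp (hP k) (hP1 k) k m).1 (fun x => rowAvg_nonneg (hP _ _) fun g => hφ0 _)
          (fun x => rowAvg_le (hP _ _) (hP1 _ _) (fun g => hφb _) fun g => hφ1 _) ?_
          (fun j hj => hh j (by omega)) ?_ ?_ hκ'
        · refine (Finset.card_insert_le _ _).trans ?_
          rw [Finset.card_erase_add_one hmJ]
          exact hJ
        · intro s hs
          rcases Finset.mem_insert.1 hs with rfl | hs
          · rw [hm]; push_cast; omega
          · have h1 := hJt s (Finset.mem_of_mem_erase hs)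
            have h2 := Finset.ne_of_mem_erase hs
            rw [hm] at h2
            push_cast at h1 h2
            omega
        · intro j hj
          have := (hF j (by omega)).copyOp (hP k) (hP1 k) k m
          rwa [Finset.erase_insert_of_ne (hne j hj), Finset.insert_comm] at this
        · intro j hj x
          have h1 := rowAvg_affine (hP k (x (m - k))) (hP1 _ _) (h := fun g => φ (Function.update x m g))
            (fun g => hφb _) 0 (h j (x (t + j)))
          rw [zero_add] at h1
          unfold copyOp
          rw [mul_comm, ← h1]
          refine rowAvg_mono (hP _ _) (hP1 _ _) (C := u j) (fun g => ?_)
            (fun g => hFb j (by omega) _) fun g => ?_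
          · rw [zero_add, abs_mul]
            exact (mul_le_mul (hhb j (by omega) _) (hφb _) (abs_nonneg _)
              ((abs_nonneg _).trans (hhb j (by omega) (x m)))).trans_eq (mul_one _)
          · have := hlo j (by omega) (Function.update x m g)
            rw [Function.update_of_ne (hne j hj)] at this
            linarith
        · intro j hj x
          have h1 := rowAvg_affine (hP k (x (m - k))) (hP1 _ _) (h := fun g => φ (Function.update x m g))
            (fun g => hφb _) (u j - h j (x (t + j))) (h j (x (t + j)))
          unfold copyOp
          have h2 : ∀ a b c : ℝ, a - b * (1 - c) = a - b + b * c := fun a b c => by ring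
          rw [h2, ← h1]
          refine rowAvg_mono (hP _ _) (hP1 _ _) (fun g => hFb j (by omega) _)
            (C' := |u j - h j (x (t + j))| + |h j (x (t + j))| * 1) (fun g => ?_) fun g => ?_
          · refine (abs_add_le _ _).trans (add_le_add le_rfl ?_)
            rw [abs_mul]
            exact mul_le_mul_of_nonneg_left (hφb _) (abs_nonneg _)
          · have := hup j (by omega) (Function.update x m g)
            rw [Function.update_of_ne (hne j hj)] at this
            linarith
      have hfin := hasSum_le hle hsum (hθ1.mul_right _)
      rw [Finset.sum_range_succ, hkill, Finset.sum_range_succ u]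
      rw [one_mul] at hfin
      refine (add_zero _).trans_le (hfin.trans_eq ?_)
      ring
    · have hE : ∀ k : ℕ, IsLocal (insert (m - k) J) (copyOp (P k) k m (F (d + 1))) := fun k => by
        have := (hF (d + 1) le_rfl).copyOp (hP k) (hP1 k) k m
        rwa [← hm, Finset.erase_insert hmJ] at this
      have hE0 : ∀ (k : ℕ) x, 0 ≤ copyOp (P k) k m (F (d + 1)) x := fun k x =>
        rowAvg_nonneg (hP _ _) fun g => hF0 _ le_rfl _
      have hEu : ∀ (k : ℕ) x, copyOp (P k) k m (F (d + 1)) x ≤ u (d + 1) := fun k x =>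
        rowAvg_le (hP _ _) (hP1 _ _) (fun g => hFb _ le_rfl _) fun g => hFu _ le_rfl _
      have hφm : ∀ x g, φ (Function.update x m g) = φ x := fun x g =>
        hφ fun s hs => Function.update_of_ne (fun e : s = m => hmJ (e ▸ Finset.mem_coe.1 hs)) _ _
      have hElo : ∀ (k : ℕ) x, φ x * rowAvg (P k (x (m - k))) (h (d + 1))
          ≤ copyOp (P k) k m (F (d + 1)) x := fun k x => by
        have h1 := rowAvg_affine (hP k (x (m - k))) (hP1 _ _) (hhb _ le_rfl) 0 (φ x)
        rw [zero_add] at h1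
        rw [← h1]
        refine rowAvg_mono (hP _ _) (hP1 _ _) (C := |φ x| * u (d + 1)) (fun g => ?_)
          (fun g => hFb _ le_rfl _) fun g => ?_
        · rw [zero_add, abs_mul]
          exact mul_le_mul_of_nonneg_left (hhb _ le_rfl _) (abs_nonneg _)
        · have := hlo _ le_rfl (Function.update x m g)
          rw [hφm, ← hm, Function.update_self] at this
          linarith
      have hEup : ∀ (k : ℕ) x, copyOp (P k) k m (F (d + 1)) x
          ≤ u (d + 1) - rowAvg (P k (x (m - k))) (h (d + 1)) * (1 - φ x) := fun k x => by
        have h1 := rowAvg_affine (hP k (x (m - k))) (hP1 _ _) (hhb _ le_rfl) (u (d + 1))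
          (-(1 - φ x))
        have h2 : ∀ a b c : ℝ, a - b * c = a + -c * b := fun a b c => by ring
        rw [h2, ← h1]
        refine rowAvg_mono (hP _ _) (hP1 _ _) (fun g => hFb _ le_rfl _)
          (C' := |u (d + 1)| + |-(1 - φ x)| * u (d + 1)) (fun g => ?_) fun g => ?_
        · refine (abs_add_le _ _).trans (add_le_add le_rfl ?_)
          rw [abs_mul]
          exact mul_le_mul_of_nonneg_left (hhb _ le_rfl _) (abs_nonneg _)
        · have := hup _ le_rfl (Function.update x m g)
          rw [hφm, ← hm, Function.update_self] at this
          linarith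
      have hmj : ∀ j ≤ d, m - ((d + 1 - j : ℕ) : ℤ) = t + j := fun j hj => by
        rw [hm, Nat.cast_sub (by omega)]; push_cast; ring
      have hEl : ∀ j ≤ d, IsLocal (insert (t + (j : ℤ)) J)
          (fun x => θ (d + 1 - j) * copyOp (P (d + 1 - j)) (d + 1 - j) m (F (d + 1)) x) :=
        fun j hj => by
          have := hE (d + 1 - j)
          rw [hmj j hj] at this
          exact this.const_mul _
      have key := ih J φ
        (fun j x => F j x + θ (d + 1 - j) * copyOp (P (d + 1 - j)) (d + 1 - j) m (F (d + 1)) x)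
        (fun j i => h j i + θ (d + 1 - j) * rowAvg (P (d + 1 - j) i) (h (d + 1)))
        (fun j => u j + θ (d + 1 - j) * u (d + 1)) κ hJ
        (fun s hs => by
          have h1 := hJt s hs
          have h2 : s ≠ m := fun h => hmJ (h ▸ hs)
          rw [hm] at h2
          push_cast at h1 h2
          omega) hφ hφ0 hφ1
        (fun j hj => (hF j (by omega)).add (hEl j hj))
        (fun j hj i => add_nonneg (hh j (by omega) i)
          (mul_nonneg (hθ _) (rowAvg_nonneg (hP _ _) (hh _ le_rfl))))
        (fun j hj x => by
          have h1 := hlo j (by omega) x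
          have h2 := mul_le_mul_of_nonneg_left (hElo (d + 1 - j) x) (hθ (d + 1 - j))
          rw [hmj j hj] at h2
          linarith)
        (fun j hj x => by
          have h1 := hup j (by omega) x
          have h2 := mul_le_mul_of_nonneg_left (hEup (d + 1 - j) x) (hθ (d + 1 - j))
          rw [hmj j hj] at h2
          linarith)
        hκ
      have hadd : ∀ j ∈ Finset.range (d + 1), D (fun x => F j x + θ (d + 1 - j) *
          copyOp (P (d + 1 - j)) (d + 1 - j) m (F (d + 1)) x)
          = D (F j) + θ (d + 1 - j) * D (copyOp (P (d + 1 - j)) (d + 1 - j) m (F (d + 1))) :=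
        fun j hj => by
          have hj' := Finset.mem_range.1 hj
          rw [hD.add _ _ _ (hF j (by omega)) (hEl j (by omega)), hD.const_mul]
      rw [Finset.sum_congr rfl hadd, Finset.sum_add_distrib, Finset.sum_add_distrib,
        ← Finset.sum_mul] at key
      have hsum := hD.hasSum_copyOp m _ _ (fun s hs => by
        rcases Finset.mem_insert.1 hs with rfl | hs
        · exact hm.ge
        · exact hJt s hs) (hF (d + 1) le_rfl) (hF0 _ le_rfl)
      have htail : D (F (d + 1)) - ∑ j ∈ Finset.range (d + 1), θ (d + 1 - j) *
          D (copyOp (P (d + 1 - j)) (d + 1 - j) m (F (d + 1)))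
          ≤ c * u (d + 1) * (1 - ∑ j ∈ Finset.range (d + 1), θ (d + 1 - j)) :=
        hasSum_sub_sum_reflect_le hθ hθ1 hsum (fun k => hD.le_mul _ _ (u (d + 1))
          ((Finset.card_insert_le _ _).trans (by omega)) (hE k) (hE0 k) (hEu k)) d
      rw [Finset.sum_range_succ, Finset.sum_range_succ u]
      linarith

theorem pushDown_mono_depth {G : Type*} {θ : ℕ → ℝ} {P : ℕ → G → G → ℝ} (hθ : ∀ k, 0 ≤ θ k) (hθ1 : HasSum θ 1)
    (hP : ∀ k i j, 0 ≤ P k i j) (hP1 : ∀ k i, HasSum (P k i) 1) {h : ℕ → G → ℝ}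
    (hC : ∀ j, ∃ C, ∀ i, |h j i| ≤ C) (h0 : ∀ j i, 0 ≤ h j i) {d e : ℕ} (hde : d ≤ e) (i : G) :
    pushDown θ P d h i ≤ pushDown θ P e h i := by
  induction e, hde using Nat.le_induction with
  | base => exact le_rfl
  | succ e _ ih =>
    refine ih.trans ((pushDown_le_add hθ hθ1 hP hP1 e
      (fun j i => h j i + θ (e + 1 - j) * rowAvg (P (e + 1 - j) i) (h (e + 1))) h (fun _ => 0) (fun j _ => ?_)
      (fun j _ => hC j) (fun _ _ => le_rfl) (fun j _ i => ?_) i).trans_eq (by simp [pushDown]))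
    · obtain ⟨C, hC1⟩ := hC j
      obtain ⟨C', hC2⟩ := hC (e + 1)
      refine ⟨C + θ (e + 1 - j) * C', fun i => (abs_add_le _ _).trans (add_le_add (hC1 i) ?_)⟩
      rw [abs_mul, abs_of_nonneg (hθ _)]
      exact mul_le_mul_of_nonneg_left (abs_rowAvg_le (hP _ _) (hP1 _ _) hC2) (hθ _)
    · have := mul_nonneg (hθ (e + 1 - j)) (rowAvg_nonneg (hP (e + 1 - j) i) (h0 (e + 1)))
      linarith

section Words

variable {G : Type*} [DecidableEq G] {θ : ℕ → ℝ} {P : ℕ → G → G → ℝ}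

theorem ENNReal.ofReal_tsum_le {α : Type*} {f : α → ℝ} (hf : ∀ a, 0 ≤ f a) :
    ENNReal.ofReal (∑' a, f a) ≤ ∑' a, ENNReal.ofReal (f a) := by
  by_cases h : Summable f
  · exact (ENNReal.ofReal_tsum_of_nonneg hf h).le
  · simp [tsum_eq_zero_of_not_summable h]

theorem wordKc_nonneg (hP : ∀ k i j, 0 ≤ P k i j) (l : List ℕ) (i j : G) : 0 ≤ wordKc P l i j := by
  induction l generalizing j with
  | nil => simp only [wordKc]; split_ifs <;> norm_num
  | cons a l ih => exact tsum_nonneg fun m => mul_nonneg (ih m) (hP a m j)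

theorem ofReal_wordKc_cons_le (hP : ∀ k i j, 0 ≤ P k i j) (a : ℕ) (l : List ℕ) (i j : G) :
    ENNReal.ofReal (wordKc P (a :: l) i j)
      ≤ ∑' m, ENNReal.ofReal (wordKc P l i m) * ENNReal.ofReal (P a m j) := by
  refine (ENNReal.ofReal_tsum_le fun m => mul_nonneg (wordKc_nonneg hP l i m) (hP a m j)).trans_eq ?_
  exact tsum_congr fun m => ENNReal.ofReal_mul (wordKc_nonneg hP l i m)

theorem exists_le_prod_map (θ : ℕ → ℝ) (n : ℕ) : ∃ ρ > 0, ∀ l : List ℕ, (∀ a ∈ l, 0 < a ∧ 0 < θ a) →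
    l.sum = n → l.length ≤ n ∧ ρ ≤ (l.map θ).prod := by
  obtain ⟨σ, hσ0, hσ1, hσ⟩ : ∃ σ > 0, σ ≤ 1 ∧ ∀ k ≤ n, 0 < θ k → σ ≤ θ k := by
    induction n with
    | zero =>
      by_cases h : 0 < θ 0
      · refine ⟨min 1 (θ 0), lt_min one_pos h, min_le_left _ _, fun k hk _ => ?_⟩
        rw [Nat.le_zero.1 hk]
        exact min_le_right _ _
      · exact ⟨1, one_pos, le_rfl, fun k hk h' => absurd (Nat.le_zero.1 hk ▸ h') h⟩
    | succ n ih =>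
      obtain ⟨σ, hσ0, hσ1, hσ⟩ := ih
      by_cases h : 0 < θ (n + 1)
      · refine ⟨min σ (θ (n + 1)), lt_min hσ0 h, (min_le_left _ _).trans hσ1, fun k hk hk0 => ?_⟩
        rcases Nat.le_succ_iff.1 hk with hk | rfl
        · exact (min_le_left _ _).trans (hσ k hk hk0)
        · exact min_le_right _ _
      · refine ⟨σ, hσ0, hσ1, fun k hk hk0 => ?_⟩
        rcases Nat.le_succ_iff.1 hk with hk | rfl
        · exact hσ k hk hk0
        · exact absurd hk0 h
  refine ⟨σ ^ n, pow_pos hσ0 n, fun l hl hln => ?_⟩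
  have key : ∀ l : List ℕ, (∀ a ∈ l, 0 < a ∧ 0 < θ a) → l.sum ≤ n →
      l.length ≤ l.sum ∧ σ ^ l.length ≤ (l.map θ).prod := by
    intro l
    induction l with
    | nil => simp
    | cons a l ih =>
      intro h1 h2
      simp only [List.sum_cons] at h2
      obtain ⟨ha, hθa⟩ := h1 a (by simp)
      obtain ⟨h3, h4⟩ := ih (fun b hb => h1 b (by simp [hb])) (by omega)
      refine ⟨by simp only [List.length_cons, List.sum_cons]; omega, ?_⟩
      rw [List.length_cons, pow_succ', List.map_cons, List.prod_cons]
      exact mul_le_mul (hσ a (by omega) hθa) h4 (pow_nonneg hσ0.le _) hθa.le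
  obtain ⟨h1, h2⟩ := key l hl hln.le
  exact ⟨h1.trans hln.le, (pow_le_pow_of_le_one hσ0.le hσ1 (h1.trans hln.le)).trans h2⟩

theorem ofReal_wordKc_le_pushDown (hθ : ∀ k, 0 ≤ θ k) (hθ1 : HasSum θ 1)
    (hP : ∀ k i j, 0 ≤ P k i j) (hP1 : ∀ k i, HasSum (P k i) 1) (i : G) (l : List ℕ) :
    (∀ a ∈ l, 0 < a) → ∀ (h : ℕ → G → ℝ), (∀ j, ∃ C, ∀ i, |h j i| ≤ C) → (∀ j i, 0 ≤ h j i) →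
      ∀ d, l.sum ≤ d → ENNReal.ofReal (l.map θ).prod *
        ∑' j, ENNReal.ofReal (wordKc P l i j) * ENNReal.ofReal (h l.sum j)
          ≤ ENNReal.ofReal (pushDown θ P d h i) := by
  induction l with
  | nil =>
    intro _ h hC h0 d hd
    rw [tsum_eq_single i (fun j hj => by simp [wordKc, hj.symm])]
    simp only [wordKc, if_true, List.map_nil, List.prod_nil, ENNReal.ofReal_one, one_mul, List.sum_nil]
    exact ENNReal.ofReal_le_ofReal (pushDown_mono_depth hθ hθ1 hP hP1 hC h0 (Nat.zero_le d) i)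
  | cons a l ih =>
    intro hl h hC h0 d hd
    refine le_trans ?_ (ENNReal.ofReal_le_ofReal (pushDown_mono_depth hθ hθ1 hP hP1 hC h0 hd i))
    have ha := hl a (by simp)
    obtain ⟨e, he⟩ : ∃ e, (a :: l).sum = e + 1 :=
      ⟨(a :: l).sum - 1, by rw [List.sum_cons]; omega⟩
    have hea : e + 1 - l.sum = a := by rw [← he, List.sum_cons]; omega
    have hle : l.sum ≤ e := by rw [List.sum_cons] at he; omega
    rw [he]
    have hR0 : ∀ k i, 0 ≤ rowAvg (P k i) (h (e + 1)) := fun k i => rowAvg_nonneg (hP k i) (h0 (e + 1))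
    refine le_trans ?_ (ih (fun b hb => hl b (by simp [hb])) _ (fun j => ?_) (fun j i => ?_) e hle)
    · rw [hea, List.map_cons, List.prod_cons, ENNReal.ofReal_mul (hθ a),
        mul_comm (ENNReal.ofReal (θ a)), mul_assoc]
      refine mul_le_mul_right ?_ _
      obtain ⟨C, hC⟩ := hC (e + 1)
      have h1 : ∀ m, ENNReal.ofReal (θ a) * ∑' j, ENNReal.ofReal (P a m j) *
          ENNReal.ofReal (h (e + 1) j)
          ≤ ENNReal.ofReal (h l.sum m + θ a * rowAvg (P a m) (h (e + 1))) := fun m => by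
        have h2 : ENNReal.ofReal (rowAvg (P a m) (h (e + 1)))
            = ∑' j, ENNReal.ofReal (P a m j) * ENNReal.ofReal (h (e + 1) j) := by
          rw [rowAvg, ENNReal.ofReal_tsum_of_nonneg
            (fun j => mul_nonneg (hP a m j) (h0 (e + 1) j)) (rowAvg_summable (hP a m) (hP1 a m) hC)]
          exact tsum_congr fun j => ENNReal.ofReal_mul (hP a m j)
        rw [← h2, ← ENNReal.ofReal_mul (hθ a)]
        exact ENNReal.ofReal_le_ofReal (by linarith [h0 l.sum m])
      refine le_trans ?_ (ENNReal.tsum_le_tsum fun m => mul_le_mul_right (h1 m) _)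
      simp_rw [mul_left_comm _ (ENNReal.ofReal (θ a)), ENNReal.tsum_mul_left]
      refine mul_le_mul_right ?_ _
      calc _ ≤ ∑' j, (∑' m, ENNReal.ofReal (wordKc P l i m) * ENNReal.ofReal (P a m j)) *
            ENNReal.ofReal (h (e + 1) j) :=
            ENNReal.tsum_le_tsum fun j => mul_le_mul_left (ofReal_wordKc_cons_le hP a l i j) _
        _ = _ := by
            simp_rw [← ENNReal.tsum_mul_right, ← ENNReal.tsum_mul_left, mul_assoc]
            exact ENNReal.tsum_comm
    · obtain ⟨C, hC1⟩ := hC j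
      obtain ⟨C', hC2⟩ := hC (e + 1)
      refine ⟨C + θ (e + 1 - j) * C', fun i => (abs_add_le _ _).trans (add_le_add (hC1 i) ?_)⟩
      rw [abs_mul, abs_of_nonneg (hθ _)]
      exact mul_le_mul_of_nonneg_left (abs_rowAvg_le (hP _ _) (hP1 _ _) hC2) (hθ _)
    · exact add_nonneg (h0 j i) (mul_nonneg (hθ _) (hR0 _ i))

/-- The Doeblin condition: words of depth `n` made of indices charged by `θ` lead from any state to
`g₀` with probability at least `ε`. -/
def IsDoeblin (θ : ℕ → ℝ) (P : ℕ → G → G → ℝ) (g₀ : G) (n : ℕ) (ε : ℝ) : Prop :=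
  0 < ε ∧ ∀ i, ∃ l : List ℕ, (∀ a ∈ l, 0 < a ∧ 0 < θ a) ∧ l.sum = n ∧ ε ≤ wordKc P l i g₀

theorem IsDoeblin.exists_le_pushDown (hθ : ∀ k, 0 ≤ θ k) (hθ1 : HasSum θ 1)
    (hP : ∀ k i j, 0 ≤ P k i j) (hP1 : ∀ k i, HasSum (P k i) 1) {g₀ : G} {n : ℕ} {ε : ℝ}
    (h : IsDoeblin θ P g₀ n ε) :
    ∃ δ > 0, ∀ i, δ ≤ pushDown θ P n (fun j g => if j = n ∧ g = g₀ then 1 else 0) i := by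
  obtain ⟨ρ, hρ, hl⟩ := exists_le_prod_map θ n
  refine ⟨ρ * ε, mul_pos hρ h.1, fun i => ?_⟩
  obtain ⟨l, h1, h2, h3⟩ := h.2 i
  have h4 := ofReal_wordKc_le_pushDown hθ hθ1 hP hP1 i l (fun a ha => (h1 a ha).1)
    (fun j g => if j = n ∧ g = g₀ then 1 else 0)
    (fun j => ⟨1, fun g => by split_ifs <;> simp⟩) (fun j g => by positivity) n h2.le
  rw [tsum_eq_single g₀ (fun j hj => by simp [hj]), if_pos ⟨h2, rfl⟩, ENNReal.ofReal_one, mul_one,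
    ← ENNReal.ofReal_mul (hρ.le.trans (hl l h1 h2).2)] at h4
  have h5 : ρ * ε ≤ (l.map θ).prod * wordKc P l i g₀ :=
    mul_le_mul (hl l h1 h2).2 h3 h.1.le (hρ.le.trans (hl l h1 h2).2)
  rw [ENNReal.ofReal_le_ofReal_iff'] at h4
  rcases h4 with h4 | h4
  · exact h5.trans h4
  · exact absurd (h5.trans h4) (not_le.2 (mul_pos hρ h.1))

end Words

/-- Standing assumptions on the delays `θ` and the kernels `P` of an imitation kernel. -/
structure IsImitation_s19 {G : Type*} (θ : ℕ → ℝ) (P : ℕ → G → G → ℝ) : Prop where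
  theta_nonneg : ∀ k, 0 ≤ θ k
  theta_zero : θ 0 = 0
  theta_sum : HasSum θ 1
  ker_nonneg : ∀ k i j, 0 ≤ P k i j
  ker_sum : ∀ k i, HasSum (P k i) 1

/-- The probability that the coordinate `m` takes the value `g`, given the past. -/
noncomputable def nextProb {G : Type*} (θ : ℕ → ℝ) (P : ℕ → G → G → ℝ) (m : ℤ) (x : ℤ → G)
    (g : G) : ENNReal :=
  ∑' k : ℕ, ENNReal.ofReal (θ k) * ENNReal.ofReal (P k (x (m - k)) g)

/-- The `σ`-algebra of the coordinates before `m`. -/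
abbrev pastSpace (G : Type*) [MeasurableSpace G] (m : ℤ) : MeasurableSpace (ℤ → G) :=
  MeasurableSpace.comap (fun x : ℤ → G => fun s : {s : ℤ // s < m} => x s.1) MeasurableSpace.pi

section Measurability

variable {G : Type*} [MeasurableSpace G]

theorem pastSpace_le (m : ℤ) : pastSpace G m ≤ MeasurableSpace.pi := by
  refine Measurable.comap_le ?_
  exact measurable_pi_lambda _ fun s => measurable_pi_apply s.1

theorem measurable_pastSpace_eval {m s : ℤ} (hs : s < m) :
    Measurable[pastSpace G m] fun x : ℤ → G => x s := by
  have h1 : Measurable fun y : {s : ℤ // s < m} → G => y ⟨s, hs⟩ := measurable_pi_apply _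
  exact h1.comp (comap_measurable _)

theorem measurableSet_eval_eq [MeasurableSingletonClass G] (m : ℤ) (g : G) :
    MeasurableSet {x : ℤ → G | x m = g} :=
  (measurable_pi_apply m : Measurable fun x : ℤ → G => x m) (measurableSet_singleton g)

theorem DependsOn.measurable_of_eval [Countable G] [MeasurableSingletonClass G] {β : Type*}
    [MeasurableSpace β] {f : (ℤ → G) → β} {S : Finset ℤ} (hf : DependsOn f (S : Set ℤ))
    {ms : MeasurableSpace (ℤ → G)} (hms : ∀ s ∈ S, Measurable[ms] fun x : ℤ → G => x s) :
    Measurable[ms] f := by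
  rcases isEmpty_or_nonempty (ℤ → G) with h | ⟨⟨x₀⟩⟩
  · exact fun _ _ => Subsingleton.measurableSet
  have : Nonempty β := ⟨f x₀⟩
  have h1 : f = (Function.extend (Set.domRestrict (S : Set ℤ)) f fun _ => f x₀) ∘
      Set.domRestrict (S : Set ℤ) := by
    funext x
    exact ((dependsOn_iff_factorsThrough.1 hf).extend_apply _ x).symm
  rw [h1]
  have h2 : Measurable[ms] (Set.domRestrict (S : Set ℤ) : (ℤ → G) → _) :=
    measurable_pi_lambda _ fun s => hms s.1 s.2
  exact Measurable.comp (Measurable.of_discrete) h2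

theorem DependsOn.measurable' [Countable G] [MeasurableSingletonClass G] {β : Type*}
    [MeasurableSpace β] {f : (ℤ → G) → β} {S : Finset ℤ} (hf : DependsOn f (S : Set ℤ)) :
    Measurable f :=
  hf.measurable_of_eval fun s _ => measurable_pi_apply s

theorem DependsOn.measurable_past [Countable G] [MeasurableSingletonClass G] {β : Type*}
    [MeasurableSpace β] {f : (ℤ → G) → β} {S : Finset ℤ} (hf : DependsOn f (S : Set ℤ)) {m : ℤ}
    (hS : ∀ s ∈ S, s < m) : Measurable[pastSpace G m] f :=
  hf.measurable_of_eval fun s hs => measurable_pastSpace_eval (hS s hs)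

theorem IsLocal.integrable [Countable G] [MeasurableSingletonClass G] {S : Finset ℤ}
    {F : (ℤ → G) → ℝ} (hF : IsLocal S F) (μ : Measure (ℤ → G)) [IsFiniteMeasure μ] :
    Integrable F μ := by
  obtain ⟨C, hC⟩ := hF.2
  exact Integrable.of_bound hF.1.measurable'.aestronglyMeasurable C (ae_of_all _ hC)

end Measurability

section Rows

variable {G : Type*} {θ : ℕ → ℝ} {P : ℕ → G → G → ℝ}

theorem IsImitation_s19.tsum_ker (h : IsImitation_s19 θ P) (k : ℕ) (i : G) :
    ∑' g, ENNReal.ofReal (P k i g) = 1 := by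
  rw [← ENNReal.ofReal_tsum_of_nonneg (h.ker_nonneg k i) (h.ker_sum k i).summable,
    (h.ker_sum k i).tsum_eq, ENNReal.ofReal_one]

theorem IsImitation_s19.tsum_theta (h : IsImitation_s19 θ P) : ∑' k, ENNReal.ofReal (θ k) = 1 := by
  rw [← ENNReal.ofReal_tsum_of_nonneg h.theta_nonneg h.theta_sum.summable, h.theta_sum.tsum_eq,
    ENNReal.ofReal_one]

theorem IsImitation_s19.tsum_nextProb (h : IsImitation_s19 θ P) (m : ℤ) (x : ℤ → G) :
    ∑' g, nextProb θ P m x g = 1 := by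
  unfold nextProb
  rw [ENNReal.tsum_comm]
  simp_rw [ENNReal.tsum_mul_left, h.tsum_ker, mul_one, h.tsum_theta]

theorem IsImitation_s19.nextProb_le_one (h : IsImitation_s19 θ P) (m : ℤ) (x : ℤ → G) (g : G) :
    nextProb θ P m x g ≤ 1 :=
  (ENNReal.le_tsum g).trans_eq (h.tsum_nextProb m x)

theorem IsImitation_s19.ker_le_one (h : IsImitation_s19 θ P) (k : ℕ) (i j : G) : P k i j ≤ 1 :=
  le_hasSum (h.ker_sum k i) j fun g _ => h.ker_nonneg k i g

theorem IsImitation_s19.ofReal_tsum (h : IsImitation_s19 θ P) (m : ℤ) (x : ℤ → G) (g : G) :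
    ENNReal.ofReal (∑' k : ℕ, θ k * P k (x (m - k)) g) = nextProb θ P m x g := by
  rw [ENNReal.ofReal_tsum_of_nonneg
    (fun k => mul_nonneg (h.theta_nonneg k) (h.ker_nonneg k _ _))
    (Summable.of_nonneg_of_le (fun k => mul_nonneg (h.theta_nonneg k) (h.ker_nonneg k _ _))
      (fun k => mul_le_of_le_one_right (h.theta_nonneg k) (h.ker_le_one k _ _))
      h.theta_sum.summable)]
  exact tsum_congr fun k => ENNReal.ofReal_mul (h.theta_nonneg k)

end Rows

theorem ENNReal.measurable_tsum_of {α ι : Type*} [Countable ι] {ms : MeasurableSpace α}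
    {f : ι → α → ENNReal} (hf : ∀ i, Measurable (f i)) : Measurable fun x => ∑' i, f i x :=
  Measurable.tsum hf

section Compat

variable {G : Type*} [Countable G] [MeasurableSpace G] [MeasurableSingletonClass G]
  {θ : ℕ → ℝ} {P : ℕ → G → G → ℝ}

theorem IsImitation_s19.measurable_nextProb_past (h : IsImitation_s19 θ P) (m : ℤ) (g : G) :
    Measurable[pastSpace G m] fun x : ℤ → G => nextProb θ P m x g := by
  refine ENNReal.measurable_tsum_of (ms := pastSpace G m) fun k => ?_
  rcases Nat.eq_zero_or_pos k with rfl | hk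
  · simp only [h.theta_zero, ENNReal.ofReal_zero, zero_mul]
    exact measurable_const
  · refine DependsOn.measurable_past (S := {m - k}) (fun x y hxy => ?_) fun s hs => ?_
    · rw [hxy (m - k) (by simp)]
    · rw [Finset.mem_singleton.1 hs]
      omega

theorem IsImitation_s19.measurable_nextProb (h : IsImitation_s19 θ P) (m : ℤ) (g : G) :
    Measurable fun x : ℤ → G => nextProb θ P m x g :=
  (h.measurable_nextProb_past m g).mono (pastSpace_le m) le_rfl

theorem IsImitation_s19.compatibleC_iff (h : IsImitation_s19 θ P) (μ : Measure (ℤ → G))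
    [IsProbabilityMeasure μ] : CompatibleC θ P μ ↔
      ∀ (n : ℤ) (g : G) (E : Set (ℤ → G)), MeasurableSet[pastSpace G n] E →
        μ (E ∩ {x | x n = g}) = ∫⁻ x in E, nextProb θ P n x g ∂μ := by
  have key : ∀ (n : ℤ) (g : G) (E : Set (ℤ → G)),
      ∫ x in E, (∑' k : ℕ, θ k * P k (x (n - (k : ℤ))) g) ∂μ
        = (∫⁻ x in E, nextProb θ P n x g ∂μ).toReal := fun n g E => by
    have h1 : ∀ x : ℤ → G, ∑' k : ℕ, θ k * P k (x (n - (k : ℤ))) g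
        = (nextProb θ P n x g).toReal := fun x => by
      rw [← h.ofReal_tsum, ENNReal.toReal_ofReal
        (tsum_nonneg fun k => mul_nonneg (h.theta_nonneg k) (h.ker_nonneg k _ _))]
    simp_rw [h1]
    exact integral_toReal (h.measurable_nextProb n g).aemeasurable
      (ae_of_all _ fun x => (h.nextProb_le_one n x g).trans_lt ENNReal.one_lt_top)
  have hfin : ∀ (n : ℤ) (g : G) (E : Set (ℤ → G)), ∫⁻ x in E, nextProb θ P n x g ∂μ ≠ ⊤ :=
    fun n g E => ne_top_of_le_ne_top (measure_ne_top (μ.restrict E) Set.univ)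
      ((lintegral_mono fun x => h.nextProb_le_one n x g).trans_eq lintegral_one)
  refine forall_congr' fun n => forall_congr' fun g => forall_congr' fun E =>
    imp_congr_right fun _ => ?_
  rw [key, ENNReal.toReal_eq_toReal_iff' (measure_ne_top _ _) (hfin n g E)]

theorem IsImitation_s19.setLIntegral_eq (h : IsImitation_s19 θ P) {μ : Measure (ℤ → G)}
    [IsProbabilityMeasure μ] (hμ : CompatibleC θ P μ) {m : ℤ} (g : G) {f : (ℤ → G) → ENNReal}
    (hf : Measurable[pastSpace G m] f) :
    ∫⁻ x in {x | x m = g}, f x ∂μ = ∫⁻ x, nextProb θ P m x g * f x ∂μ := by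
  have hq := h.measurable_nextProb m g
  have hle := pastSpace_le (G := G) m
  have h1 : (μ.restrict {x | x m = g}).trim hle
      = (μ.withDensity fun x => nextProb θ P m x g).trim hle := by
    refine @Measure.ext _ (pastSpace G m) _ _ fun E hE => ?_
    rw [trim_measurableSet_eq hle hE, trim_measurableSet_eq hle hE,
      Measure.restrict_apply (hle E hE), withDensity_apply _ (hle E hE)]
    exact (h.compatibleC_iff μ).1 hμ m g E hE
  rw [← lintegral_trim hle hf, h1, lintegral_trim hle hf,
    lintegral_withDensity_eq_lintegral_mul _ hq (hf.mono hle le_rfl)]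
  rfl

theorem IsImitation_s19.lintegral_eq (h : IsImitation_s19 θ P) {μ : Measure (ℤ → G)}
    [IsProbabilityMeasure μ] (hμ : CompatibleC θ P μ) {m : ℤ} {S : Finset ℤ} {F : (ℤ → G) → ℝ}
    (hS : ∀ s ∈ S, s ≤ m) (hF : IsLocal S F) (hF0 : ∀ x, 0 ≤ F x) :
    ∫⁻ x, ENNReal.ofReal (F x) ∂μ = ∑' k : ℕ, ENNReal.ofReal (θ k) *
      ∫⁻ x, ENNReal.ofReal (copyOp (P k) k m F x) ∂μ := by
  obtain ⟨C, hC⟩ := hF.2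
  have hupd : ∀ g, DependsOn (fun x => ENNReal.ofReal (F (Function.update x m g)))
      ((S.erase m : Finset ℤ) : Set ℤ) := fun g x y hxy => by
    refine congrArg _ (hF.1 fun s hs => ?_)
    by_cases hsm : s = m
    · subst hsm; simp
    · simp only [Function.update_of_ne hsm]
      exact hxy s (by simp_all)
  have hker : ∀ (k : ℕ) (g : G), Measurable fun x : ℤ → G => ENNReal.ofReal (P k (x (m - k)) g) :=
    fun k g => DependsOn.measurable' (S := {m - k}) fun x y hxy => by rw [hxy (m - k) (by simp)]
  have hset := measurableSet_eval_eq (G := G) m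
  have hcopy : ∀ (k : ℕ) x, ENNReal.ofReal (copyOp (P k) k m F x) = ∑' g,
      ENNReal.ofReal (P k (x (m - k)) g) * ENNReal.ofReal (F (Function.update x m g)) :=
    fun k x => by
      rw [copyOp, rowAvg, ENNReal.ofReal_tsum_of_nonneg
        (fun g => mul_nonneg (h.ker_nonneg _ _ _) (hF0 _))
        (rowAvg_summable (h.ker_nonneg _ _) (h.ker_sum _ _) fun g => hC _)]
      exact tsum_congr fun g => ENNReal.ofReal_mul (h.ker_nonneg _ _ _)
  calc ∫⁻ x, ENNReal.ofReal (F x) ∂μ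
      = ∑' g, ∫⁻ x in {x | x m = g}, ENNReal.ofReal (F x) ∂μ := by
        rw [← lintegral_iUnion hset fun a b hab => Set.disjoint_left.2 fun x ha hb =>
          hab (ha.symm.trans hb)]
        have : ⋃ g, {x : ℤ → G | x m = g} = Set.univ := Set.eq_univ_of_forall fun x =>
          Set.mem_iUnion.2 ⟨x m, rfl⟩
        rw [this, Measure.restrict_univ]
    _ = ∑' g, ∫⁻ x in {x | x m = g}, ENNReal.ofReal (F (Function.update x m g)) ∂μ := by
        refine tsum_congr fun g => setLIntegral_congr_fun (hset g) fun x hx => ?_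
        have : x m = g := hx
        simp only [← this, Function.update_eq_self]
    _ = ∑' g, ∫⁻ x, nextProb θ P m x g * ENNReal.ofReal (F (Function.update x m g)) ∂μ := by
        refine tsum_congr fun g => h.setLIntegral_eq hμ g ((hupd g).measurable_past fun s hs => ?_)
        exact lt_of_le_of_ne (hS s (Finset.mem_of_mem_erase hs)) (Finset.ne_of_mem_erase hs)
    _ = ∑' g, ∑' k : ℕ, ENNReal.ofReal (θ k) * ∫⁻ x, ENNReal.ofReal (P k (x (m - k)) g) *
          ENNReal.ofReal (F (Function.update x m g)) ∂μ := by
        refine tsum_congr fun g => ?_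
        have hm : ∀ k : ℕ, Measurable fun x : ℤ → G => ENNReal.ofReal (P k (x (m - k)) g) *
          ENNReal.ofReal (F (Function.update x m g)) := fun k => (hker k g).mul (hupd g).measurable'
        simp_rw [nextProb, ← ENNReal.tsum_mul_right, mul_assoc]
        rw [lintegral_tsum fun k => ((hm k).const_mul _).aemeasurable]
        exact tsum_congr fun k => lintegral_const_mul _ (hm k)
    _ = ∑' k : ℕ, ∑' g, ENNReal.ofReal (θ k) * ∫⁻ x, ENNReal.ofReal (P k (x (m - k)) g) *
          ENNReal.ofReal (F (Function.update x m g)) ∂μ := ENNReal.tsum_comm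
    _ = _ := by
        refine tsum_congr fun k => ?_
        simp_rw [ENNReal.tsum_mul_left, hcopy]
        exact congrArg _
          (lintegral_tsum fun g => ((hker k g).mul (hupd g).measurable').aemeasurable).symm

theorem IsImitation_s19.hasSum_integral_copyOp (h : IsImitation_s19 θ P) {μ : Measure (ℤ → G)}
    [IsProbabilityMeasure μ] (hμ : CompatibleC θ P μ) {m : ℤ} {S : Finset ℤ} {F : (ℤ → G) → ℝ}
    (hS : ∀ s ∈ S, s ≤ m) (hF : IsLocal S F) (hF0 : ∀ x, 0 ≤ F x) :
    HasSum (fun k => θ k * ∫ x, copyOp (P k) k m F x ∂μ) (∫ x, F x ∂μ) := by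
  have hloc : ∀ k : ℕ, IsLocal _ (copyOp (P k) k m F) := fun k =>
    hF.copyOp (h.ker_nonneg k) (h.ker_sum k) k m
  have hF1 : ∀ (k : ℕ) x, 0 ≤ copyOp (P k) k m F x := fun k x =>
    rowAvg_nonneg (h.ker_nonneg _ _) fun g => hF0 _
  have h1 : ∀ k : ℕ, ENNReal.ofReal (θ k) * ∫⁻ x, ENNReal.ofReal (copyOp (P k) k m F x) ∂μ
      = ENNReal.ofReal (θ k * ∫ x, copyOp (P k) k m F x ∂μ) := fun k => by
    rw [ENNReal.ofReal_mul (h.theta_nonneg k),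
      ofReal_integral_eq_lintegral_ofReal ((hloc k).integrable μ) (ae_of_all _ (hF1 k))]
  have h2 := h.lintegral_eq hμ hS hF hF0
  rw [← ofReal_integral_eq_lintegral_ofReal (hF.integrable μ) (ae_of_all _ hF0)] at h2
  simp_rw [h1] at h2
  have h3 := ENNReal.hasSum_toReal (h2.symm ▸ ENNReal.ofReal_ne_top)
  rw [← ENNReal.tsum_toReal_eq (fun _ => ENNReal.ofReal_ne_top), ← h2,
    ENNReal.toReal_ofReal (integral_nonneg hF0)] at h3
  refine h3.congr_fun fun k => ?_
  rw [ENNReal.toReal_ofReal (mul_nonneg (h.theta_nonneg k) (integral_nonneg (hF1 k)))]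

end Compat

theorem IsLocal.exists_eq_const {G : Type*} {S : Finset ℤ} {F : (ℤ → G) → ℝ} [Nonempty G]
    (hF : IsLocal S F) (hS : S.card = 0) : ∃ a, F = fun _ => a := by
  obtain ⟨x₀⟩ : Nonempty (ℤ → G) := inferInstance
  refine ⟨F x₀, funext fun x => hF.1 fun s hs => ?_⟩
  rw [Finset.card_eq_zero.1 hS] at hs
  simp at hs

theorem IsContrast.le_mul_one_sub {G : Type*} [DecidableEq G] {θ : ℕ → ℝ}
    {P : ℕ → G → G → ℝ} (h : IsImitation_s19 θ P) {r : ℕ} {c δ : ℝ}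
    {D : ((ℤ → G) → ℝ) → ℝ} (hD : IsContrast θ P r c D) (hc : 0 ≤ c) {g₀ : G} {n : ℕ}
    (hδ1 : δ ≤ 1)
    (hδ : ∀ i, δ ≤ pushDown θ P n (fun j g => if j = n ∧ g = g₀ then 1 else 0) i)
    {S : Finset ℤ} {F : (ℤ → G) → ℝ} (hS : S.card ≤ r + 1) (hF : IsLocal S F)
    (hF0 : ∀ x, 0 ≤ F x) (hF1 : ∀ x, F x ≤ 1) : D F ≤ c * (1 - δ) := by
  rcases S.eq_empty_or_nonempty with rfl | hne
  · rw [hD.eq_zero ∅ F (by simp) hF]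
    exact mul_nonneg hc (sub_nonneg.2 hδ1)
  set m := S.max' hne with hm
  have hmS : m ∈ S := S.max'_mem hne
  have hDj : ∀ j, D (fun x => (if j = n then 1 else 0) * F x) = if j = n then D F else 0 :=
    fun j => by rw [hD.const_mul]; split_ifs <;> simp
  have key := hD.sum_le hc h.theta_nonneg h.theta_zero h.theta_sum h.ker_nonneg h.ker_sum (m - n) n
    (S.erase m) (fun x => F (Function.update x m g₀)) (fun j x => (if j = n then 1 else 0) * F x)
    (fun j g => if j = n ∧ g = g₀ then 1 else 0) (fun j => if j = n then 1 else 0) δ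
    (by rw [Finset.card_erase_of_mem hmS]; omega)
    (fun s hs => by
      have := S.le_max' s (Finset.mem_of_mem_erase hs)
      omega)
    (fun x y hxy => hF.1 fun s hs => by
      by_cases hsm : s = m
      · subst hsm; simp
      · simp only [Function.update_of_ne hsm]
        exact hxy s (by simp_all))
    (fun x => hF0 _) (fun x => hF1 _)
    (fun j hj => by
      by_cases hjn : j = n
      · have : m - n + (j : ℤ) = m := by rw [hjn]; ring
        rw [this, Finset.insert_erase hmS]
        exact hF.const_mul _
      · simp only [if_neg hjn, zero_mul]
        exact IsLocal.const _ _)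
    (fun j _ i => by positivity)
    (fun j _ x => by
      by_cases hjn : j = n
      · have : m - n + (j : ℤ) = m := by rw [hjn]; ring
        rw [this]
        by_cases hx : x m = g₀
        · simp [hjn, ← hx]
        · simp [hx, hF0, hjn]
      · simp [hjn])
    (fun j _ x => by
      by_cases hjn : j = n
      · have : m - n + (j : ℤ) = m := by rw [hjn]; ring
        rw [this]
        by_cases hx : x m = g₀
        · simp [hjn, ← hx]
        · simp [hx, hF1, hjn]
      · simp [hjn])
    hδ
  simp_rw [hDj] at key
  simpa using key

section Uniqueness

variable {G : Type*} [Countable G] [MeasurableSpace G] [MeasurableSingletonClass G]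
  {θ : ℕ → ℝ} {P : ℕ → G → G → ℝ}

theorem IsImitation_s19.isContrast (h : IsImitation_s19 θ P) {μ ν : Measure (ℤ → G)}
    [IsProbabilityMeasure μ] [IsProbabilityMeasure ν] (hμ : CompatibleC θ P μ)
    (hν : CompatibleC θ P ν) {r : ℕ} {c : ℝ}
    (hr : ∀ S F, S.card ≤ r → IsLocal S F → ∫ x, F x ∂μ - ∫ x, F x ∂ν = 0)
    (hc : ∀ S F, S.card ≤ r + 1 → IsLocal S F → (∀ x, 0 ≤ F x) → (∀ x, F x ≤ 1) →
      ∫ x, F x ∂μ - ∫ x, F x ∂ν ≤ c) :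
    IsContrast θ P r c fun F : (ℤ → G) → ℝ => ∫ x, F x ∂μ - ∫ x, F x ∂ν where
  add S F F' hF hF' := by
    simp only
    rw [integral_add (hF.integrable μ) (hF'.integrable μ),
      integral_add (hF.integrable ν) (hF'.integrable ν)]
    ring
  const_mul a F := by
    simp only
    rw [integral_const_mul, integral_const_mul]
    ring
  eq_zero S F hS hF := hr S F hS hF
  le_mul S F u hS hF hF0 hFu := by
    obtain ⟨x₀⟩ : Nonempty (ℤ → G) := by
      by_contra hne
      rw [not_nonempty_iff] at hne
      have := measure_univ (μ := μ)
      rw [Measure.eq_zero_of_isEmpty μ] at this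
      simp at this
    rcases ((hF0 x₀).trans (hFu x₀)).eq_or_lt with hu | hu
    · have hz : ∀ x, F x = 0 := fun x => le_antisymm ((hFu x).trans_eq hu.symm) (hF0 x)
      simp [hz, ← hu]
    · have h1 := hc S (fun x => u⁻¹ * F x) hS (hF.const_mul _)
        (fun x => mul_nonneg (inv_nonneg.2 hu.le) (hF0 x))
        (fun x => (inv_mul_le_one₀ hu).2 (hFu x))
      rw [integral_const_mul, integral_const_mul, ← mul_sub, inv_mul_le_iff₀ hu] at h1
      linarith
  hasSum_copyOp m S F hS hF hF0 := by
    simp only [mul_sub]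
    exact (h.hasSum_integral_copyOp hμ hS hF hF0).sub (h.hasSum_integral_copyOp hν hS hF hF0)

theorem IsImitation_s19.integral_eq [DecidableEq G] (h : IsImitation_s19 θ P) {g₀ : G} {n : ℕ} {ε : ℝ}
    (hDb : IsDoeblin θ P g₀ n ε) {μ ν : Measure (ℤ → G)}
    [IsProbabilityMeasure μ] [IsProbabilityMeasure ν] (hμ : CompatibleC θ P μ)
    (hν : CompatibleC θ P ν) (r : ℕ) :
    ∀ S F, S.card ≤ r → IsLocal S F → ∫ x, F x ∂μ - ∫ x, F x ∂ν = 0 := by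
  have : Nonempty G := ⟨g₀⟩
  obtain ⟨δ, hδ0, hδ⟩ := hDb.exists_le_pushDown h.theta_nonneg h.theta_sum h.ker_nonneg h.ker_sum
  induction r with
  | zero =>
    intro S F hS hF
    obtain ⟨a, rfl⟩ := hF.exists_eq_const (Nat.le_zero.1 hS)
    simp
  | succ r ih =>
    set T : Set ℝ := {y | ∃ S F, S.card ≤ r + 1 ∧ IsLocal S F ∧ (∀ x, 0 ≤ F x) ∧ (∀ x, F x ≤ 1) ∧
      y = ∫ x, F x ∂μ - ∫ x, F x ∂ν} with hT
    have hbdd : BddAbove T := by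
      refine ⟨1, ?_⟩
      rintro y ⟨S, F, -, hF, hF0, hF1, rfl⟩
      have h1 : ∫ x, F x ∂μ ≤ 1 :=
        (integral_mono (hF.integrable μ) (integrable_const 1) hF1).trans_eq (by simp)
      have h2 : 0 ≤ ∫ x, F x ∂ν := integral_nonneg hF0
      linarith
    have h0T : (0 : ℝ) ∈ T :=
      ⟨∅, fun _ => 0, by simp, IsLocal.const _ _, fun _ => le_rfl, fun _ => zero_le_one, by simp⟩
    have hc0 : 0 ≤ sSup T := le_csSup hbdd h0T
    have hD := h.isContrast hμ hν (c := sSup T) ih fun S F hS hF hF0 hF1 =>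
      le_csSup hbdd ⟨S, F, hS, hF, hF0, hF1, rfl⟩
    have hcle : sSup T ≤ sSup T * (1 - min δ 1) := by
      refine csSup_le ⟨0, h0T⟩ ?_
      rintro y ⟨S, F, hS, hF, hF0, hF1, rfl⟩
      exact hD.le_mul_one_sub h hc0 (min_le_right _ _) (fun i => (min_le_left _ _).trans (hδ i))
        hS hF hF0 hF1
    have hc : sSup T = 0 := by
      have : 0 < min δ 1 := lt_min hδ0 one_pos
      nlinarith
    rw [hc] at hD
    have hneg : ∀ S F, S.card ≤ r + 1 → IsLocal S F → ∫ x, F x ∂μ - ∫ x, F x ∂ν ≤ 0 := by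
      intro S F hS hF
      obtain ⟨C, hC⟩ := hF.2
      have h1 := hD.add S F (fun _ => C) hF (IsLocal.const _ _)
      have h2 := hD.le_mul S (fun x => F x + C) (C + C) hS (hF.add (IsLocal.const _ _))
        (fun x => by linarith [(abs_le.1 (hC x)).1]) (fun x => by linarith [(abs_le.1 (hC x)).2])
      have h3 := hD.eq_zero ∅ (fun _ => C) (by simp) (IsLocal.const _ _)
      linarith
    intro S F hS hF
    have h1 := hneg S F hS hF
    have h2 := hneg S _ hS (hF.const_mul (-1))
    have h3 := hD.const_mul (-1) F
    linarith

theorem IsImitation_s19.eq_of_compatibleC [DecidableEq G] (h : IsImitation_s19 θ P) {g₀ : G} {n : ℕ} {ε : ℝ}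
    (hDb : IsDoeblin θ P g₀ n ε) {μ ν : Measure (ℤ → G)}
    [IsProbabilityMeasure μ] [IsProbabilityMeasure ν] (hμ : CompatibleC θ P μ)
    (hν : CompatibleC θ P ν) : μ = ν := by
  refine ext_of_generate_finite (measurableCylinders fun _ : ℤ => G)
    generateFrom_measurableCylinders.symm isPiSystem_measurableCylinders (fun E hE => ?_) (by simp)
  obtain ⟨S, B, hB, rfl⟩ := (mem_measurableCylinders _).1 hE
  have hmeas : MeasurableSet (cylinder S B : Set (ℤ → G)) := hB.cylinder S
  have hloc : IsLocal S ((cylinder S B : Set (ℤ → G)).indicator fun _ => (1 : ℝ)) := by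
    refine ⟨dependsOn_cylinder_indicator_const (α := fun _ : ℤ => G) (I := S) B (1 : ℝ), 1, fun x => ?_⟩
    by_cases hx : x ∈ (cylinder S B : Set (ℤ → G)) <;> simp [hx]
  have := h.integral_eq hDb hμ hν S.card S _ le_rfl hloc
  rw [integral_indicator_const _ hmeas, integral_indicator_const _ hmeas, smul_eq_mul, smul_eq_mul,
    mul_one, mul_one, sub_eq_zero] at this
  exact (measureReal_eq_measureReal_iff).1 this

end Uniqueness

section Stationary

variable {G : Type*} [DecidableEq G]

theorem exists_stationary_of_minorization {K : G → G → ENNReal} (hK : ∀ i, ∑' j, K i j = 1)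
    {g₀ : G} {η : ENNReal} (hη : η ≠ 0) (hηK : ∀ i, η ≤ K i g₀) :
    ∃ π : G → ENNReal, ∑' i, π i = 1 ∧ ∀ j, ∑' i, π i * K i j = π j := by
  have hη1 : η ≤ 1 := (hηK g₀).trans ((ENNReal.le_tsum g₀).trans_eq (hK g₀))
  have hηt : η ≠ ⊤ := ne_top_of_le_ne_top ENNReal.one_ne_top hη1
  set K' : G → G → ENNReal := fun i j => K i j - if j = g₀ then η else 0
  have hKK' : ∀ i j, K i j = K' i j + if j = g₀ then η else 0 := fun i j => by
    refine (tsub_add_cancel_of_le ?_).symm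
    split_ifs with hj
    · exact hj ▸ hηK i
    · exact zero_le
  have hK' : ∀ i, ∑' j, K' i j = 1 - η := fun i => by
    have h1 := hK i
    simp_rw [hKK', ENNReal.tsum_add, tsum_ite_eq] at h1
    exact ENNReal.eq_sub_of_add_eq hηt h1
  set q : ℕ → G → ENNReal := fun n => Nat.rec (fun j => if j = g₀ then 1 else 0)
    (fun _ v j => ∑' i, v i * K' i j) n
  have hq : ∀ n, ∑' j, q n j = (1 - η) ^ n := fun n => by
    induction n with
    | zero => simp [q]
    | succ n ih =>
      change ∑' j, ∑' i, q n i * K' i j = _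
      rw [ENNReal.tsum_comm]
      simp_rw [ENNReal.tsum_mul_left, hK', ENNReal.tsum_mul_right, ih, pow_succ]
  have hsum : ∑' i, η * ∑' n, q n i = 1 := by
    rw [ENNReal.tsum_mul_left, ENNReal.tsum_comm]
    simp_rw [hq]
    rw [ENNReal.tsum_geometric, ENNReal.sub_sub_cancel ENNReal.one_ne_top hη1,
      ENNReal.mul_inv_cancel hη hηt]
  refine ⟨fun i => η * ∑' n, q n i, hsum, fun j => ?_⟩
  simp_rw [hKK', mul_add, ENNReal.tsum_add]
  rw [ENNReal.tsum_mul_right, hsum, one_mul, tsum_eq_zero_add' (f := fun n => q n j)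
    ENNReal.summable, mul_add, add_comm]
  congr 1
  · simp [q]
  · simp_rw [mul_assoc, ENNReal.tsum_mul_left, ← ENNReal.tsum_mul_right]
    rw [ENNReal.tsum_comm]

/-- The one-step kernel obtained by averaging the kernels `P k` with the weights `θ k`. -/
noncomputable def meanKer {G : Type*} (θ : ℕ → ℝ) (P : ℕ → G → G → ℝ) (i j : G) : ENNReal :=
  ∑' k, ENNReal.ofReal (θ k) * ENNReal.ofReal (P k i j)

/-- Powers of `meanKer`. -/
noncomputable def meanKerPow (θ : ℕ → ℝ) (P : ℕ → G → G → ℝ) : ℕ → G → G → ENNReal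
  | 0 => fun i j => if i = j then 1 else 0
  | n + 1 => fun i j => ∑' m, meanKerPow θ P n i m * meanKer θ P m j

variable {θ : ℕ → ℝ} {P : ℕ → G → G → ℝ}

theorem IsImitation_s19.tsum_meanKer {G : Type*} {θ : ℕ → ℝ} {P : ℕ → G → G → ℝ}
    (h : IsImitation_s19 θ P) (i : G) : ∑' j, meanKer θ P i j = 1 := by
  unfold meanKer
  rw [ENNReal.tsum_comm]
  simp_rw [ENNReal.tsum_mul_left, h.tsum_ker, mul_one, h.tsum_theta]

theorem IsImitation_s19.tsum_meanKerPow (h : IsImitation_s19 θ P) (n : ℕ) (i : G) :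
    ∑' j, meanKerPow θ P n i j = 1 := by
  induction n with
  | zero => simp [meanKerPow]
  | succ n ih =>
    simp only [meanKerPow]
    rw [ENNReal.tsum_comm]
    simp_rw [ENNReal.tsum_mul_left, h.tsum_meanKer, mul_one, ih]

theorem IsImitation_s19.wordKc_le_meanKerPow (h : IsImitation_s19 θ P) (l : List ℕ) (i j : G) :
    ENNReal.ofReal (l.map θ).prod * ENNReal.ofReal (wordKc P l i j)
      ≤ meanKerPow θ P l.length i j := by
  induction l generalizing j with
  | nil =>
    simp only [wordKc, meanKerPow, List.map_nil, List.prod_nil, List.length_nil]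
    split_ifs <;> simp
  | cons a l ih =>
    rw [List.length_cons, meanKerPow, List.map_cons, List.prod_cons,
      ENNReal.ofReal_mul (h.theta_nonneg a)]
    refine (mul_le_mul_right (ofReal_wordKc_cons_le h.ker_nonneg a l i j) _).trans ?_
    rw [← ENNReal.tsum_mul_left]
    refine ENNReal.tsum_le_tsum fun m => ?_
    refine le_trans (le_of_eq ?_) (mul_le_mul' (ih m)
      (ENNReal.le_tsum (f := fun k => ENNReal.ofReal (θ k) * ENNReal.ofReal (P k m j)) a))
    ring

theorem IsImitation_s19.exists_stationary (h : IsImitation_s19 θ P) {g₀ : G} {n : ℕ} {ε : ℝ}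
    (hDb : IsDoeblin θ P g₀ n ε) :
    ∃ π : G → ENNReal, ∑' i, π i = 1 ∧ ∀ j, ∑' i, π i * meanKer θ P i j = π j := by
  set K : G → G → ENNReal := fun i j => ∑' n, 2⁻¹ ^ (n + 1) * meanKerPow θ P n i j
  have hgeom : ∑' n : ℕ, (2⁻¹ : ENNReal) ^ (n + 1) = 1 := by
    rw [ENNReal.tsum_geometric_add_one, ENNReal.one_sub_inv_two, inv_inv,
      ENNReal.inv_mul_cancel two_ne_zero ENNReal.ofNat_ne_top]
  have hK : ∀ i, ∑' j, K i j = 1 := fun i => by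
    simp only [K]
    rw [ENNReal.tsum_comm]
    simp_rw [ENNReal.tsum_mul_left, h.tsum_meanKerPow, mul_one, hgeom]
  have hKrec : ∀ i j, K i j = 2⁻¹ * (if i = j then 1 else 0) +
      2⁻¹ * ∑' m, K i m * meanKer θ P m j := fun i j => by
    simp only [K]
    rw [tsum_eq_zero_add' ENNReal.summable]
    congr 1
    · simp [meanKerPow]
    · simp_rw [meanKerPow, ← ENNReal.tsum_mul_left, ← ENNReal.tsum_mul_right, ← ENNReal.tsum_mul_left]
      rw [ENNReal.tsum_comm]
      refine tsum_congr fun m => tsum_congr fun n => ?_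
      rw [pow_succ']
      ring
  obtain ⟨ρ, hρ, hl⟩ := exists_le_prod_map θ n
  have hη : ∀ i, 2⁻¹ ^ (n + 1) * (ENNReal.ofReal ρ * ENNReal.ofReal ε) ≤ K i g₀ := fun i => by
    obtain ⟨l, h1, h2, h3⟩ := hDb.2 i
    obtain ⟨h4, h5⟩ := hl l h1 h2
    refine le_trans ?_ (ENNReal.le_tsum l.length)
    refine mul_le_mul' (pow_le_pow_right_of_le_one' ?_ (by omega))
      ((mul_le_mul' (ENNReal.ofReal_le_ofReal h5) (ENNReal.ofReal_le_ofReal h3)).trans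
        (h.wordKc_le_meanKerPow l i g₀))
    exact ENNReal.inv_le_one.2 one_le_two
  obtain ⟨π, hπ1, hπ⟩ := exists_stationary_of_minorization hK (mul_ne_zero
    (pow_ne_zero _ (ENNReal.inv_ne_zero.2 ENNReal.ofNat_ne_top)) (mul_ne_zero
      (ENNReal.ofReal_pos.2 hρ).ne' (ENNReal.ofReal_pos.2 hDb.1).ne')) hη
  refine ⟨π, hπ1, fun j => ?_⟩
  have h1 : π j = 2⁻¹ * π j + 2⁻¹ * ∑' i, π i * meanKer θ P i j := by
    conv_lhs => rw [← hπ j]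
    simp_rw [hKrec _ j, mul_add, ENNReal.tsum_add]
    congr 1
    · rw [tsum_eq_single j fun i hi => by simp [hi]]
      simp [mul_comm]
    · simp_rw [mul_left_comm _ (2⁻¹ : ENNReal), ENNReal.tsum_mul_left, ← ENNReal.tsum_mul_left]
      rw [ENNReal.tsum_comm]
      simp_rw [← mul_assoc, ENNReal.tsum_mul_right, mul_assoc, ENNReal.tsum_mul_left]
      simp_rw [hπ, mul_assoc, ENNReal.tsum_mul_left]
  have h2 : π j ≠ ⊤ := ne_top_of_le_ne_top ENNReal.one_ne_top ((ENNReal.le_tsum j).trans_eq hπ1)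
  have h3 : π j = 2⁻¹ * π j + 2⁻¹ * π j := by
    rw [← add_mul, ENNReal.inv_two_add_inv_two, one_mul]
  have h4 := (ENNReal.add_right_inj (ENNReal.mul_ne_top (by simp) h2)).1 (h1.symm.trans h3)
  exact (ENNReal.mul_right_inj (by simp) (by simp)).1 h4

end Stationary

theorem IsImitation_s19.nextProb_update {G : Type*} {θ : ℕ → ℝ} {P : ℕ → G → G → ℝ}
    (h : IsImitation_s19 θ P) {n m : ℤ} (hnm : n ≤ m) (x : ℤ → G)
    (g i : G) : nextProb θ P n (Function.update x m g) i = nextProb θ P n x i := by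
  refine tsum_congr fun k => ?_
  rcases Nat.eq_zero_or_pos k with rfl | hk
  · simp [h.theta_zero]
  · rw [Function.update_of_ne (by omega)]

section Resample

variable {G : Type*} [MeasurableSpace G]

/-- Replace the coordinate `m` of a configuration sampled from `μ` by one sampled from the imitation
kernel. -/
noncomputable def resample (θ : ℕ → ℝ) (P : ℕ → G → G → ℝ) (m : ℤ) (μ : Measure (ℤ → G)) :
    Measure (ℤ → G) :=
  Measure.sum fun g =>
    (μ.withDensity fun x => nextProb θ P m x g).map fun x => Function.update x m g

/-- Compatibility with the imitation kernel at the coordinate `n`. -/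
def CompatibleAt (θ : ℕ → ℝ) (P : ℕ → G → G → ℝ) (n : ℤ) (μ : Measure (ℤ → G)) : Prop :=
  ∀ (g : G) (E : Set (ℤ → G)), MeasurableSet[pastSpace G n] E →
    μ (E ∩ {x | x n = g}) = ∫⁻ x in E, nextProb θ P n x g ∂μ

theorem update_mem_iff_of_pastSpace {n m : ℤ} (hnm : n ≤ m) {E : Set (ℤ → G)}
    (hE : MeasurableSet[pastSpace G n] E) (x : ℤ → G) (g : G) :
    Function.update x m g ∈ E ↔ x ∈ E := by
  obtain ⟨B, -, rfl⟩ := hE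
  simp only [Set.mem_preimage]
  have : (fun s : {s : ℤ // s < n} => Function.update x m g s.1) = fun s => x s.1 :=
    funext fun s => Function.update_of_ne (ne_of_lt (s.2.trans_le hnm)) _ _
  rw [this]

variable {θ : ℕ → ℝ} {P : ℕ → G → G → ℝ}

variable [Countable G] [MeasurableSingletonClass G]

theorem IsImitation_s19.lintegral_resample (h : IsImitation_s19 θ P) (m : ℤ) (μ : Measure (ℤ → G))
    {f : (ℤ → G) → ENNReal} (hf : Measurable f) :
    ∫⁻ x, f x ∂(resample θ P m μ)
      = ∑' g, ∫⁻ x, nextProb θ P m x g * f (Function.update x m g) ∂μ := by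
  rw [resample, lintegral_sum_measure]
  refine tsum_congr fun g => ?_
  have hu : Measurable fun x : ℤ → G => Function.update x m g := measurable_update_left
  rw [lintegral_map hf hu]
  exact lintegral_withDensity_eq_lintegral_mul _ (h.measurable_nextProb m g) (hf.comp hu)

theorem IsImitation_s19.lintegral_resample_of_update (h : IsImitation_s19 θ P) (m : ℤ) (μ : Measure (ℤ → G))
    {f : (ℤ → G) → ENNReal} (hf : Measurable f) (hfu : ∀ x g, f (Function.update x m g) = f x) :
    ∫⁻ x, f x ∂(resample θ P m μ) = ∫⁻ x, f x ∂μ := by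
  simp_rw [h.lintegral_resample m μ hf, hfu]
  refine (lintegral_tsum fun g => ((h.measurable_nextProb m g).mul hf).aemeasurable).symm.trans ?_
  refine lintegral_congr fun x => ?_
  simp only [Pi.mul_apply]
  rw [ENNReal.tsum_mul_right, h.tsum_nextProb, one_mul]

theorem IsImitation_s19.resample_apply_of_update (h : IsImitation_s19 θ P) (m : ℤ) (μ : Measure (ℤ → G))
    {E : Set (ℤ → G)} (hE : MeasurableSet E) (hEu : ∀ x g, Function.update x m g ∈ E ↔ x ∈ E) :
    resample θ P m μ E = μ E := by
  rw [← lintegral_indicator_one hE, ← lintegral_indicator_one hE]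
  refine h.lintegral_resample_of_update m μ (measurable_one.indicator hE) fun x g => ?_
  by_cases hx : x ∈ E
  · rw [Set.indicator_of_mem hx, Set.indicator_of_mem ((hEu x g).2 hx)]
    rfl
  · rw [Set.indicator_of_notMem hx, Set.indicator_of_notMem (mt (hEu x g).1 hx)]

theorem IsImitation_s19.setLIntegral_nextProb_resample (h : IsImitation_s19 θ P) {n m : ℤ} (hnm : n ≤ m)
    (μ : Measure (ℤ → G)) (g : G) {E : Set (ℤ → G)} (hE : MeasurableSet[pastSpace G n] E) :
    ∫⁻ x in E, nextProb θ P n x g ∂(resample θ P m μ) = ∫⁻ x in E, nextProb θ P n x g ∂μ := by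
  have hE' := pastSpace_le n E hE
  rw [← lintegral_indicator hE', ← lintegral_indicator hE']
  refine h.lintegral_resample_of_update m μ ((h.measurable_nextProb n g).indicator hE') fun x i => ?_
  have hEu := update_mem_iff_of_pastSpace hnm hE x i
  by_cases hx : x ∈ E
  · rw [Set.indicator_of_mem hx, Set.indicator_of_mem (hEu.2 hx), h.nextProb_update hnm]
  · rw [Set.indicator_of_notMem hx, Set.indicator_of_notMem (mt hEu.1 hx)]

theorem IsImitation_s19.compatibleAt_resample_self (h : IsImitation_s19 θ P) (m : ℤ) (μ : Measure (ℤ → G)) :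
    CompatibleAt θ P m (resample θ P m μ) := by
  intro g E hE
  have hE' := pastSpace_le m E hE
  rw [h.setLIntegral_nextProb_resample le_rfl μ g hE,
    ← lintegral_indicator_one (hE'.inter (measurableSet_eval_eq m g)),
    h.lintegral_resample m μ (measurable_one.indicator (hE'.inter (measurableSet_eval_eq m g))),
    ← lintegral_indicator hE', tsum_eq_single g]
  · refine lintegral_congr fun x => ?_
    by_cases hx : x ∈ E <;>
      simp [Set.indicator, update_mem_iff_of_pastSpace le_rfl hE, hx]
  · intro i hi
    simp [Set.indicator, hi]

theorem IsImitation_s19.compatibleAt_resample (h : IsImitation_s19 θ P) {n m : ℤ} (hnm : n < m)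
    {μ : Measure (ℤ → G)} (hμ : CompatibleAt θ P n μ) : CompatibleAt θ P n (resample θ P m μ) := by
  intro g E hE
  rw [h.setLIntegral_nextProb_resample hnm.le μ g hE, ← hμ g E hE]
  refine h.resample_apply_of_update m μ
    ((pastSpace_le n E hE).inter (measurableSet_eval_eq n g)) fun x i => ?_
  rw [Set.mem_inter_iff, Set.mem_inter_iff, update_mem_iff_of_pastSpace hnm.le hE,
    Set.mem_ofPred_eq, Set.mem_ofPred_eq, Function.update_of_ne hnm.ne]

theorem lintegral_eval_eq_tsum {μ : Measure (ℤ → G)} {π : G → ENNReal}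
    (hμ : ∀ s g, μ {x | x s = g} = π g) (s : ℤ) (f : G → ENNReal) :
    ∫⁻ x, f (x s) ∂μ = ∑' g, π g * f g := by
  rw [← lintegral_map (μ := μ) (f := f) (g := fun x : ℤ → G => x s) (Measurable.of_discrete)
    (measurable_pi_apply s), lintegral_countable']
  refine tsum_congr fun g => ?_
  rw [Measure.map_apply (measurable_pi_apply s) (measurableSet_singleton g), mul_comm]
  exact congrArg (· * f g) (hμ s g)

theorem IsImitation_s19.marginal_resample (h : IsImitation_s19 θ P) {π : G → ENNReal}
    (hπ : ∀ j, ∑' i, π i * meanKer θ P i j = π j) (m : ℤ) {μ : Measure (ℤ → G)}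
    (hμ : ∀ s g, μ {x | x s = g} = π g) (s : ℤ) (g : G) :
    resample θ P m μ {x | x s = g} = π g := by
  by_cases hsm : s = m
  · subst hsm
    have h1 := h.compatibleAt_resample_self s μ g Set.univ MeasurableSet.univ
    rw [h.setLIntegral_nextProb_resample le_rfl μ g MeasurableSet.univ, Set.univ_inter,
      Measure.restrict_univ] at h1
    rw [h1]
    unfold nextProb
    have hm : ∀ k : ℕ, Measurable fun x : ℤ → G => ENNReal.ofReal (P k (x (s - k)) g) := fun k =>
      (Measurable.of_discrete (f := fun i => ENNReal.ofReal (P k i g))).comp (measurable_pi_apply _)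
    have hk : ∀ k : ℕ, ∫⁻ x, ENNReal.ofReal (θ k) * ENNReal.ofReal (P k (x (s - k)) g) ∂μ
        = ∑' i, ENNReal.ofReal (θ k) * (π i * ENNReal.ofReal (P k i g)) := fun k => by
      rw [lintegral_const_mul _ (hm k), ENNReal.tsum_mul_left,
        lintegral_eval_eq_tsum hμ (s - k) fun i => ENNReal.ofReal (P k i g)]
    rw [lintegral_tsum fun k => ((hm k).const_mul _).aemeasurable, ← hπ g]
    simp_rw [hk, meanKer, ← ENNReal.tsum_mul_left]
    rw [ENNReal.tsum_comm]
    exact tsum_congr fun i => tsum_congr fun k => mul_left_comm _ _ _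
  · rw [h.resample_apply_of_update m μ (measurableSet_eval_eq s g) fun x i => ?_, hμ s g]
    rw [Set.mem_ofPred_eq, Set.mem_ofPred_eq, Function.update_of_ne hsm]

theorem isProbabilityMeasure_of_marginal {μ : Measure (ℤ → G)} {π : G → ENNReal}
    (hπ1 : ∑' i, π i = 1) (hμ : ∀ s g, μ {x | x s = g} = π g) : IsProbabilityMeasure μ := by
  have := lintegral_eval_eq_tsum hμ 0 fun _ => 1
  simp_rw [mul_one, hπ1, lintegral_one] at this
  exact ⟨this⟩

theorem IsImitation_s19.exists_compatibleAt [DecidableEq G] (h : IsImitation_s19 θ P) {π : G → ENNReal}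
    (hπ : ∀ j, ∑' i, π i * meanKer θ P i j = π j) (a : ℤ) (j : ℕ) :
    ∃ μ : Measure (ℤ → G), (∀ s g, μ {x | x s = g} = π g) ∧
      ∀ n, a ≤ n → n < a + j → CompatibleAt θ P n μ := by
  induction j with
  | zero =>
    refine ⟨Measure.sum fun g => π g • Measure.dirac fun _ => g, fun s g => ?_, fun n h1 h2 => ?_⟩
    · rw [Measure.sum_apply _ (measurableSet_eval_eq s g), tsum_eq_single g]
      · simp [Measure.dirac_apply' _ (measurableSet_eval_eq s g)]
      · intro i hi
        simp [Measure.dirac_apply' _ (measurableSet_eval_eq s g), hi]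
    · push_cast at h2
      omega
  | succ j ih =>
    obtain ⟨μ, h1, h2⟩ := ih
    refine ⟨resample θ P (a + j) μ, h.marginal_resample hπ _ h1, fun n h3 h4 => ?_⟩
    rcases lt_or_eq_of_le (show n ≤ a + j by push_cast at h4; omega) with h5 | rfl
    · exact h.compatibleAt_resample h5 (h2 n h3 h5)
    · exact h.compatibleAt_resample_self _ μ

end Resample

theorem exists_isCompact_of_marginal {G : Type*} [Countable G] [MeasurableSpace G] [TopologicalSpace G] [DiscreteTopology G]
    {π : G → ENNReal} (hπ1 : ∑' i, π i = 1) {ε : ENNReal} (hε : 0 < ε) :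
    ∃ K : Set (ℤ → G), IsCompact K ∧
      ∀ μ : Measure (ℤ → G), (∀ s g, μ {x | x s = g} = π g) → μ Kᶜ ≤ ε := by
  obtain ⟨δ, hδ, hδε⟩ := ENNReal.exists_pos_sum_of_countable' hε.ne' ℤ
  have hT := ENNReal.tendsto_tsum_compl_atTop_zero (f := π) (by simp [hπ1])
  choose F hF using fun s => ((tendsto_order.1 hT).2 _ (hδ s)).exists
  refine ⟨Set.univ.pi fun s => (F s : Set G),
    isCompact_univ_pi fun s => (F s).finite_toSet.isCompact, fun μ hμ => ?_⟩
  have hsub : (Set.univ.pi fun s => (F s : Set G))ᶜ ⊆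
      ⋃ s, ⋃ g : {g // g ∉ F s}, {x : ℤ → G | x s = g} := by
    intro x hx
    simp only [Set.mem_compl_iff, Set.mem_univ_pi, not_forall] at hx
    obtain ⟨s, hs⟩ := hx
    exact Set.mem_iUnion.2 ⟨s, Set.mem_iUnion.2 ⟨⟨x s, by simpa using hs⟩, rfl⟩⟩
  refine (measure_mono hsub).trans ((measure_iUnion_le _).trans ?_)
  refine (ENNReal.tsum_le_tsum fun s => ?_).trans hδε.le
  refine (measure_iUnion_le _).trans ?_
  simp_rw [hμ]
  exact (hF s).le

theorem IsImitation_s19.continuous_nextProb {G : Type*} {θ : ℕ → ℝ} {P : ℕ → G → G → ℝ}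
    [TopologicalSpace G] [DiscreteTopology G]
    (h : IsImitation_s19 θ P) (m : ℤ) (g : G) :
    Continuous fun x : ℤ → G => (nextProb θ P m x g).toNNReal := by
  have h1 : Continuous fun x : ℤ → G => ∑' k : ℕ, θ k * P k (x (m - k)) g := by
    refine continuous_tsum (u := θ) (fun k => ?_) h.theta_sum.summable fun k x => ?_
    · exact continuous_const.mul
        ((continuous_of_discreteTopology (f := fun i => P k i g)).comp (continuous_apply _))
    · rw [Real.norm_of_nonneg (mul_nonneg (h.theta_nonneg k) (h.ker_nonneg _ _ _))]
      exact mul_le_of_le_one_right (h.theta_nonneg k) (h.ker_le_one _ _ _)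
  simp_rw [← h.ofReal_tsum m _ g]
  exact continuous_real_toNNReal.comp h1

section Limit

variable {G : Type*} [Countable G] [MeasurableSpace G] [MeasurableSingletonClass G]

theorem exists_tendsto_of_marginal [TopologicalSpace G] [DiscreteTopology G] [BorelSpace (ℤ → G)]
    {π : G → ENNReal} (hπ1 : ∑' i, π i = 1) (ν : ℕ → ProbabilityMeasure (ℤ → G))
    (hν : ∀ N s g, (ν N : Measure (ℤ → G)) {x | x s = g} = π g) :
    ∃ μ, Filter.Tendsto ν (Filter.hyperfilter ℕ) (nhds μ) := by
  have hT : IsTightMeasureSet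
      {((μ : ProbabilityMeasure (ℤ → G)) : Measure (ℤ → G)) | μ ∈ Set.range ν} := by
    rw [isTightMeasureSet_iff_exists_isCompact_measure_compl_le]
    intro ε hε
    obtain ⟨K, hK, h⟩ := exists_isCompact_of_marginal (G := G) hπ1 hε
    refine ⟨K, hK, ?_⟩
    rintro _ ⟨_, ⟨N, rfl⟩, rfl⟩
    exact h _ (hν N)
  obtain ⟨μ, -, hμ⟩ := (isCompact_closure_of_isTightMeasureSet hT).ultrafilter_le_nhds
    ((Filter.hyperfilter ℕ).map ν) (.trans (by simp) (Filter.monotone_principal subset_closure))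
  exact ⟨μ, hμ⟩

variable {θ : ℕ → ℝ} {P : ℕ → G → G → ℝ}

theorem IsImitation_s19.compatibleAt_cylinder_of_tendsto [TopologicalSpace G] [DiscreteTopology G]
    [BorelSpace (ℤ → G)] (h : IsImitation_s19 θ P) {ν : ℕ → ProbabilityMeasure (ℤ → G)}
    {μ : ProbabilityMeasure (ℤ → G)} {l : Filter ℕ} [l.NeBot]
    (hμ : Filter.Tendsto ν l (nhds μ)) {n : ℤ}
    (hν : ∀ᶠ N in l, CompatibleAt θ P n (ν N : Measure (ℤ → G))) (g : G) {E : Set (ℤ → G)}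
    (hE : MeasurableSet[pastSpace G n] E) (hEc : IsClopen E) :
    (μ : Measure (ℤ → G)) (E ∩ {x | x n = g}) = ∫⁻ x in E, nextProb θ P n x g ∂μ := by
  have hfin : ∀ x, ((nextProb θ P n x g).toNNReal : ENNReal) = nextProb θ P n x g := fun x =>
    ENNReal.coe_toNNReal (ne_top_of_le_ne_top ENNReal.one_ne_top (h.nextProb_le_one n x g))
  have hq1 : ∀ x, (nextProb θ P n x g).toNNReal ≤ 1 := fun x => by
    rw [← ENNReal.coe_le_coe, hfin]
    exact h.nextProb_le_one n x g
  have hgc : IsClopen {x : ℤ → G | x n = g} :=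
    (isClopen_discrete {g}).preimage (continuous_apply n)
  have hEm : MeasurableSet E := pastSpace_le n _ hE
  have hbdd : ∀ f : (ℤ → G) → NNReal, (∀ x, f x ≤ 1) → ∀ x y, dist (f x) (f y) ≤ 1 :=
    fun f hf x y => by
      rw [NNReal.dist_eq, abs_le]
      have h1 := (f x).2
      have h2 := (f y).2
      have h3 : (f x : ℝ) ≤ 1 := hf x
      have h4 : (f y : ℝ) ≤ 1 := hf y
      constructor <;> linarith
  let f₁ : BoundedContinuousFunction (ℤ → G) NNReal :=
    ⟨⟨(E ∩ {x | x n = g}).indicator fun _ => 1,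
      (hEc.inter hgc).continuous_indicator continuous_const⟩, 1,
      hbdd ((E ∩ {x | x n = g}).indicator fun _ => 1) fun x => Set.indicator_apply_le' (fun _ => le_rfl) fun _ => zero_le_one⟩
  let f₂ : BoundedContinuousFunction (ℤ → G) NNReal :=
    ⟨⟨E.indicator fun x => (nextProb θ P n x g).toNNReal,
      hEc.continuous_indicator (h.continuous_nextProb n g)⟩, 1,
      hbdd (E.indicator fun x => (nextProb θ P n x g).toNNReal) fun x => Set.indicator_apply_le' (fun _ => hq1 x) fun _ => zero_le_one⟩
  have e₁ : ∀ ρ : Measure (ℤ → G), ∫⁻ x, (f₁ x : ENNReal) ∂ρ = ρ (E ∩ {x | x n = g}) := fun ρ => by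
    rw [← lintegral_indicator_one (hEm.inter (measurableSet_eval_eq n g))]
    refine lintegral_congr fun x => ?_
    change (((E ∩ {x | x n = g}).indicator (fun _ => (1 : NNReal)) x : NNReal) : ENNReal) = _
    by_cases hx : x ∈ E ∩ {x | x n = g}
    · rw [Set.indicator_of_mem hx, Set.indicator_of_mem hx]; rfl
    · rw [Set.indicator_of_notMem hx, Set.indicator_of_notMem hx]; rfl
  have e₂ : ∀ ρ : Measure (ℤ → G), ∫⁻ x, (f₂ x : ENNReal) ∂ρ
      = ∫⁻ x in E, nextProb θ P n x g ∂ρ := fun ρ => by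
    rw [← lintegral_indicator hEm]
    refine lintegral_congr fun x => ?_
    change ((E.indicator (fun x => (nextProb θ P n x g).toNNReal) x : NNReal) : ENNReal) = _
    by_cases hx : x ∈ E
    · rw [Set.indicator_of_mem hx, Set.indicator_of_mem hx, hfin]
    · rw [Set.indicator_of_notMem hx, Set.indicator_of_notMem hx]; rfl
  rw [ProbabilityMeasure.tendsto_iff_forall_lintegral_tendsto] at hμ
  have t₁ := hμ f₁
  have t₂ := hμ f₂
  simp_rw [e₁] at t₁
  simp_rw [e₂] at t₂
  refine tendsto_nhds_unique t₁ (t₂.congr' ?_)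
  filter_upwards [hν] with N hN
  exact (hN g E hE).symm

theorem IsImitation_s19.compatibleAt_of_tendsto [TopologicalSpace G] [DiscreteTopology G]
    [BorelSpace (ℤ → G)] (h : IsImitation_s19 θ P) {ν : ℕ → ProbabilityMeasure (ℤ → G)}
    {μ : ProbabilityMeasure (ℤ → G)} {l : Filter ℕ} [l.NeBot]
    (hμ : Filter.Tendsto ν l (nhds μ)) {n : ℤ}
    (hν : ∀ᶠ N in l, CompatibleAt θ P n (ν N : Measure (ℤ → G))) :
    CompatibleAt θ P n (μ : Measure (ℤ → G)) := by
  intro g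
  set r : (ℤ → G) → {s : ℤ // s < n} → G := fun x s => x s.1 with hr
  have hrm : Measurable r := measurable_pi_lambda _ fun s => measurable_pi_apply s.1
  have hrc : Continuous r := continuous_pi fun s => continuous_apply s.1
  have h₁ : ∀ B, MeasurableSet B → ((μ : Measure (ℤ → G)).restrict {x | x n = g}).map r B
      = (μ : Measure (ℤ → G)) (r ⁻¹' B ∩ {x | x n = g}) := fun B hB => by
    rw [Measure.map_apply hrm hB, Measure.restrict_apply (hrm hB)]
  have h₂ : ∀ B, MeasurableSet B →
      ((μ : Measure (ℤ → G)).withDensity fun x => nextProb θ P n x g).map r B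
      = ∫⁻ x in r ⁻¹' B, nextProb θ P n x g ∂(μ : Measure (ℤ → G)) := fun B hB => by
    rw [Measure.map_apply hrm hB, withDensity_apply _ (hrm hB)]
  have hcyl : ∀ B, MeasurableSet B → IsClopen B →
      ((μ : Measure (ℤ → G)).restrict {x | x n = g}).map r B
      = ((μ : Measure (ℤ → G)).withDensity fun x => nextProb θ P n x g).map r B :=
    fun B hB hBc => by
      rw [h₁ B hB, h₂ B hB]
      exact h.compatibleAt_cylinder_of_tendsto hμ hν g ⟨B, hB, rfl⟩ (hBc.preimage hrc)
  have key : ((μ : Measure (ℤ → G)).restrict {x | x n = g}).map r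
      = ((μ : Measure (ℤ → G)).withDensity fun x => nextProb θ P n x g).map r := by
    refine ext_of_generate_finite _ generateFrom_measurableCylinders.symm
      isPiSystem_measurableCylinders (fun B hB => ?_) (hcyl _ MeasurableSet.univ isClopen_univ)
    obtain ⟨s, S, hS, rfl⟩ := (mem_measurableCylinders _).1 hB
    refine hcyl _ (hS.cylinder s) ?_
    exact (isClopen_discrete S).preimage (by fun_prop)
  rintro _ ⟨B, hB, rfl⟩
  rw [← h₁ B hB, key, h₂ B hB]

theorem IsImitation_s19.exists_compatibleC [DecidableEq G] (h : IsImitation_s19 θ P) {g₀ : G} {n : ℕ}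
    {ε : ℝ} (hDb : IsDoeblin θ P g₀ n ε) :
    ∃ μ : Measure (ℤ → G), IsProbabilityMeasure μ ∧ CompatibleC θ P μ := by
  let _ : TopologicalSpace G := ⊥
  have : DiscreteTopology G := ⟨rfl⟩
  obtain ⟨π, hπ1, hπ⟩ := h.exists_stationary hDb
  choose ν hν1 hν2 using fun N : ℕ => h.exists_compatibleAt hπ (-N) (2 * N + 1)
  have hp : ∀ N, IsProbabilityMeasure (ν N) := fun N =>
    isProbabilityMeasure_of_marginal hπ1 (hν1 N)
  obtain ⟨μ, hμ⟩ := exists_tendsto_of_marginal hπ1 (fun N => ⟨ν N, hp N⟩) hν1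
  refine ⟨μ, inferInstance, (h.compatibleC_iff _).2 fun m => ?_⟩
  refine h.compatibleAt_of_tendsto hμ ?_
  have : ∀ᶠ N in Filter.atTop, CompatibleAt θ P m (ν N) := by
    filter_upwards [Filter.eventually_ge_atTop m.natAbs] with N hN
    exact hν2 N m (by omega) (by push_cast; omega)
  exact Nat.hyperfilter_le_atTop this

end Limit

open Classical in
/-- The kernels of `P` with index in `A`, completed by the identity kernel off `A`. -/
noncomputable def extendKer {G : Type*} (A : Set ℕ) (P : ℕ → G → G → ℝ) (k : ℕ) (i j : G) : ℝ :=
  if k ∈ A then P k i j else if i = j then 1 else 0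

theorem extendKer_of_mem {G : Type*} {A : Set ℕ} (P : ℕ → G → G → ℝ) {k : ℕ} (hk : k ∈ A) :
    extendKer A P k = P k := by
  funext i j
  exact if_pos hk

theorem wordKc_extendKer {G : Type*} [DecidableEq G] {A : Set ℕ} (P : ℕ → G → G → ℝ)
    {l : List ℕ} (hl : ∀ a ∈ l, a ∈ A) : wordKc (extendKer A P) l = wordKc P l := by
  induction l with
  | nil => rfl
  | cons a l ih =>
    funext i j
    simp only [wordKc]
    rw [ih fun b hb => hl b (List.mem_cons_of_mem _ hb),
      extendKer_of_mem P (hl a List.mem_cons_self)]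

theorem compatibleC_extendKer_iff {G : Type*} [MeasurableSpace G] {A : Set ℕ} {θ : ℕ → ℝ}
    (hθ : ∀ k, k ∉ A → θ k = 0) (P : ℕ → G → G → ℝ) (μ : Measure (ℤ → G)) :
    CompatibleC θ (extendKer A P) μ ↔ CompatibleC θ P μ := by
  have h : ∀ k i j, θ k * extendKer A P k i j = θ k * P k i j := fun k i j => by
    by_cases hk : k ∈ A
    · rw [extendKer_of_mem P hk]
    · rw [hθ k hk, zero_mul, zero_mul]
  simp only [CompatibleC, h]

theorem isImitation_extendKer {G : Type*} {A : Set ℕ} (hApos : ∀ k ∈ A, 0 < k) {θ : ℕ → ℝ}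
    (hθpos : ∀ k ∈ A, 0 < θ k) (hθ0 : ∀ k, k ∉ A → θ k = 0) (hθsum : HasSum θ 1)
    {P : ℕ → G → G → ℝ} (hPnn : ∀ k ∈ A, ∀ i j : G, 0 ≤ P k i j)
    (hProw : ∀ k ∈ A, ∀ i : G, HasSum (fun j : G => P k i j) 1) :
    IsImitation_s19 θ (extendKer A P) where
  theta_nonneg k := by
    by_cases hk : k ∈ A
    · exact (hθpos k hk).le
    · exact (hθ0 k hk).ge
  theta_zero := hθ0 0 fun h => (hApos 0 h).false
  theta_sum := hθsum
  ker_nonneg k i j := by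
    by_cases hk : k ∈ A
    · rw [extendKer_of_mem P hk]
      exact hPnn k hk i j
    · rw [extendKer, if_neg hk]
      split_ifs <;> norm_num
  ker_sum k i := by
    by_cases hk : k ∈ A
    · rw [extendKer_of_mem P hk]
      exact hProw k hk i
    · classical
      have h : extendKer A P k i = fun j => if j = i then 1 else 0 := by
        funext j
        rw [extendKer, if_neg hk]
        exact if_congr eq_comm rfl rfl
      rw [h]
      exact hasSum_ite_eq i 1

/-- on a countably infinite alphabet, under the Doeblin-type
Hypothesis D (some state `g₀`, depth `n̄₀` and `ε > 0` with
`P_{𝐛_i}(i, g₀) ≥ ε` for every `i`, where `s(𝐛_i) = n̄₀`), the set `𝒢(p)` has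
exactly one element. -/
theorem stmt_19 {G : Type*} [Countable G] [Infinite G] [DecidableEq G]
    [MeasurableSpace G] [MeasurableSingletonClass G]
    (A : Set ℕ) (hA : A.Nonempty) (hApos : ∀ k ∈ A, 0 < k)
    (θ : ℕ → ℝ) (hθpos : ∀ k ∈ A, 0 < θ k) (hθ0 : ∀ k, k ∉ A → θ k = 0)
    (hθsum : HasSum θ 1)
    (P : ℕ → G → G → ℝ)
    (hPnn : ∀ k ∈ A, ∀ i j : G, 0 ≤ P k i j)
    (hProw : ∀ k ∈ A, ∀ i : G, HasSum (fun j : G => P k i j) 1)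
    (g₀ : G) (n₀ : ℕ) (hn₀ : 0 < n₀) (ε : ℝ) (hε : 0 < ε)
    (hDoeblin : ∀ i : G, ∃ l : List ℕ, IsWord A l ∧ l.sum = n₀ ∧
      ε ≤ wordKc P l i g₀) :
    ∃! μ : Measure (ℤ → G), IsProbabilityMeasure μ ∧ CompatibleC θ P μ := by
  have h := isImitation_extendKer hApos hθpos hθ0 hθsum hPnn hProw
  have hDb : IsDoeblin θ (extendKer A P) g₀ n₀ ε := by
    refine ⟨hε, fun i => ?_⟩
    obtain ⟨l, hl, hsum, hle⟩ := hDoeblin i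
    refine ⟨l, fun a ha => ⟨hApos a (hl.2 a ha), hθpos a (hl.2 a ha)⟩, hsum, ?_⟩
    rwa [wordKc_extendKer P hl.2]
  obtain ⟨μ, hμ, hμc⟩ := h.exists_compatibleC hDb
  refine ⟨μ, ⟨hμ, (compatibleC_extendKer_iff hθ0 P μ).1 hμc⟩, ?_⟩
  rintro ν ⟨hν, hνc⟩
  exact h.eq_of_compatibleC hDb ((compatibleC_extendKer_iff hθ0 P ν).2 hνc) hμc
end
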